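/- Let Q̃ and h̃ be as in the context, with h̃ satisfying μ₃φ^{5λ/4+1/2} ≤ h̃(φ) ≤ μ₄φ^{5λ/4+1/2} and h̃'(φ) ≥ 0 on (0,ζ). Then the homogeneous characteristic system W_φ + b^{1/2}(Q̃)W_ψ = 0, Z_φ − b^{1/2}(Q̃)Z_ψ = 0 on (0,ζ)×(0,m), with boundary conditions W + Z = 0 on {ψ = 0} and W + Z = h̃ on {ψ = m} and initial conditions W(0,·) = Z(0,·) = 0, admits a unique weak solution (W,Z) ∈ L^∞((0,ζ)×(0,m))² satisfying lim_{φ→0⁺} ess sup_{ψ∈(0,m)} max(|W(φ,ψ)|, |Z(φ,ψ)|) = 0. Moreover there exist constants 0 < μ₆ ≤ μ₇ depending only on γ, m, λ, μ₁, μ₂, μ₃, μ₄ such that, for a.e. (φ,ψ) ∈ (0,ζ)×(0,m): −μ₇φ^{λ+1} ≤ W(φ,ψ) ≤ −μ₆φ^{λ+1}; μ₆φ^{λ+1} ≤ Z(φ,ψ) ≤ μ₇φ^{λ+1}; and 0 ≤ W(φ,ψ) + Z(φ,ψ) ≤ μ₄φ^{5λ/4+1/2}. -/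

import Mathlib

open Real Set MeasureTheory Filter

noncomputable section

/-- The density function `ρ(t) = (1 − ((γ−1)/2) t)^{1/(γ−1)}`. -/
def rhoF (γ t : ℝ) : ℝ := (1 - (γ - 1) / 2 * t) ^ ((1 : ℝ) / (γ - 1))

/-- The critical (sonic) speed `c_* = (2/(γ+1))^{1/2}`. -/
def cstar (γ : ℝ) : ℝ := Real.sqrt (2 / (γ + 1))

/-- The maximal speed `q_max = (2/(γ−1))^{1/2}`. -/
def qmaxF (γ : ℝ) : ℝ := Real.sqrt (2 / (γ - 1))

/-- `A(q) = ∫_{c_*}^q (ρ(s²)+2s²ρ'(s²))/(s ρ(s²)²) ds`. -/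
def Afun (γ q : ℝ) : ℝ :=
  ∫ s in (cstar γ)..q,
    (rhoF γ (s ^ 2) + 2 * s ^ 2 * deriv (rhoF γ) (s ^ 2)) / (s * (rhoF γ (s ^ 2)) ^ 2)

/-- `B(q) = ∫_{c_*}^q ρ(s²)/s ds`. -/
def Bfun (γ q : ℝ) : ℝ := ∫ s in (cstar γ)..q, rhoF γ (s ^ 2) / s

/-- Inverse of `A` restricted to `[c_*, q_max)`. -/
def AplusInv (γ : ℝ) : ℝ → ℝ := Function.invFunOn (Afun γ) (Ico (cstar γ) (qmaxF γ))

/-- `K(s) = B(A₊⁻¹(s))`. -/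
def Kfun (γ s : ℝ) : ℝ := Bfun γ (AplusInv γ s)

/-- `b(s) = −K'(s)`. -/
def bfun (γ s : ℝ) : ℝ := -deriv (Kfun γ) s

/-- `p(s) = −K''(s)`. -/
def pfun (γ s : ℝ) : ℝ := -deriv (deriv (Kfun γ)) s

/-- Partial derivative in the first (potential) variable. -/
def pdx (u : ℝ × ℝ → ℝ) (p : ℝ × ℝ) : ℝ := deriv (fun x => u (x, p.2)) p.1

/-- Partial derivative in the second (stream) variable. -/
def pdy (u : ℝ × ℝ → ℝ) (p : ℝ × ℝ) : ℝ := deriv (fun y => u (p.1, y)) p.2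

/-- The Chaplygin equation (⋆) at a point. -/
def chap (γ : ℝ) (q : ℝ × ℝ → ℝ) (p : ℝ × ℝ) : Prop :=
  pdx (pdx fun z => Afun γ (q z)) p + pdy (pdy fun z => Bfun γ (q z)) p = 0

/-- `W̃ = Q̃_φ − b^{1/2}(Q̃) Q̃_ψ`. -/
def Wtil (γ : ℝ) (Qt : ℝ × ℝ → ℝ) (p : ℝ × ℝ) : ℝ :=
  pdx Qt p - Real.sqrt (bfun γ (Qt p)) * pdy Qt p

/-- `Z̃ = −Q̃_φ − b^{1/2}(Q̃) Q̃_ψ`. -/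
def Ztil (γ : ℝ) (Qt : ℝ × ℝ → ℝ) (p : ℝ × ℝ) : ℝ :=
  -pdx Qt p - Real.sqrt (bfun γ (Qt p)) * pdy Qt p

/-- The structural hypotheses on the background state `Q̃` on `(0,ζ)×(0,m)`. -/
def QtOK (γ lam ζ m μ1 μ2 β1 β2 β3 : ℝ) (Qt : ℝ × ℝ → ℝ) : Prop :=
  (∃ L : NNReal, LipschitzOnWith L Qt (Icc 0 ζ ×ˢ Icc 0 m)) ∧
  (∀ p ∈ Ioo (0 : ℝ) ζ ×ˢ Ioo (0 : ℝ) m,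
    -μ2 * p.1 ^ (lam + 2) ≤ Qt p ∧ Qt p ≤ -μ1 * p.1 ^ (lam + 2)) ∧
  (∀ᵐ p ∂(volume.restrict (Ioo (0 : ℝ) ζ ×ˢ Ioo (0 : ℝ) m)),
    (-β2 * p.1 ^ (lam + 1) ≤ pdx Qt p ∧ pdx Qt p ≤ -β1 * p.1 ^ (lam + 1)) ∧
    |pdy Qt p| ≤ β3 * p.1 ^ (3 * lam / 2 + 1))

/-- Weak solution of the characteristic system
`W_φ + b^{1/2}(Q̃) W_ψ = F`, `Z_φ − b^{1/2}(Q̃) Z_ψ = G` with `W(0,·) = Z(0,·) = 0`,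
`W + Z = 0` on `{ψ = 0}`, and `W + Z = h̃` on `{ψ = m}` (`h̃ = 0` for homogeneous
boundary data), in the sense of the paper. -/
def HypWeakSol (γ ζ m : ℝ) (Qt : ℝ × ℝ → ℝ) (F G : ℝ × ℝ → ℝ) (hb : ℝ → ℝ)
    (W Z : ℝ × ℝ → ℝ) : Prop :=
  ∀ ξ η : ℝ × ℝ → ℝ, ContDiff ℝ 1 ξ → ContDiff ℝ 1 η →
    (∀ ψ ∈ Icc (0 : ℝ) m, ξ (ζ, ψ) = 0 ∧ η (ζ, ψ) = 0) →
    (∀ φ ∈ Icc (0 : ℝ) ζ, ξ (φ, 0) = -η (φ, 0) ∧ ξ (φ, m) = -η (φ, m)) →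
    (∫ p in Ioo (0 : ℝ) ζ ×ˢ Ioo (0 : ℝ) m,
        (W p * pdx ξ p + Real.sqrt (bfun γ (Qt p)) * W p * pdy ξ p
          + 1 / 2 * (Real.sqrt (bfun γ (Qt p)))⁻¹ * pfun γ (Qt p) * pdy Qt p * W p * ξ p
          + F p * ξ p))
    + (∫ p in Ioo (0 : ℝ) ζ ×ˢ Ioo (0 : ℝ) m,
        (Z p * pdx η p - Real.sqrt (bfun γ (Qt p)) * Z p * pdy η p
          - 1 / 2 * (Real.sqrt (bfun γ (Qt p)))⁻¹ * pfun γ (Qt p) * pdy Qt p * Z p * η p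
          + G p * η p))
    - (∫ φ in Ioo (0 : ℝ) ζ, Real.sqrt (bfun γ (Qt (φ, m))) * hb φ * ξ (φ, m)) = 0

/-- `ess sup_{ψ} max(|W|,|Z|)(φ,·) → 0` as `φ → 0⁺`. -/
def VanishAtSonic (ζ m : ℝ) (W Z : ℝ × ℝ → ℝ) : Prop :=
  ∀ η > 0, ∃ φ0 > 0,
    ∀ᵐ p ∂(volume.restrict (Ioo (0 : ℝ) (min φ0 ζ) ×ˢ Ioo (0 : ℝ) m)),
      |W p| ≤ η ∧ |Z p| ≤ η


open Real Set MeasureTheory Filter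


/-! ### Part A: the functions `b` and `p` -/

/-- `r(q) = 1 - (γ-1)/2 q²`. -/
def rr (γ q : ℝ) : ℝ := 1 - (γ - 1) / 2 * q ^ 2

/-- `D(q) = (γ+1)/2 q² - 1`. -/
def dd (γ q : ℝ) : ℝ := (γ + 1) / 2 * q ^ 2 - 1

/-- The derivative of `A`. -/
def fA (γ q : ℝ) : ℝ := -(dd γ q * rr γ q ^ (-(1 / (γ - 1)) - 1) / q)

/-- The derivative of `B`. -/
def fB (γ q : ℝ) : ℝ := rr γ q ^ (1 / (γ - 1)) / q

/-- `b` as a function of `q`. -/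
def bq (γ q : ℝ) : ℝ := rr γ q ^ (2 * (1 / (γ - 1)) + 1) / dd γ q

lemma cstar_pos {γ : ℝ} (hγ : 1 < γ) : 0 < cstar γ := by
  unfold cstar; apply Real.sqrt_pos.2; apply div_pos <;> linarith

lemma cstar_lt {γ : ℝ} (hγ : 1 < γ) : cstar γ < qmaxF γ := by
  unfold cstar qmaxF
  apply Real.sqrt_lt_sqrt
  · apply div_nonneg <;> linarith
  · apply div_lt_div_of_pos_left <;> linarith

lemma rr_pos {γ q : ℝ} (hγ : 1 < γ) (h0 : 0 ≤ q) (h : q < qmaxF γ) : 0 < rr γ q := by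
  unfold qmaxF at h
  have h1 : q ^ 2 < 2 / (γ - 1) := (Real.lt_sqrt h0).1 h
  unfold rr
  have h2 : 0 < γ - 1 := by linarith
  rw [lt_div_iff₀ h2] at h1
  nlinarith

lemma rr_le_one {γ q : ℝ} (hγ : 1 < γ) : rr γ q ≤ 1 := by
  unfold rr; nlinarith [sq_nonneg q]

lemma rr_anti {γ q q' : ℝ} (hγ : 1 < γ) (h0 : 0 ≤ q) (h : q ≤ q') : rr γ q' ≤ rr γ q := by
  unfold rr
  have : q ^ 2 ≤ q' ^ 2 := by nlinarith
  nlinarith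

lemma dd_pos {γ q : ℝ} (hγ : 1 < γ) (h : cstar γ < q) : 0 < dd γ q := by
  unfold cstar at h
  have h1 : 2 / (γ + 1) < q ^ 2 := by
    rw [← Real.sqrt_lt' (lt_of_le_of_lt (Real.sqrt_nonneg _) h)]; exact h
  unfold dd
  rw [div_lt_iff₀ (by linarith)] at h1
  nlinarith

lemma dd_cstar {γ : ℝ} (hγ : 1 < γ) : dd γ (cstar γ) = 0 := by
  unfold dd cstar
  rw [Real.sq_sqrt (by apply div_nonneg <;> linarith)]
  field_simp; ring

lemma integrandA {γ q : ℝ} (hγ : 1 < γ) (h0 : 0 < q) (h : q < qmaxF γ) :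
    (rhoF γ (q ^ 2) + 2 * q ^ 2 * deriv (rhoF γ) (q ^ 2)) / (q * (rhoF γ (q ^ 2)) ^ 2)
      = fA γ q := by
  have hr := rr_pos hγ h0.le h
  have hg : γ - 1 ≠ 0 := by linarith
  have hd : deriv (rhoF γ) (q ^ 2) = -(1/2) * rr γ q ^ (1 / (γ - 1) - 1) := by
    have h1 : HasDerivAt (fun t : ℝ => 1 - (γ - 1) / 2 * t) (-((γ - 1) / 2)) (q ^ 2) := by
      simpa using ((hasDerivAt_id (q ^ 2)).const_mul ((γ - 1) / 2)).const_sub 1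
    have h2 := h1.rpow_const (p := 1 / (γ - 1)) (Or.inl hr.ne')
    have h3 : HasDerivAt (rhoF γ) _ (q ^ 2) := h2
    rw [h3.deriv]
    have : (1 - (γ - 1) / 2 * q ^ 2) = rr γ q := rfl
    rw [this]
    field_simp
  have hrho : rhoF γ (q ^ 2) = rr γ q ^ (1 / (γ - 1)) := rfl
  rw [hd, hrho]
  unfold fA
  set e := 1 / (γ - 1) with he
  have e1 : rr γ q ^ (e - 1) = rr γ q ^ e / rr γ q := by
    rw [Real.rpow_sub hr, Real.rpow_one]
  have e2 : rr γ q ^ (-e - 1) = (rr γ q ^ e)⁻¹ / rr γ q := by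
    rw [Real.rpow_sub hr, Real.rpow_one, Real.rpow_neg hr.le]
  rw [e1, e2]
  have hre : rr γ q ^ e ≠ 0 := (Real.rpow_pos_of_pos hr e).ne'
  have hdd : dd γ q = q ^ 2 - rr γ q := by unfold dd rr; ring
  rw [hdd]
  field_simp
  ring

lemma fA_cont {γ : ℝ} (hγ : 1 < γ) : ContinuousOn (fA γ) (Ioo 0 (qmaxF γ)) := by
  intro q hq
  have hr := rr_pos hγ hq.1.le hq.2
  have hq0 : q ≠ 0 := hq.1.ne'
  have h1 : ContinuousAt (rr γ) q := by unfold rr; fun_prop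
  have h2 : ContinuousAt (dd γ) q := by unfold dd; fun_prop
  have h3 := h1.rpow_const (p := (-(1 / (γ - 1)) - 1)) (Or.inl hr.ne')
  exact (((h2.mul h3).div continuousAt_id hq0).neg).continuousWithinAt

lemma fB_cont {γ : ℝ} (hγ : 1 < γ) : ContinuousOn (fB γ) (Ioo 0 (qmaxF γ)) := by
  intro q hq
  have hr := rr_pos hγ hq.1.le hq.2
  have hq0 : q ≠ 0 := hq.1.ne'
  have h1 : ContinuousAt (rr γ) q := by unfold rr; fun_prop
  have h3 := h1.rpow_const (p := (1 / (γ - 1))) (Or.inl hr.ne')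
  exact ((h3.div continuousAt_id hq0)).continuousWithinAt

lemma strictDeriv_of_contOn {f : ℝ → ℝ} {a b x0 q : ℝ} (hf : ContinuousOn f (Ioo a b))
    (h0 : x0 ∈ Ioo a b) (hq : q ∈ Ioo a b) :
    HasStrictDerivAt (fun q => ∫ x in x0..q, f x) (f q) q := by
  have hsub : uIcc x0 q ⊆ Ioo a b := by
    intro x hx
    rw [mem_uIcc] at hx
    rcases hx with hx | hx
    · exact ⟨lt_of_lt_of_le h0.1 hx.1, lt_of_le_of_lt hx.2 hq.2⟩
    · exact ⟨lt_of_lt_of_le hq.1 hx.1, lt_of_le_of_lt hx.2 h0.2⟩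
  apply intervalIntegral.integral_hasStrictDerivAt_right
  · exact (hf.mono hsub).intervalIntegrable
  · exact hf.stronglyMeasurableAtFilter isOpen_Ioo q hq
  · exact hf.continuousAt (isOpen_Ioo.mem_nhds hq)

lemma cstar_mem {γ : ℝ} (hγ : 1 < γ) : cstar γ ∈ Ioo 0 (qmaxF γ) :=
  ⟨cstar_pos hγ, cstar_lt hγ⟩

lemma congr_int {f g : ℝ → ℝ} {a b x0 q : ℝ} (hfg : ∀ x ∈ Ioo a b, f x = g x)
    (h0 : x0 ∈ Ioo a b) (hq : q ∈ Ioo a b) :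
    ∫ x in x0..q, f x = ∫ x in x0..q, g x := by
  apply intervalIntegral.integral_congr
  intro x hx
  apply hfg
  rw [mem_uIcc] at hx
  rcases hx with hx | hx
  · exact ⟨lt_of_lt_of_le h0.1 hx.1, lt_of_le_of_lt hx.2 hq.2⟩
  · exact ⟨lt_of_lt_of_le hq.1 hx.1, lt_of_le_of_lt hx.2 h0.2⟩

lemma Afun_deriv {γ q : ℝ} (hγ : 1 < γ) (hq : q ∈ Ioo 0 (qmaxF γ)) :
    HasStrictDerivAt (Afun γ) (fA γ q) q := by
  refine (strictDeriv_of_contOn (fA_cont hγ) (cstar_mem hγ) hq).congr_of_eventuallyEq ?_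
  filter_upwards [isOpen_Ioo.mem_nhds hq] with x hx
  unfold Afun
  exact (congr_int (fun s hs => integrandA hγ hs.1 hs.2) (cstar_mem hγ) hx).symm

lemma Bfun_deriv {γ q : ℝ} (hγ : 1 < γ) (hq : q ∈ Ioo 0 (qmaxF γ)) :
    HasStrictDerivAt (Bfun γ) (fB γ q) q := by
  exact strictDeriv_of_contOn (fB_cont hγ) (cstar_mem hγ) hq

lemma Afun_cstar (γ : ℝ) : Afun γ (cstar γ) = 0 := by unfold Afun; simp

lemma fA_neg {γ q : ℝ} (hγ : 1 < γ) (hq : q ∈ Ioo (cstar γ) (qmaxF γ)) : fA γ q < 0 := by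
  have h0 : 0 < q := lt_trans (cstar_pos hγ) hq.1
  have := rr_pos hγ h0.le hq.2
  have := dd_pos hγ hq.1
  unfold fA
  have := Real.rpow_pos_of_pos (rr_pos hγ h0.le hq.2) (-(1 / (γ - 1)) - 1)
  rw [neg_lt_zero]; positivity

lemma Ico_sub {γ : ℝ} (hγ : 1 < γ) : Ico (cstar γ) (qmaxF γ) ⊆ Ioo 0 (qmaxF γ) :=
  fun _ hx => ⟨lt_of_lt_of_le (cstar_pos hγ) hx.1, hx.2⟩

lemma Afun_contOn {γ : ℝ} (hγ : 1 < γ) : ContinuousOn (Afun γ) (Ioo 0 (qmaxF γ)) :=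
  fun _ hq => (Afun_deriv hγ hq).hasDerivAt.continuousAt.continuousWithinAt

lemma Afun_anti {γ : ℝ} (hγ : 1 < γ) : StrictAntiOn (Afun γ) (Ico (cstar γ) (qmaxF γ)) := by
  apply strictAntiOn_of_deriv_neg (convex_Ico _ _) ((Afun_contOn hγ).mono (Ico_sub hγ))
  intro x hx
  rw [interior_Ico] at hx
  rw [(Afun_deriv hγ (Ico_sub hγ ⟨hx.1.le, hx.2⟩)).hasDerivAt.deriv]
  exact fA_neg hγ hx

lemma rr_deriv (γ q : ℝ) : HasDerivAt (rr γ) (-((γ - 1) * q)) q := by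
  have := (((hasDerivAt_id q).pow 2).const_mul ((γ - 1) / 2)).const_sub 1
  have h : HasDerivAt (rr γ) _ q := this
  convert h using 1; simp; ring

lemma dd_deriv (γ q : ℝ) : HasDerivAt (dd γ) ((γ + 1) * q) q := by
  have := (((hasDerivAt_id q).pow 2).const_mul ((γ + 1) / 2)).sub_const 1
  have h : HasDerivAt (dd γ) _ q := this
  convert h using 1; simp; ring

lemma Afun_unbdd {γ : ℝ} (hγ : 1 < γ) (N : ℝ) : ∃ q ∈ Ico (cstar γ) (qmaxF γ), Afun γ q ≤ N := by
  have hg : 0 < γ - 1 := by linarith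
  obtain ⟨q1, hq1⟩ := exists_between (cstar_lt hγ)
  have hq1pos : 0 < q1 := lt_trans (cstar_pos hγ) hq1.1
  set e := 1 / (γ - 1) with he
  have hepos : 0 < e := by positivity
  set d0 := dd γ q1 / (qmaxF γ) ^ 2 with hd0
  have hqm : 0 < qmaxF γ := lt_trans hq1pos hq1.2
  have hd0pos : 0 < d0 := by have := dd_pos hγ hq1.1; positivity
  have hder : ∀ x ∈ Ico q1 (qmaxF γ), HasDerivAt (fun q => Afun γ q + d0 * rr γ q ^ (-e))
      (fA γ x + d0 * (x * rr γ x ^ (-e - 1))) x := by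
    intro x hx
    have hx0 : 0 < x := lt_of_lt_of_le hq1pos hx.1
    have h1 := (rr_deriv γ x).rpow_const (p := -e) (Or.inl (rr_pos hγ hx0.le hx.2).ne')
    have h2 := (Afun_deriv hγ ⟨hx0, hx.2⟩).hasDerivAt.add (h1.const_mul d0)
    have h3 : fA γ x + d0 * (x * rr γ x ^ (-e - 1))
        = fA γ x + d0 * (-((γ - 1) * x) * -e * rr γ x ^ (-e - 1)) := by
      have : (γ - 1) * e = 1 := by rw [he]; field_simp
      linear_combination (- d0 * x * rr γ x ^ (-e - 1)) * this
    rw [h3]; exact h2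
  have hanti : AntitoneOn (fun q => Afun γ q + d0 * rr γ q ^ (-e)) (Ico q1 (qmaxF γ)) := by
    apply antitoneOn_of_deriv_nonpos (convex_Ico _ _)
    · exact fun x hx => (hder x hx).continuousAt.continuousWithinAt
    · intro x hx; rw [interior_Ico] at hx
      exact (hder x ⟨hx.1.le, hx.2⟩).differentiableAt.differentiableWithinAt
    · intro x hx; rw [interior_Ico] at hx
      rw [(hder x ⟨hx.1.le, hx.2⟩).deriv]
      have hx0 : 0 < x := lt_trans hq1pos hx.1
      unfold fA
      rw [← he]
      have hrp := Real.rpow_pos_of_pos (rr_pos hγ hx0.le hx.2) (-e - 1)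
      have : d0 * x ≤ dd γ x / x := by
        rw [le_div_iff₀ hx0, hd0, div_mul_eq_mul_div, div_mul_eq_mul_div, div_le_iff₀ (by positivity)]
        have h1 : dd γ q1 ≤ dd γ x := by
          have h0 : q1 ^ 2 ≤ x ^ 2 := by nlinarith [hx.1]
          unfold dd; nlinarith
        have h2 : x * x ≤ qmaxF γ ^ 2 := by nlinarith [hx.2]
        have h3 := dd_pos hγ hq1.1
        have h4 : 0 ≤ dd γ x := by linarith
        calc dd γ q1 * x * x = dd γ q1 * (x * x) := by ring
          _ ≤ dd γ x * qmaxF γ ^ 2 := by gcongr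
      have e3 : dd γ x * rr γ x ^ (-e - 1) / x = dd γ x / x * rr γ x ^ (-e - 1) := by ring
      rw [e3]
      nlinarith
  -- choose q with r(q) small
  have ht : Tendsto (fun x : ℝ => x ^ (-e)) (nhdsWithin 0 (Ioi 0)) atTop :=
    tendsto_rpow_neg_nhdsGT_zero (by linarith)
  set C := Afun γ q1 + d0 * rr γ q1 ^ (-e) with hC
  have hr1 := rr_pos hγ hq1pos.le hq1.2
  have hev : ∀ᶠ x in nhdsWithin (0:ℝ) (Ioi 0), (C - N) / d0 ≤ x ^ (-e) ∧ x < rr γ q1 ∧ 0 < x := by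
    filter_upwards [ht.eventually_ge_atTop ((C - N) / d0), self_mem_nhdsWithin,
      nhdsWithin_le_nhds (Iio_mem_nhds hr1)] with x h1 h2 h3
    exact ⟨h1, h3, h2⟩
  obtain ⟨x, hx1, hx2, hx3⟩ := hev.exists
  have hx4 : x < 1 := lt_of_lt_of_le hx2 (rr_le_one hγ)
  set q := Real.sqrt (2 / (γ - 1) * (1 - x)) with hq
  have hqsq : q ^ 2 = 2 / (γ - 1) * (1 - x) := Real.sq_sqrt (by apply mul_nonneg; positivity; linarith)
  have hrq : rr γ q = x := by unfold rr; rw [hqsq]; field_simp; ring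
  have hq1q : q1 ≤ q := by
    by_contra hcon
    push Not at hcon
    have := rr_anti hγ (Real.sqrt_nonneg _) hcon.le
    rw [← hq, hrq] at this; linarith
  have hqlt : q < qmaxF γ := by
    unfold qmaxF; rw [hq]
    apply Real.sqrt_lt_sqrt
    · apply mul_nonneg; positivity; linarith
    · have : 0 < 2 / (γ - 1) := by positivity
      nlinarith
  refine ⟨q, ⟨by linarith [hq1.1], hqlt⟩, ?_⟩
  have := hanti ⟨le_refl _, hq1.2⟩ ⟨hq1q, hqlt⟩ hq1q
  simp only [hrq] at this
  rw [div_le_iff₀ hd0pos] at hx1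
  linarith

lemma Afun_surj {γ s : ℝ} (hγ : 1 < γ) (hs : s ≤ 0) : ∃ q ∈ Ico (cstar γ) (qmaxF γ), Afun γ q = s := by
  obtain ⟨q, hq, hqN⟩ := Afun_unbdd hγ s
  have hsub : Icc (cstar γ) q ⊆ Ico (cstar γ) (qmaxF γ) := fun x hx => ⟨hx.1, lt_of_le_of_lt hx.2 hq.2⟩
  have := intermediate_value_Icc' hq.1 ((Afun_contOn hγ).mono (hsub.trans (Ico_sub hγ)))
  obtain ⟨x, hx, hx2⟩ := this ⟨hqN, by rw [Afun_cstar]; exact hs⟩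
  exact ⟨x, hsub hx, hx2⟩

lemma AplusInv_mem {γ s : ℝ} (hγ : 1 < γ) (hs : s ≤ 0) : AplusInv γ s ∈ Ico (cstar γ) (qmaxF γ) :=
  Function.invFunOn_mem (Afun_surj hγ hs)

lemma AplusInv_eq {γ s : ℝ} (hγ : 1 < γ) (hs : s ≤ 0) : Afun γ (AplusInv γ s) = s :=
  Function.invFunOn_eq (Afun_surj hγ hs)

lemma AplusInv_mem' {γ s : ℝ} (hγ : 1 < γ) (hs : s < 0) : AplusInv γ s ∈ Ioo (cstar γ) (qmaxF γ) := by
  have h := AplusInv_mem hγ hs.le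
  refine ⟨lt_of_le_of_ne h.1 ?_, h.2⟩
  intro h2
  have h3 := AplusInv_eq hγ hs.le
  rw [← h2, Afun_cstar] at h3; linarith

lemma AplusInv_deriv {γ s : ℝ} (hγ : 1 < γ) (hs : s < 0) :
    HasDerivAt (AplusInv γ) (fA γ (AplusInv γ s))⁻¹ s := by
  have hm := AplusInv_mem' hγ hs
  have hA := Afun_deriv hγ (Ico_sub hγ (AplusInv_mem hγ hs.le))
  have hne := (fA_neg hγ hm).ne
  have hl := hA.to_localInverse hne
  have hli : ∀ᶠ y in nhds (Afun γ (AplusInv γ s)), Afun γ (hA.localInverse _ _ _ hne y) = y :=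
    HasStrictFDerivAt.eventually_right_inverse (hA.hasStrictFDerivAt_equiv hne)
  have hval : hA.localInverse _ _ _ hne (Afun γ (AplusInv γ s)) = AplusInv γ s :=
    HasStrictFDerivAt.localInverse_apply_image (hA.hasStrictFDerivAt_equiv hne)
  have hcont := hl.hasDerivAt.continuousAt
  have hmem : ∀ᶠ y in nhds (Afun γ (AplusInv γ s)),
      hA.localInverse _ _ _ hne y ∈ Ioo (cstar γ) (qmaxF γ) :=
    hcont.eventually_mem (isOpen_Ioo.mem_nhds (by rw [hval]; exact hm))
  rw [AplusInv_eq hγ hs.le] at hl hli hmem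
  refine hl.hasDerivAt.congr_of_eventuallyEq ?_
  filter_upwards [hli, hmem, Iio_mem_nhds hs] with y h1 h2 h3
  have h3' : y ≤ 0 := le_of_lt h3
  apply (Afun_anti hγ).injOn (AplusInv_mem hγ h3') ⟨h2.1.le, h2.2⟩
  rw [AplusInv_eq hγ h3', h1]

lemma Kfun_deriv {γ s : ℝ} (hγ : 1 < γ) (hs : s < 0) :
    HasDerivAt (Kfun γ) (-(bq γ (AplusInv γ s))) s := by
  have hm := AplusInv_mem' hγ hs
  have hB := (Bfun_deriv hγ (Ico_sub hγ (AplusInv_mem hγ hs.le))).hasDerivAt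
  have h := hB.comp s (AplusInv_deriv hγ hs)
  have h' : HasDerivAt (Kfun γ) _ s := h
  convert h' using 1
  set q := AplusInv γ s
  have hq0 : 0 < q := lt_trans (cstar_pos hγ) hm.1
  have hr := rr_pos hγ hq0.le hm.2
  have hd := dd_pos hγ hm.1
  unfold bq fB fA
  set e := 1 / (γ - 1)
  have e2 : rr γ q ^ (-e - 1) = (rr γ q ^ e)⁻¹ / rr γ q := by
    rw [Real.rpow_sub hr, Real.rpow_one, Real.rpow_neg hr.le]
  have e3 : rr γ q ^ (2 * e + 1) = (rr γ q ^ e) ^ 2 * rr γ q := by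
    rw [Real.rpow_add hr, Real.rpow_one, mul_comm 2 e, Real.rpow_mul hr.le]; norm_cast
  rw [e2, e3]
  have hre : rr γ q ^ e ≠ 0 := (Real.rpow_pos_of_pos hr e).ne'
  field_simp

lemma bfun_eq {γ s : ℝ} (hγ : 1 < γ) (hs : s < 0) : bfun γ s = bq γ (AplusInv γ s) := by
  unfold bfun; rw [(Kfun_deriv hγ hs).deriv]; ring

/-- derivative of `bq`. -/
def bq' (γ q : ℝ) : ℝ :=
  (-((γ - 1) * q) * (2 * (1 / (γ - 1)) + 1) * rr γ q ^ (2 * (1 / (γ - 1)) + 1 - 1) * dd γ q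
    - rr γ q ^ (2 * (1 / (γ - 1)) + 1) * ((γ + 1) * q)) / dd γ q ^ 2

lemma bfun_deriv {γ s : ℝ} (hγ : 1 < γ) (hs : s < 0) :
    HasDerivAt (bfun γ) (bq' γ (AplusInv γ s) * (fA γ (AplusInv γ s))⁻¹) s := by
  have hm := AplusInv_mem' hγ hs
  have hq0 : 0 < AplusInv γ s := lt_trans (cstar_pos hγ) hm.1
  have hr := rr_pos hγ hq0.le hm.2
  have hd := dd_pos hγ hm.1
  have h1 := (rr_deriv γ (AplusInv γ s)).rpow_const (p := 2 * (1 / (γ - 1)) + 1) (Or.inl hr.ne')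
  have h2 := h1.div (dd_deriv γ _) hd.ne'
  have h3 := HasDerivAt.comp s h2 (AplusInv_deriv hγ hs)
  refine h3.congr_of_eventuallyEq ?_
  filter_upwards [Iio_mem_nhds hs] with y hy
  rw [bfun_eq hγ hy]; rfl

lemma pfun_eq {γ s : ℝ} (hγ : 1 < γ) (hs : s < 0) :
    pfun γ s = bq' γ (AplusInv γ s) * (fA γ (AplusInv γ s))⁻¹ := by
  rw [← (bfun_deriv hγ hs).deriv]
  unfold pfun
  have : bfun γ = fun s => - deriv (Kfun γ) s := rfl
  rw [this, deriv.fun_neg]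

lemma bfun_deriv' {γ s : ℝ} (hγ : 1 < γ) (hs : s < 0) :
    HasDerivAt (bfun γ) (pfun γ s) s := by
  rw [pfun_eq hγ hs]; exact bfun_deriv hγ hs

set_option maxHeartbeats 1600000 in
lemma bp_asymp {γ : ℝ} (hγ : 1 < γ) {M : ℝ} (hM : 0 < M) :
    ∃ k1 k2 k3 : ℝ, 0 < k1 ∧ 0 < k2 ∧ 0 < k3 ∧ ∀ s : ℝ, -M ≤ s → s < 0 →
      k1 / √(-s) ≤ bfun γ s ∧ bfun γ s ≤ k2 / √(-s) ∧ |pfun γ s| ≤ k3 / √(-s) ^ 3 := by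
  have hg : 0 < γ - 1 := by linarith
  set e := 1 / (γ - 1) with he
  have hepos : 0 < e := by positivity
  have hM0 : -M < 0 := by linarith
  set q2 := AplusInv γ (-M) with hq2
  have hq2m := AplusInv_mem' hγ hM0
  rw [← hq2] at hq2m
  have hc := cstar_pos hγ
  have hq2pos : 0 < q2 := lt_trans hc hq2m.1
  set r2 := rr γ q2 with hr2
  have hr2pos : 0 < r2 := rr_pos hγ hq2pos.le hq2m.2
  set f0 := 1 / (2 * (γ + 1) * q2 ^ 2) with hf0
  set f1 := r2 ^ (-e - 1) / (2 * (γ + 1) * cstar γ ^ 2) with hf1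
  have hgp : 0 < γ + 1 := by linarith
  have hf0pos : 0 < f0 := by positivity
  have hf1pos : 0 < f1 := by positivity
  have hd2 : 0 < dd γ q2 := dd_pos hγ hq2m.1
  -- comparison of A with D²
  have hsub : Icc (cstar γ) q2 ⊆ Ioo 0 (qmaxF γ) :=
    fun x hx => ⟨lt_of_lt_of_le hc hx.1, lt_of_le_of_lt hx.2 hq2m.2⟩
  have hder : ∀ f : ℝ, ∀ x ∈ Icc (cstar γ) q2, HasDerivAt (fun q => Afun γ q + f * dd γ q ^ 2)
      (dd γ x * (2 * f * (γ + 1) * x - rr γ x ^ (-e - 1) / x)) x := by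
    intro f x hx
    have h1 := (Afun_deriv hγ (hsub hx)).hasDerivAt
    have h2 := (((dd_deriv γ x).pow 2).const_mul f)
    have h3 := h1.add h2
    have h4 : dd γ x * (2 * f * (γ + 1) * x - rr γ x ^ (-e - 1) / x) =
      fA γ x + f * (↑2 * dd γ x ^ (2 - 1) * ((γ + 1) * x)) := by
      unfold fA; rw [← he]; norm_num; ring
    rw [h4]; exact h3
  have hrb : ∀ x ∈ Icc (cstar γ) q2, r2 ≤ rr γ x ∧ rr γ x ≤ 1 := fun x hx =>
    ⟨rr_anti hγ (hc.le.trans hx.1) hx.2, rr_le_one hγ⟩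
  have hexp : -e - 1 ≤ 0 := by linarith
  have hlow : ∀ x ∈ Icc (cstar γ) q2, f0 * dd γ x ^ 2 ≤ -Afun γ x := by
    intro x hx
    have hanti : AntitoneOn (fun q => Afun γ q + f0 * dd γ q ^ 2) (Icc (cstar γ) q2) := by
      apply antitoneOn_of_deriv_nonpos (convex_Icc _ _)
      · exact fun x hx => (hder f0 x hx).continuousAt.continuousWithinAt
      · intro x hx; rw [interior_Icc] at hx
        exact (hder f0 x ⟨hx.1.le, hx.2.le⟩).differentiableAt.differentiableWithinAt
      · intro x hx; rw [interior_Icc] at hx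
        rw [(hder f0 x ⟨hx.1.le, hx.2.le⟩).deriv]
        have hx0 : 0 < x := lt_trans hc hx.1
        have hrx := hrb x ⟨hx.1.le, hx.2.le⟩
        apply mul_nonpos_of_nonneg_of_nonpos (dd_pos hγ hx.1).le
        have h1 : 1 ≤ rr γ x ^ (-e - 1) :=
          Real.one_le_rpow_of_pos_of_le_one_of_nonpos (by linarith) hrx.2 hexp
        have h2 : 2 * f0 * (γ + 1) * x ≤ 1 / x := by
          rw [le_div_iff₀ hx0, hf0]
          have : x ^ 2 ≤ q2 ^ 2 := by nlinarith [hx.2]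
          have e1 : 2 * (1 / (2 * (γ + 1) * q2 ^ 2)) * (γ + 1) * x * x = x ^ 2 / q2 ^ 2 := by
            field_simp
          rw [e1, div_le_one (by positivity)]; exact this
        have h3 : 1 / x ≤ rr γ x ^ (-e - 1) / x := by gcongr
        linarith
    have := hanti ⟨le_refl _, hq2m.1.le⟩ hx hx.1
    simp only [Afun_cstar, dd_cstar hγ] at this
    norm_num at this; linarith
  have hup : ∀ x ∈ Icc (cstar γ) q2, -Afun γ x ≤ f1 * dd γ x ^ 2 := by
    intro x hx
    have hmono : MonotoneOn (fun q => Afun γ q + f1 * dd γ q ^ 2) (Icc (cstar γ) q2) := by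
      apply monotoneOn_of_deriv_nonneg (convex_Icc _ _)
      · exact fun x hx => (hder f1 x hx).continuousAt.continuousWithinAt
      · intro x hx; rw [interior_Icc] at hx
        exact (hder f1 x ⟨hx.1.le, hx.2.le⟩).differentiableAt.differentiableWithinAt
      · intro x hx; rw [interior_Icc] at hx
        rw [(hder f1 x ⟨hx.1.le, hx.2.le⟩).deriv]
        have hx0 : 0 < x := lt_trans hc hx.1
        have hrx := hrb x ⟨hx.1.le, hx.2.le⟩
        apply mul_nonneg (dd_pos hγ hx.1).le
        have h1 : rr γ x ^ (-e - 1) ≤ r2 ^ (-e - 1) :=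
          Real.rpow_le_rpow_of_nonpos hr2pos hrx.1 hexp
        have h2 : r2 ^ (-e - 1) / x ≤ 2 * f1 * (γ + 1) * x := by
          rw [div_le_iff₀ hx0, hf1]
          have : cstar γ ^ 2 ≤ x ^ 2 := by nlinarith [hx.1]
          have e1 : 2 * (r2 ^ (-e - 1) / (2 * (γ + 1) * cstar γ ^ 2)) * (γ + 1) * x * x
              = r2 ^ (-e - 1) * (x ^ 2 / cstar γ ^ 2) := by
            field_simp
          rw [e1]
          apply le_mul_of_one_le_right (by positivity)
          rw [one_le_div (by positivity)]; exact this
        have h3 : rr γ x ^ (-e - 1) / x ≤ r2 ^ (-e - 1) / x := by gcongr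
        linarith
    have := hmono ⟨le_refl _, hq2m.1.le⟩ hx hx.1
    simp only [Afun_cstar, dd_cstar hγ] at this
    norm_num at this; linarith
  set n := 2 * e + 1 with hn
  have hnpos : 0 < n := by positivity
  -- constant for p
  set C1 := ((γ - 1) * q2 * n * dd γ q2 + (γ + 1) * q2) * q2 with hC1
  have hC1pos : 0 < C1 := by positivity
  refine ⟨r2 ^ n * √f0, √f1, C1 * √f1 ^ 3, by positivity, by positivity, by positivity, ?_⟩
  intro s hsM hs0
  have hm := AplusInv_mem' hγ hs0
  set q := AplusInv γ s with hq
  have hqA : Afun γ q = s := AplusInv_eq hγ hs0.le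
  have hqq2 : q ≤ q2 := by
    by_contra hcon
    push Not at hcon
    have := Afun_anti hγ ⟨hq2m.1.le, hq2m.2⟩ ⟨hm.1.le, hm.2⟩ hcon
    rw [hqA, hq2, AplusInv_eq hγ hM0.le] at this
    linarith
  have hqI : q ∈ Icc (cstar γ) q2 := ⟨hm.1.le, hqq2⟩
  have hq0 : 0 < q := lt_trans hc hm.1
  have hd := dd_pos hγ hm.1
  have hl := hlow q hqI
  have hu := hup q hqI
  have hrx := hrb q hqI
  have hr : 0 < rr γ q := by linarith
  rw [hqA] at hl hu
  have hss : 0 < √(-s) := Real.sqrt_pos.2 (by linarith)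
  have hl' : √f0 * dd γ q ≤ √(-s) := by
    rw [← Real.sqrt_sq hd.le, ← Real.sqrt_mul hf0pos.le]; exact Real.sqrt_le_sqrt hl
  have hu' : √(-s) ≤ √f1 * dd γ q := by
    rw [← Real.sqrt_sq hd.le, ← Real.sqrt_mul hf1pos.le]; exact Real.sqrt_le_sqrt hu
  have hsf0 : 0 < √f0 := Real.sqrt_pos.2 hf0pos
  have hsf1 : 0 < √f1 := Real.sqrt_pos.2 hf1pos
  have hbq : bfun γ s = rr γ q ^ n / dd γ q := bfun_eq hγ hs0
  refine ⟨?_, ?_, ?_⟩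
  · rw [hbq, div_le_div_iff₀ hss hd]
    have h1 : r2 ^ n ≤ rr γ q ^ n := Real.rpow_le_rpow hr2pos.le hrx.1 hnpos.le
    calc r2 ^ n * √f0 * dd γ q = r2 ^ n * (√f0 * dd γ q) := by ring
      _ ≤ rr γ q ^ n * √(-s) := by gcongr
  · rw [hbq, div_le_div_iff₀ hd hss]
    have h1 : rr γ q ^ n ≤ 1 := Real.rpow_le_one hr.le hrx.2 hnpos.le
    calc rr γ q ^ n * √(-s) ≤ 1 * (√f1 * dd γ q) := by gcongr
      _ = _ := by ring
  · rw [pfun_eq hγ hs0, ← hq, abs_mul, abs_inv]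
    have h1 : |bq' γ q| ≤ ((γ - 1) * q2 * n * dd γ q2 + (γ + 1) * q2) / dd γ q ^ 2 := by
      unfold bq'
      rw [← he, ← hn, abs_div, abs_of_pos (show 0 < dd γ q ^ 2 by positivity)]
      gcongr
      have a1 : rr γ q ^ (n - 1) ≤ 1 := Real.rpow_le_one hr.le hrx.2 (by rw [hn]; linarith)
      have a2 : rr γ q ^ n ≤ 1 := Real.rpow_le_one hr.le hrx.2 hnpos.le
      have a3 : dd γ q ≤ dd γ q2 := by
        have : q ^ 2 ≤ q2 ^ 2 := by nlinarith
        unfold dd; nlinarith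
      have a4 : 0 < rr γ q ^ (n - 1) := Real.rpow_pos_of_pos hr _
      have a5 : 0 < rr γ q ^ n := Real.rpow_pos_of_pos hr _
      rw [abs_le]
      have b1 : (γ - 1) * q * n * rr γ q ^ (n - 1) * dd γ q ≤ (γ - 1) * q2 * n * 1 * dd γ q2 := by
        gcongr
      have b2 : rr γ q ^ n * ((γ + 1) * q) ≤ 1 * ((γ + 1) * q2) := by gcongr
      have b3 : 0 < (γ - 1) * q * n * rr γ q ^ (n - 1) * dd γ q := by positivity
      have b4 : 0 < rr γ q ^ n * ((γ + 1) * q) := by positivity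
      have b5 : γ - 1 > 0 := by linarith
      constructor
      · linarith
      · linarith
    have h2 : |fA γ q|⁻¹ ≤ q2 / dd γ q := by
      have : |fA γ q| = dd γ q * rr γ q ^ (-e - 1) / q := by
        unfold fA; rw [abs_neg, ← he, abs_of_pos]; positivity
      rw [this, inv_div]
      have a1 : 1 ≤ rr γ q ^ (-e - 1) :=
          Real.one_le_rpow_of_pos_of_le_one_of_nonpos hr hrx.2 hexp
      gcongr
      exact le_mul_of_one_le_right hd.le a1
    calc |bq' γ q| * |fA γ q|⁻¹
        ≤ ((γ - 1) * q2 * n * dd γ q2 + (γ + 1) * q2) / dd γ q ^ 2 * (q2 / dd γ q) := by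
          gcongr
      _ = C1 / dd γ q ^ 3 := by rw [hC1]; field_simp
      _ ≤ C1 * √f1 ^ 3 / √(-s) ^ 3 := by
          rw [div_le_div_iff₀ (by positivity) (by positivity)]
          have : √(-s) ^ 3 ≤ (√f1 * dd γ q) ^ 3 := by gcongr
          calc C1 * √(-s) ^ 3 ≤ C1 * (√f1 * dd γ q) ^ 3 := by gcongr
            _ = _ := by ring


open Real Set MeasureTheory Filter

lemma measurable_pdy {f : ℝ × ℝ → ℝ} (hf : Continuous f) : Measurable (pdy f) := by
  have := measurable_deriv_with_param (𝕜 := ℝ) (f := fun x y : ℝ => f (x, y)) (by simpa [Function.uncurry_def] using hf)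
  exact this

lemma pdx_swap (f : ℝ × ℝ → ℝ) (p : ℝ × ℝ) : pdx f p = pdy (fun q => f q.swap) p.swap := rfl

lemma measurable_pdx {f : ℝ × ℝ → ℝ} (hf : Continuous f) : Measurable (pdx f) := by
  have := (measurable_pdy (f := fun q => f q.swap) (hf.comp continuous_swap)).comp measurable_swap
  exact this

lemma lip_slice_y {f : ℝ × ℝ → ℝ} {L : NNReal} (hf : LipschitzWith L f) (x : ℝ) :
    LipschitzWith L (fun y => f (x, y)) := by
  have := hf.comp (LipschitzWith.prodMk_left (β := ℝ) x)
  rw [mul_one] at this; exact this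

lemma lip_slice_x {f : ℝ × ℝ → ℝ} {L : NNReal} (hf : LipschitzWith L f) (y : ℝ) :
    LipschitzWith L (fun x => f (x, y)) := by
  have := hf.comp (LipschitzWith.prodMk_right (α := ℝ) y)
  rw [mul_one] at this; exact this

lemma abs_pdy_le {f : ℝ × ℝ → ℝ} {L : NNReal} (hf : LipschitzWith L f) (p : ℝ × ℝ) :
    |pdy f p| ≤ L := norm_deriv_le_of_lipschitz (lip_slice_y hf p.1)

lemma abs_pdx_le {f : ℝ × ℝ → ℝ} {L : NNReal} (hf : LipschitzWith L f) (p : ℝ × ℝ) :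
    |pdx f p| ≤ L := norm_deriv_le_of_lipschitz (lip_slice_x hf p.2)

lemma ftc_lip {f : ℝ → ℝ} {L : NNReal} (hf : LipschitzWith L f) (a b : ℝ) :
    ∫ x in a..b, deriv f x = f b - f a :=
  (hf.lipschitzOnWith (s := uIcc a b)).absolutelyContinuousOnInterval.integral_deriv_eq_sub

lemma volume_rect_lt_top (a b c d : ℝ) : volume (Ioo a b ×ˢ Ioo c d) < ⊤ := by
  rw [Measure.volume_eq_prod, Measure.prod_prod]
  simp [ENNReal.mul_lt_top_iff]

lemma integrableOn_rect_of_bdd {f : ℝ × ℝ → ℝ} {a b c d M : ℝ} (hf : Measurable f)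
    (hb : ∀ p, |f p| ≤ M) : IntegrableOn f (Ioo a b ×ˢ Ioo c d) := by
  apply Measure.integrableOn_of_bounded (M := M) (volume_rect_lt_top a b c d).ne hf.aestronglyMeasurable
  exact Eventually.of_forall hb

lemma setIntegral_rect {f : ℝ × ℝ → ℝ} {a b c d : ℝ}
    (hf : IntegrableOn f (Ioo a b ×ˢ Ioo c d)) :
    ∫ p in Ioo a b ×ˢ Ioo c d, f p = ∫ x in Ioo a b, ∫ y in Ioo c d, f (x, y) := by
  rw [Measure.volume_eq_prod] at hf ⊢
  exact setIntegral_prod f hf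

lemma setIntegral_rect_swap (f : ℝ × ℝ → ℝ) (a b c d : ℝ) :
    ∫ p in Ioo a b ×ˢ Ioo c d, f p = ∫ p in Ioo c d ×ˢ Ioo a b, f p.swap := by
  have := setIntegral_prod_swap (μ := (volume : Measure ℝ)) (ν := (volume : Measure ℝ)) (Ioo a b) (Ioo c d) f
  rw [Measure.volume_eq_prod]
  exact this.symm

lemma int_pdy {f : ℝ × ℝ → ℝ} {L : NNReal} (hf : LipschitzWith L f) {a b c d : ℝ}
    (hab : a ≤ b) (hcd : c ≤ d) :
    ∫ p in Ioo a b ×ˢ Ioo c d, pdy f p = ∫ x in a..b, (f (x, d) - f (x, c)) := by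
  rw [setIntegral_rect (integrableOn_rect_of_bdd (measurable_pdy hf.continuous) (abs_pdy_le hf)),
    intervalIntegral.integral_of_le hab, integral_Ioc_eq_integral_Ioo]
  apply integral_congr_ae
  refine Eventually.of_forall fun x => ?_
  show ∫ y in Ioo c d, deriv (fun y => f (x, y)) y = _
  rw [← integral_Ioc_eq_integral_Ioo, ← intervalIntegral.integral_of_le hcd, ftc_lip (lip_slice_y hf x)]

lemma int_pdx {f : ℝ × ℝ → ℝ} {L : NNReal} (hf : LipschitzWith L f) {a b c d : ℝ}
    (hab : a ≤ b) (hcd : c ≤ d) :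
    ∫ p in Ioo a b ×ˢ Ioo c d, pdx f p = ∫ y in c..d, (f (b, y) - f (a, y)) := by
  have hs : LipschitzWith L (fun q : ℝ × ℝ => f q.swap) := by
    have := hf.comp (LipschitzWith.of_edist_le (f := (Prod.swap : ℝ × ℝ → ℝ × ℝ)) (by
      intro x y; simp [Prod.edist_eq, max_comm]))
    rw [mul_one] at this; exact this
  rw [setIntegral_rect_swap]
  exact int_pdy hs hcd hab

lemma deriv_congr_Ioo {f g : ℝ → ℝ} {a b x : ℝ} (h : EqOn f g (Ioo a b)) (hx : x ∈ Ioo a b) :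
    deriv f x = deriv g x :=
  Filter.EventuallyEq.deriv_eq (by filter_upwards [Ioo_mem_nhds hx.1 hx.2] with y hy using h hy)

lemma pdx_congr {f g : ℝ × ℝ → ℝ} {a b c d : ℝ} (h : EqOn f g (Icc a b ×ˢ Icc c d)) {p : ℝ × ℝ}
    (hp : p ∈ Ioo a b ×ˢ Ioo c d) : pdx f p = pdx g p :=
  deriv_congr_Ioo (fun _ hy => h ⟨Ioo_subset_Icc_self hy, Ioo_subset_Icc_self hp.2⟩) hp.1

lemma pdy_congr {f g : ℝ × ℝ → ℝ} {a b c d : ℝ} (h : EqOn f g (Icc a b ×ˢ Icc c d)) {p : ℝ × ℝ}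
    (hp : p ∈ Ioo a b ×ˢ Ioo c d) : pdy f p = pdy g p :=
  deriv_congr_Ioo (fun _ hy => h ⟨Ioo_subset_Icc_self hp.1, Ioo_subset_Icc_self hy⟩) hp.2

/-- Divergence theorem for Lipschitz fields on a rectangle. -/
lemma div_rect {P R : ℝ × ℝ → ℝ} {a b c d : ℝ} {L1 L2 : NNReal}
    (hP : LipschitzOnWith L1 P (Icc a b ×ˢ Icc c d)) (hR : LipschitzOnWith L2 R (Icc a b ×ˢ Icc c d))
    (hab : a ≤ b) (hcd : c ≤ d) :
    IntegrableOn (pdx P) (Ioo a b ×ˢ Ioo c d) ∧ IntegrableOn (pdy R) (Ioo a b ×ˢ Ioo c d) ∧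
    ∫ p in Ioo a b ×ˢ Ioo c d, (pdx P p + pdy R p)
      = (∫ y in c..d, (P (b, y) - P (a, y))) + ∫ x in a..b, (R (x, d) - R (x, c)) := by
  obtain ⟨P', hP', eP⟩ := hP.extend_real
  obtain ⟨R', hR', eR⟩ := hR.extend_real
  have hms : MeasurableSet (Ioo a b ×ˢ Ioo c d) := measurableSet_Ioo.prod measurableSet_Ioo
  have i1 : IntegrableOn (pdx P') (Ioo a b ×ˢ Ioo c d) :=
    integrableOn_rect_of_bdd (measurable_pdx hP'.continuous) (abs_pdx_le hP')
  have i2 : IntegrableOn (pdy R') (Ioo a b ×ˢ Ioo c d) :=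
    integrableOn_rect_of_bdd (measurable_pdy hR'.continuous) (abs_pdy_le hR')
  have c1 : EqOn (pdx P') (pdx P) (Ioo a b ×ˢ Ioo c d) := fun p hp => (pdx_congr eP hp).symm
  have c2 : EqOn (pdy R') (pdy R) (Ioo a b ×ˢ Ioo c d) := fun p hp => (pdy_congr eR hp).symm
  have j1 : IntegrableOn (pdx P) (Ioo a b ×ˢ Ioo c d) := i1.congr_fun c1 hms
  have j2 : IntegrableOn (pdy R) (Ioo a b ×ˢ Ioo c d) := i2.congr_fun c2 hms
  refine ⟨j1, j2, ?_⟩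
  rw [integral_add j1 j2, ← setIntegral_congr_fun hms c1, ← setIntegral_congr_fun hms c2,
    int_pdx hP' hab hcd, int_pdy hR' hab hcd]
  congr 1
  · apply intervalIntegral.integral_congr
    intro y hy
    rw [uIcc_of_le hcd] at hy
    show P' _ - P' _ = P _ - P _
    rw [eP ⟨right_mem_Icc.2 hab, hy⟩, eP ⟨left_mem_Icc.2 hab, hy⟩]
  · apply intervalIntegral.integral_congr
    intro x hx
    rw [uIcc_of_le hab] at hx
    show R' _ - R' _ = R _ - R _
    rw [eR ⟨hx, right_mem_Icc.2 hcd⟩, eR ⟨hx, left_mem_Icc.2 hcd⟩]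

lemma le_on_Ioo_of_ae {f g : ℝ → ℝ} {a b : ℝ} (hf : ContinuousOn f (Ioo a b))
    (hg : ContinuousOn g (Ioo a b)) (h : ∀ᵐ x ∂(volume.restrict (Ioo a b)), f x ≤ g x) :
    ∀ x ∈ Ioo a b, f x ≤ g x := by
  have := Measure.eqOn_Ioo_of_ae_eq (μ := (volume : Measure ℝ)) (a := a) (b := b)
    (f := fun x => max (f x - g x) 0) (g := fun _ => 0)
    (by filter_upwards [h] with x hx; exact max_eq_right (by linarith))
    (ContinuousOn.sup (hf.sub hg) continuousOn_const) continuousOn_const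
  intro x hx
  have h2 := this hx
  have h3 := le_max_left (f x - g x) 0
  simp only at h2
  linarith

lemma sub_le_of_ae_deriv {f : ℝ → ℝ} {L : NNReal} (hf : LipschitzWith L f) {a b K : ℝ} (hab : a ≤ b)
    (h : ∀ᵐ x ∂(volume.restrict (Ioo a b)), |deriv f x| ≤ K) : |f b - f a| ≤ K * (b - a) := by
  rw [← ftc_lip hf]
  have := intervalIntegral.norm_integral_le_of_norm_le_const_ae (f := deriv f) (a := a) (b := b) (C := K) (by
    rw [ae_restrict_iff' measurableSet_Ioo] at h
    have hb : ∀ᵐ x : ℝ, x ≠ b := by simp [ae_iff, measure_singleton]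
    filter_upwards [h, hb] with x hx hxb hm
    rw [uIoc_of_le hab] at hm
    exact hx ⟨hm.1, lt_of_le_of_ne hm.2 hxb⟩)
  rwa [abs_of_nonneg (sub_nonneg.2 hab)] at this

lemma slice_bound_y {f : ℝ × ℝ → ℝ} {L : NNReal} (hf : LipschitzWith L f) {a b c d : ℝ}
    {g : ℝ → ℝ} (hg : ContinuousOn g (Ioo a b))
    (h : ∀ᵐ p ∂(volume.restrict (Ioo a b ×ˢ Ioo c d)), |pdy f p| ≤ g p.1) :
    ∀ x ∈ Ioo a b, ∀ y ∈ Icc c d, ∀ y' ∈ Icc c d, |f (x, y) - f (x, y')| ≤ g x * |y - y'| := by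
  have key : ∀ y ∈ Icc c d, ∀ y' ∈ Icc c d, y ≤ y' → ∀ x ∈ Ioo a b,
      |f (x, y') - f (x, y)| ≤ g x * (y' - y) := by
    intro y hy y' hy' hyy
    apply le_on_Ioo_of_ae
    · exact (((hf.continuous.comp (by fun_prop : Continuous fun x : ℝ => (x, y'))).sub
        (hf.continuous.comp (by fun_prop : Continuous fun x : ℝ => (x, y)))).abs).continuousOn
    · exact hg.mul continuousOn_const
    · rw [Measure.volume_eq_prod, ← Measure.prod_restrict] at h
      filter_upwards [Measure.ae_ae_of_ae_prod h] with x hx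
      apply sub_le_of_ae_deriv (lip_slice_y hf x) hyy
      exact ae_restrict_of_ae_restrict_of_subset (Ioo_subset_Ioo hy.1 hy'.2) hx
  intro x hx y hy y' hy'
  rcases le_total y y' with h1 | h1
  · have := key y hy y' hy' h1 x hx
    rw [abs_sub_comm, abs_sub_comm y y', abs_of_nonneg (sub_nonneg.2 h1)]; exact this
  · have := key y' hy' y hy h1 x hx
    rw [abs_of_nonneg (sub_nonneg.2 h1)]; exact this

lemma slice_bound_x {f : ℝ × ℝ → ℝ} {L : NNReal} (hf : LipschitzWith L f) {a b c d : ℝ}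
    {g : ℝ → ℝ} (hg : MonotoneOn g (Icc a b))
    (h : ∀ᵐ p ∂(volume.restrict (Ioo a b ×ˢ Ioo c d)), |pdx f p| ≤ g p.1) :
    ∀ y ∈ Ioo c d, ∀ x ∈ Icc a b, ∀ x' ∈ Icc a b, x ≤ x' → |f (x', y) - f (x, y)| ≤ g x' * (x' - x) := by
  have key : ∀ x ∈ Icc a b, ∀ x' ∈ Icc a b, x ≤ x' → ∀ y ∈ Ioo c d,
      |f (x', y) - f (x, y)| ≤ g x' * (x' - x) := by
    intro x hx x' hx' hxx
    apply le_on_Ioo_of_ae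
    · exact (((hf.continuous.comp (by fun_prop : Continuous fun y : ℝ => (x', y))).sub
        (hf.continuous.comp (by fun_prop : Continuous fun y : ℝ => (x, y)))).abs).continuousOn
    · exact continuousOn_const
    · rw [Measure.volume_eq_prod, ← Measure.prod_restrict] at h
      have h' := (Measure.measurePreserving_swap (μ := volume.restrict (Ioo c d)) (ν := volume.restrict (Ioo a b))).quasiMeasurePreserving.ae h
      filter_upwards [Measure.ae_ae_of_ae_prod h'] with y hy
      apply sub_le_of_ae_deriv (lip_slice_x hf y) hxx
      have h1 := ae_restrict_of_ae_restrict_of_subset (Ioo_subset_Ioo hx.1 hx'.2) hy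
      filter_upwards [h1, ae_restrict_mem measurableSet_Ioo] with z hz hm
      exact hz.trans (hg ⟨hx.1.trans hm.1.le, hm.2.le.trans hx'.2⟩ hx' hm.2.le)
  intro y hy x hx x' hx' hxx
  exact key x hx x' hx' hxx y hy


open Real Set MeasureTheory Filter

lemma sb_asymp {γ : ℝ} (hγ : 1 < γ) {M : ℝ} (hM : 0 < M) :
    ∃ k1 k2 k3 : ℝ, 0 < k1 ∧ 0 < k2 ∧ 0 < k3 ∧ ∀ s, -M ≤ s → s < 0 →
      k1 * (-s) ^ (-(1/4) : ℝ) ≤ √(bfun γ s) ∧ √(bfun γ s) ≤ k2 * (-s) ^ (-(1/4) : ℝ) ∧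
      HasDerivAt (fun s => √(bfun γ s)) (1 / 2 * (√(bfun γ s))⁻¹ * pfun γ s) s ∧
      |1 / 2 * (√(bfun γ s))⁻¹ * pfun γ s| ≤ k3 * (-s) ^ (-(5/4) : ℝ) := by
  obtain ⟨k1, k2, k3, h1, h2, h3, H⟩ := bp_asymp hγ hM
  refine ⟨√k1, √k2, 1 / 2 * (√k1)⁻¹ * k3, by positivity, by positivity, by positivity, ?_⟩
  intro s hs hs0
  obtain ⟨a1, a2, a3⟩ := H s hs hs0
  have ht : 0 < -s := by linarith
  set t := -s with htdef
  have e4 : √(√t) = t ^ ((1/4) : ℝ) := by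
    rw [Real.sqrt_eq_rpow, Real.sqrt_eq_rpow, ← Real.rpow_mul ht.le]; norm_num
  have e4' : (√(√t))⁻¹ = t ^ (-(1/4) : ℝ) := by
    rw [e4, Real.rpow_neg ht.le]
  have hsq : 0 < √t := Real.sqrt_pos.2 ht
  have hb : 0 < bfun γ s := lt_of_lt_of_le (by positivity) a1
  have b1 : √k1 * t ^ (-(1/4) : ℝ) ≤ √(bfun γ s) := by
    rw [← e4', ← div_eq_mul_inv, ← Real.sqrt_div h1.le]; exact Real.sqrt_le_sqrt a1
  refine ⟨b1, ?_, ?_, ?_⟩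
  · rw [← e4', ← div_eq_mul_inv, ← Real.sqrt_div h2.le]; exact Real.sqrt_le_sqrt a2
  · have := (bfun_deriv' hγ hs0).sqrt hb.ne'
    convert this using 1
    field_simp
  · rw [abs_mul, abs_of_pos (by positivity : 0 < 1 / 2 * (√(bfun γ s))⁻¹)]
    have c1 : (√(bfun γ s))⁻¹ ≤ (√k1)⁻¹ * t ^ ((1/4) : ℝ) := by
      have := inv_anti₀ (by positivity) b1
      rw [mul_inv, ← Real.rpow_neg ht.le, neg_neg] at this; exact this
    have c2 : |pfun γ s| ≤ k3 * t ^ (-(3/2) : ℝ) := by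
      refine a3.trans (le_of_eq ?_)
      rw [div_eq_mul_inv, Real.sqrt_eq_rpow, ← Real.rpow_natCast, ← Real.rpow_mul ht.le,
        ← Real.rpow_neg ht.le]; norm_num
    calc 1 / 2 * (√(bfun γ s))⁻¹ * |pfun γ s|
        ≤ 1 / 2 * ((√k1)⁻¹ * t ^ ((1/4) : ℝ)) * (k3 * t ^ (-(3/2) : ℝ)) := by gcongr
      _ = 1 / 2 * (√k1)⁻¹ * k3 * (t ^ ((1/4) : ℝ) * t ^ (-(3/2) : ℝ)) := by ring
      _ = _ := by rw [← Real.rpow_add ht]; norm_num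

/-- Folding of the real line onto `[0,m]`. -/
def fold (m x : ℝ) : ℝ := ‖(x : AddCircle (2 * m))‖

lemma fold_of_abs_le {m x : ℝ} (hm : 0 < m) (hx : |x| ≤ m) : fold m x = |x| := by
  unfold fold
  have h2 : 0 < 2 * m := by linarith
  rw [AddCircle.norm_coe_eq_abs_iff _ h2.ne', abs_of_pos h2]; linarith

lemma fold_of_mem {m x : ℝ} (hm : 0 < m) (hx : x ∈ Icc 0 m) : fold m x = x := by
  rw [fold_of_abs_le hm (by rw [abs_of_nonneg hx.1]; exact hx.2), abs_of_nonneg hx.1]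

lemma fold_neg (m x : ℝ) : fold m (-x) = fold m x := by
  unfold fold; rw [AddCircle.coe_neg, norm_neg]

lemma fold_add (m x : ℝ) : fold m (x + 2 * m) = fold m x := by
  unfold fold; rw [AddCircle.coe_add_period]

lemma fold_lip (m x y : ℝ) : |fold m x - fold m y| ≤ |x - y| := by
  unfold fold
  refine (abs_norm_sub_norm_le _ _).trans ?_
  rw [← AddCircle.coe_sub]
  exact QuotientAddGroup.norm_mk_le_norm

lemma fold_mem {m : ℝ} (hm : 0 < m) (x : ℝ) : fold m x ∈ Icc 0 m := by
  refine ⟨norm_nonneg _, ?_⟩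
  have := AddCircle.norm_le_half_period (2 * m) (x := (x : AddCircle (2 * m))) (by positivity)
  rw [abs_of_pos (by positivity)] at this
  unfold fold; linarith

/-- Abstract properties of the coefficient `c = b^{1/2}(Q)`, extended evenly and periodically. -/
structure Coef (ζ m κ s c1 c2 C : ℝ) (c : ℝ × ℝ → ℝ) : Prop where
  lo : ∀ x y, 0 < x → x ≤ ζ → c1 * x ^ (-κ) ≤ c (x, y)
  hi : ∀ x y, 0 < x → x ≤ ζ → c (x, y) ≤ c2 * x ^ (-κ)
  even : ∀ x y, c (x, -y) = c (x, y)
  per : ∀ x y, c (x, y + 2 * m) = c (x, y)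
  lipy : ∀ x y y', 0 < x → x ≤ ζ → |c (x, y) - c (x, y')| ≤ C * x ^ (s - 1) * |y - y'|
  lipa : ∀ x x' y, 0 < x → x ≤ ζ → 0 < x' → x' ≤ ζ → |(c (x, y))⁻¹ - (c (x', y))⁻¹| ≤ C * |x - x'|

lemma Qt_props {γ lam ζ m μ1 μ2 β1 β2 β3 : ℝ} {Qt : ℝ × ℝ → ℝ} (hζ : 0 < ζ) (hm : 0 < m)
    (hlam : 2 < lam) (hβ1 : 0 < β1) (hβ12 : β1 ≤ β2)
    (h : QtOK γ lam ζ m μ1 μ2 β1 β2 β3 Qt) :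
    ∃ Q : ℝ × ℝ → ℝ, ∃ L : NNReal, LipschitzWith L Q ∧ EqOn Qt Q (Icc 0 ζ ×ˢ Icc 0 m) ∧
      (∀ p ∈ Icc (0 : ℝ) ζ ×ˢ Icc (0 : ℝ) m,
        -μ2 * p.1 ^ (lam + 2) ≤ Q p ∧ Q p ≤ -μ1 * p.1 ^ (lam + 2)) ∧
      (∀ x ∈ Icc 0 ζ, ∀ y ∈ Icc 0 m, ∀ y' ∈ Icc 0 m,
        |Q (x, y) - Q (x, y')| ≤ β3 * x ^ (3 * lam / 2 + 1) * |y - y'|) ∧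
      (∀ y ∈ Icc 0 m, ∀ x ∈ Icc 0 ζ, ∀ x' ∈ Icc 0 ζ, x ≤ x' →
        |Q (x', y) - Q (x, y)| ≤ β2 * x' ^ (lam + 1) * (x' - x)) := by
  obtain ⟨⟨L, hL⟩, h2, h3⟩ := h
  obtain ⟨Q, hQ, eQ⟩ := hL.extend_real
  have hQc := hQ.continuous
  refine ⟨Q, L, hQ, eQ, ?_, ?_, ?_⟩
  · have hcl : closure (Ioo (0 : ℝ) ζ ×ˢ Ioo (0 : ℝ) m) = Icc 0 ζ ×ˢ Icc 0 m := by
      rw [closure_prod_eq, closure_Ioo hζ.ne, closure_Ioo hm.ne]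
    have hp : Continuous fun p : ℝ × ℝ => p.1 ^ (lam + 2) :=
      (Real.continuous_rpow_const (by linarith)).comp continuous_fst
    have hcs : IsClosed {p : ℝ × ℝ | -μ2 * p.1 ^ (lam + 2) ≤ Q p ∧ Q p ≤ -μ1 * p.1 ^ (lam + 2)} := by
      apply IsClosed.inter
      · exact isClosed_le (by fun_prop) hQc
      · exact isClosed_le hQc (by fun_prop)
    have := closure_minimal (s := Ioo (0 : ℝ) ζ ×ˢ Ioo (0 : ℝ) m) (fun p hp => by
      have := h2 p hp
      rwa [eQ ⟨Ioo_subset_Icc_self hp.1, Ioo_subset_Icc_self hp.2⟩] at this) hcs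
    rw [hcl] at this
    exact fun p hp => this hp
  · have hc : Continuous fun x : ℝ => β3 * x ^ (3 * lam / 2 + 1) :=
      continuous_const.mul (Real.continuous_rpow_const (by linarith))
    have hb := slice_bound_y (c := 0) (d := m) hQ (g := fun x => β3 * x ^ (3 * lam / 2 + 1)) (a := 0) (b := ζ)
      hc.continuousOn (by
        filter_upwards [h3, ae_restrict_mem (measurableSet_Ioo.prod measurableSet_Ioo)] with p hp hm
        rw [← pdy_congr eQ hm]; exact hp.2)
    intro x hx y hy y' hy'
    have hcs : IsClosed {x : ℝ | |Q (x, y) - Q (x, y')| ≤ β3 * x ^ (3 * lam / 2 + 1) * |y - y'|} :=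
      isClosed_le (by fun_prop) (by fun_prop)
    have := closure_minimal (s := Ioo 0 ζ) (fun x hx => hb x hx y hy y' hy') hcs
    rw [closure_Ioo hζ.ne] at this
    exact this hx
  · have hb := slice_bound_x (c := 0) (d := m) hQ (g := fun x => β2 * x ^ (lam + 1)) (a := 0) (b := ζ)
      (by
        intro x hx x' hx' hxx
        show β2 * x ^ (lam + 1) ≤ β2 * x' ^ (lam + 1)
        have := Real.rpow_le_rpow hx.1 hxx (by linarith : 0 ≤ lam + 1)
        have : 0 < β2 := by linarith
        gcongr) (by
        filter_upwards [h3, ae_restrict_mem (measurableSet_Ioo.prod measurableSet_Ioo)] with p hp hm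
        rw [← pdx_congr eQ hm, abs_le]
        have h5 : 0 < p.1 ^ (lam + 1) := Real.rpow_pos_of_pos hm.1.1 _
        have h6 : 0 < β1 * p.1 ^ (lam + 1) := by positivity
        have h7 : 0 < β2 * p.1 ^ (lam + 1) := by nlinarith
        constructor <;> nlinarith [hp.1.1, hp.1.2])
    intro y hy x hx x' hx' hxx
    have hcs : IsClosed {y : ℝ | |Q (x', y) - Q (x, y)| ≤ β2 * x' ^ (lam + 1) * (x' - x)} :=
      isClosed_le (by fun_prop) (by fun_prop)
    have := closure_minimal (s := Ioo 0 m) (fun y hy => hb y hy x hx x' hx' hxx) hcs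
    rw [closure_Ioo hm.ne] at this
    exact this hy

lemma lip_of_deriv_bound {f f' : ℝ → ℝ} {S : Set ℝ} (hS : Convex ℝ S) {K : ℝ}
    (h : ∀ x ∈ S, HasDerivAt f (f' x) x) (hb : ∀ x ∈ S, |f' x| ≤ K) {x y : ℝ} (hx : x ∈ S) (hy : y ∈ S) :
    |f x - f y| ≤ K * |x - y| := by
  have := hS.norm_image_sub_le_of_norm_hasDerivWithin_le (f := f) (f' := f') (C := K)
    (fun x hx => (h x hx).hasDerivWithinAt) (fun x hx => hb x hx) hy hx
  exact this

set_option maxHeartbeats 1000000 in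
lemma coef_exists {γ lam m μ1 μ2 : ℝ} (hγ : 1 < γ) (hlam : 2 < lam) (hm : 0 < m) (hμ1 : 0 < μ1)
    (hμ12 : μ1 ≤ μ2) : ∃ c1 c2 : ℝ, 0 < c1 ∧ 0 < c2 ∧
    ∀ ζ β1 β2 β3 : ℝ, 0 < ζ → ζ ≤ 1 → 0 < β1 → β1 ≤ β2 → 0 < β3 →
    ∀ Qt : ℝ × ℝ → ℝ, QtOK γ lam ζ m μ1 μ2 β1 β2 β3 Qt →
    ∃ C : ℝ, 0 < C ∧ ∃ c : ℝ × ℝ → ℝ,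
      Coef ζ m ((lam + 2) / 4) (lam / 4 - 1 / 2) c1 c2 C c ∧
      (∀ p ∈ Icc 0 ζ ×ˢ Icc 0 m, √(bfun γ (Qt p)) = c p) ∧
      (∀ᵐ p ∂(volume.restrict (Ioo (0 : ℝ) ζ ×ˢ Ioo (0 : ℝ) m)),
        1 / 2 * (√(bfun γ (Qt p)))⁻¹ * pfun γ (Qt p) * pdy Qt p = pdy c p) := by
  have hμ2 : 0 < μ2 := by linarith
  obtain ⟨k1, k2, k3, hk1, hk2, hk3, H⟩ := sb_asymp hγ hμ2
  refine ⟨k1 * μ2 ^ (-(1/4) : ℝ), k2 * μ1 ^ (-(1/4) : ℝ), by positivity, by positivity, ?_⟩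
  intro ζ β1 β2 β3 hζ hζ1 hβ1 hβ12 hβ3 Qt hQt
  have hβ2 : 0 < β2 := by linarith
  obtain ⟨Q, L, hQ, eQ, q1, q2, q3⟩ := Qt_props hζ hm hlam hβ1 hβ12 hQt
  -- position facts
  have hpos : ∀ x y, 0 < x → x ≤ ζ → y ∈ Icc 0 m →
      μ1 * x ^ (lam + 2) ≤ -Q (x, y) ∧ -Q (x, y) ≤ μ2 * x ^ (lam + 2) ∧ -μ2 ≤ Q (x, y) ∧ Q (x, y) < 0 := by
    intro x y hx hxζ hy
    obtain ⟨a1, a2⟩ := q1 (x, y) ⟨⟨hx.le, hxζ⟩, hy⟩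
    simp only at a1 a2
    have e1 : 0 < x ^ (lam + 2) := Real.rpow_pos_of_pos hx _
    have e2 : x ^ (lam + 2) ≤ 1 := Real.rpow_le_one hx.le (by linarith) (by linarith)
    refine ⟨by linarith, by linarith, ?_, ?_⟩ <;> nlinarith
  have hpw : ∀ x μ e : ℝ, 0 < x → 0 < μ → (μ * x ^ (lam + 2)) ^ e = μ ^ e * x ^ ((lam + 2) * e) := by
    intro x μ e hx hμ
    rw [Real.mul_rpow hμ.le (Real.rpow_nonneg hx.le _), ← Real.rpow_mul hx.le]
  have hlo : ∀ x y, 0 < x → x ≤ ζ → y ∈ Icc 0 m →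
      k1 * μ2 ^ (-(1/4) : ℝ) * x ^ (-((lam + 2) / 4)) ≤ √(bfun γ (Q (x, y))) := by
    intro x y hx hxζ hy
    obtain ⟨a1, a2, a3, a4⟩ := hpos x y hx hxζ hy
    refine le_trans ?_ (H _ a3 a4).1
    rw [mul_assoc]
    gcongr
    have := Real.rpow_le_rpow_of_nonpos (z := (-(1/4) : ℝ)) (by linarith) a2 (by norm_num)
    rw [hpw _ _ _ hx hμ2] at this
    have e : -((lam + 2) / 4) = (lam + 2) * (-(1/4)) := by ring
    rw [e]; exact this
  have hhi : ∀ x y, 0 < x → x ≤ ζ → y ∈ Icc 0 m →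
      √(bfun γ (Q (x, y))) ≤ k2 * μ1 ^ (-(1/4) : ℝ) * x ^ (-((lam + 2) / 4)) := by
    intro x y hx hxζ hy
    obtain ⟨a1, a2, a3, a4⟩ := hpos x y hx hxζ hy
    refine le_trans (H _ a3 a4).2.1 ?_
    rw [mul_assoc]
    gcongr
    have := Real.rpow_le_rpow_of_nonpos (z := (-(1/4) : ℝ)) (by positivity) a1 (by norm_num)
    rw [hpw _ _ _ hx hμ1] at this
    have e : -((lam + 2) / 4) = (lam + 2) * (-(1/4)) := by ring
    rw [e]; exact this
  -- lipschitz in y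
  set D1 := k3 * μ1 ^ (-(5/4) : ℝ) * β3 with hD1
  have hly : ∀ x y y', 0 < x → x ≤ ζ → y ∈ Icc 0 m → y' ∈ Icc 0 m →
      |√(bfun γ (Q (x, y))) - √(bfun γ (Q (x, y')))| ≤ D1 * x ^ (lam / 4 - 1 / 2 - 1) * |y - y'| := by
    intro x y y' hx hxζ hy hy'
    obtain ⟨a1, a2, a3, a4⟩ := hpos x y hx hxζ hy
    obtain ⟨b1, b2, b3, b4⟩ := hpos x y' hx hxζ hy'
    have hX : 0 < μ1 * x ^ (lam + 2) := mul_pos hμ1 (Real.rpow_pos_of_pos hx _)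
    have := lip_of_deriv_bound (S := Icc (-μ2) (-(μ1 * x ^ (lam + 2)))) (convex_Icc _ _)
      (f := fun s => √(bfun γ s)) (K := k3 * (μ1 * x ^ (lam + 2)) ^ (-(5/4) : ℝ))
      (fun s hs => (H s hs.1 (by linarith [hs.2])).2.2.1)
      (fun s hs => ((H s hs.1 (by linarith [hs.2])).2.2.2).trans (by
        exact mul_le_mul_of_nonneg_left
          (Real.rpow_le_rpow_of_nonpos hX (by linarith [hs.2]) (by norm_num)) hk3.le))
      (x := Q (x, y)) (y := Q (x, y')) ⟨a3, by linarith⟩ ⟨b3, by linarith⟩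
    refine this.trans ?_
    have q := q2 x ⟨hx.le, hxζ⟩ y hy y' hy'
    have hk : 0 ≤ k3 * (μ1 * x ^ (lam + 2)) ^ (-(5/4) : ℝ) := by positivity
    calc _ ≤ k3 * (μ1 * x ^ (lam + 2)) ^ (-(5/4) : ℝ) * (β3 * x ^ (3 * lam / 2 + 1) * |y - y'|) := by gcongr
      _ = D1 * (x ^ ((lam + 2) * (-(5/4))) * x ^ (3 * lam / 2 + 1)) * |y - y'| := by
          rw [hpw _ _ _ hx hμ1, hD1]; ring
      _ = _ := by rw [← Real.rpow_add hx]; ring_nf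
  -- inverse
  set D2 := k3 * k1⁻¹ * k1⁻¹ * μ1 ^ (-(3/4) : ℝ) * β2 * 2 ^ (lam + 1) with hD2
  set D3 := 2 * (k1 * μ2 ^ (-(1/4) : ℝ))⁻¹ with hD3
  have hai : ∀ x y, 0 < x → x ≤ ζ → y ∈ Icc 0 m → 0 < √(bfun γ (Q (x, y))) := fun x y hx hxζ hy =>
    lt_of_lt_of_le (by positivity) (hlo x y hx hxζ hy)
  have hla0 : ∀ x x' y, 0 < x → x ≤ x' → x' ≤ ζ → y ∈ Icc 0 m →
      |(√(bfun γ (Q (x, y))))⁻¹ - (√(bfun γ (Q (x', y))))⁻¹| ≤ (D2 + D3) * |x - x'| := by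
    intro x x' y hx hxx hx'ζ hy
    have hx' : 0 < x' := by linarith
    have hxζ : x ≤ ζ := by linarith
    have hD2p : 0 < D2 := by positivity
    have hD3p : 0 < D3 := by positivity
    rcases le_or_gt x' (2 * x) with hc | hc
    · obtain ⟨a1, a2, a3, a4⟩ := hpos x y hx hxζ hy
      obtain ⟨b1, b2, b3, b4⟩ := hpos x' y hx' hx'ζ hy
      have hX : 0 < μ1 * x ^ (lam + 2) := mul_pos hμ1 (Real.rpow_pos_of_pos hx _)
      have hXX : μ1 * x ^ (lam + 2) ≤ μ1 * x' ^ (lam + 2) := by gcongr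
      have := lip_of_deriv_bound (S := Icc (-μ2) (-(μ1 * x ^ (lam + 2)))) (convex_Icc _ _)
        (f := fun s => (√(bfun γ s))⁻¹)
        (K := k3 * k1⁻¹ * k1⁻¹ * (μ1 * x ^ (lam + 2)) ^ (-(3/4) : ℝ))
        (f' := fun s => -(1 / 2 * (√(bfun γ s))⁻¹ * pfun γ s) / (√(bfun γ s)) ^ 2)
        (fun s hs => by
          obtain ⟨h1, h2, h3, h4⟩ := H s hs.1 (by linarith [hs.2])
          have : 0 < -s := by linarith [hs.2]
          have h5 : 0 < √(bfun γ s) := lt_of_lt_of_le (by positivity) h1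
          exact h3.inv h5.ne')
        (fun s hs => by
          obtain ⟨h1, h2, h3, h4⟩ := H s hs.1 (by linarith [hs.2])
          have hs' : 0 < -s := by linarith [hs.2]
          have h5 : 0 < √(bfun γ s) := lt_of_lt_of_le (by positivity) h1
          rw [abs_div, abs_neg, abs_of_pos (by positivity : 0 < √(bfun γ s) ^ 2)]
          have h6 : (√(bfun γ s))⁻¹ ≤ k1⁻¹ * (-s) ^ ((1/4) : ℝ) := by
            have := inv_anti₀ (by positivity) h1
            rw [mul_inv, ← Real.rpow_neg hs'.le, neg_neg] at this; exact this
          calc |1 / 2 * (√(bfun γ s))⁻¹ * pfun γ s| / √(bfun γ s) ^ 2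
              = |1 / 2 * (√(bfun γ s))⁻¹ * pfun γ s| * ((√(bfun γ s))⁻¹ * (√(bfun γ s))⁻¹) := by
                field_simp
            _ ≤ (k3 * (-s) ^ (-(5/4) : ℝ)) * ((k1⁻¹ * (-s) ^ ((1/4) : ℝ)) * (k1⁻¹ * (-s) ^ ((1/4) : ℝ))) := by
                gcongr
            _ = k3 * k1⁻¹ * k1⁻¹ * ((-s) ^ (-(5/4) : ℝ) * ((-s) ^ ((1/4) : ℝ) * (-s) ^ ((1/4) : ℝ))) := by ring
            _ = k3 * k1⁻¹ * k1⁻¹ * ((-s) ^ (-(3/4) : ℝ)) := by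
                rw [← Real.rpow_add hs', ← Real.rpow_add hs']; norm_num
            _ ≤ _ := mul_le_mul_of_nonneg_left
                (Real.rpow_le_rpow_of_nonpos hX (by linarith [hs.2]) (by norm_num)) (by positivity))
        (x := Q (x, y)) (y := Q (x', y)) ⟨a3, by linarith⟩ ⟨b3, by linarith⟩
      refine this.trans ?_
      have q := q3 y hy x ⟨hx.le, hxζ⟩ x' ⟨hx'.le, hx'ζ⟩ hxx
      have h8 : x' ^ (lam + 1) ≤ 2 ^ (lam + 1) * x ^ (lam + 1) := by
        rw [← Real.mul_rpow (by norm_num) hx.le]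
        exact Real.rpow_le_rpow hx'.le hc (by linarith)
      have h9 : x ^ (lam / 4 - 1 / 2) ≤ 1 := Real.rpow_le_one hx.le (by linarith) (by linarith)
      rw [abs_sub_comm (Q (x, y)), abs_sub_comm x x', abs_of_nonneg (sub_nonneg.2 hxx)]
      have hsub : 0 ≤ x' - x := by linarith
      calc _ ≤ k3 * k1⁻¹ * k1⁻¹ * (μ1 * x ^ (lam + 2)) ^ (-(3/4) : ℝ) *
            (β2 * (2 ^ (lam + 1) * x ^ (lam + 1)) * (x' - x)) := by
              gcongr
              exact q.trans (by gcongr)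
        _ = D2 * (x ^ ((lam + 2) * (-(3/4))) * x ^ (lam + 1)) * (x' - x) := by
          rw [hpw _ _ _ hx hμ1, hD2]; ring
        _ = D2 * x ^ (lam / 4 - 1 / 2) * (x' - x) := by rw [← Real.rpow_add hx]; ring_nf
        _ ≤ D2 * 1 * (x' - x) := by gcongr
        _ ≤ _ := by nlinarith
    · have hb : ∀ z, 0 < z → z ≤ x' → (√(bfun γ (Q (z, y))))⁻¹ ≤ (k1 * μ2 ^ (-(1/4) : ℝ))⁻¹ * x' := by
        intro z hz hzx
        have h1 := inv_anti₀ (by positivity) (hlo z y hz (by linarith) hy)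
        rw [mul_inv, ← Real.rpow_neg hz.le, neg_neg] at h1
        refine h1.trans ?_
        gcongr
        calc z ^ ((lam + 2) / 4) ≤ z ^ (1 : ℝ) :=
              Real.rpow_le_rpow_of_exponent_ge hz (by linarith) (by linarith)
          _ = z := Real.rpow_one z
          _ ≤ x' := hzx
      have h1 := hb x hx hxx
      have h2 := hb x' hx' le_rfl
      have p1 := inv_pos.2 (hai x y hx hxζ hy)
      have p2 := inv_pos.2 (hai x' y hx' hx'ζ hy)
      rw [abs_sub_comm x x', abs_of_nonneg (sub_nonneg.2 hxx)]
      have h3 : (k1 * μ2 ^ (-(1/4) : ℝ))⁻¹ * x' ≤ D3 * (x' - x) := by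
        rw [hD3, mul_comm 2, mul_assoc]
        gcongr; linarith
      have h4 : 0 ≤ D2 * (x' - x) := mul_nonneg hD2p.le (by linarith)
      rw [abs_le]; constructor <;> nlinarith
  refine ⟨D1 + D2 + D3, by positivity, fun p => √(bfun γ (Q (p.1, fold m p.2))), ?_, ?_, ?_⟩
  · constructor
    · exact fun x y hx hxζ => hlo x _ hx hxζ (fold_mem hm y)
    · exact fun x y hx hxζ => hhi x _ hx hxζ (fold_mem hm y)
    · intro x y; simp only [fold_neg]
    · intro x y; simp only [fold_add]
    · intro x y y' hx hxζ
      refine (hly x _ _ hx hxζ (fold_mem hm y) (fold_mem hm y')).trans ?_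
      have hD2p : 0 < D2 := by positivity
      have hD3p : 0 < D3 := by positivity
      have hD1p : 0 < D1 := by positivity
      have : D1 ≤ D1 + D2 + D3 := by linarith
      have := fold_lip m y y'
      gcongr
    · intro x x' y hx hxζ hx' hx'ζ
      have hD1p : 0 < D1 := by positivity
      have : D2 + D3 ≤ D1 + D2 + D3 := by linarith
      rcases le_total x x' with h | h
      · refine (hla0 x x' _ hx h hx'ζ (fold_mem hm y)).trans ?_
        gcongr
      · rw [abs_sub_comm, abs_sub_comm x]
        refine (hla0 x' x _ hx' h hxζ (fold_mem hm y)).trans ?_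
        gcongr
  · intro p hp
    show _ = √(bfun γ (Q (p.1, fold m p.2)))
    rw [fold_of_mem hm hp.2, eQ hp]
  · have hd : ∀ᵐ p ∂(volume.restrict (Ioo (0 : ℝ) ζ ×ˢ Ioo (0 : ℝ) m)), DifferentiableAt ℝ Q p :=
      ae_restrict_of_ae hQ.ae_differentiableAt
    filter_upwards [hd, ae_restrict_mem (measurableSet_Ioo.prod measurableSet_Ioo)] with p hp hpm
    have hpI : p ∈ Icc (0 : ℝ) ζ ×ˢ Icc (0 : ℝ) m := ⟨Ioo_subset_Icc_self hpm.1, Ioo_subset_Icc_self hpm.2⟩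
    have e1 : pdy (fun p => √(bfun γ (Q (p.1, fold m p.2)))) p = pdy (fun p => √(bfun γ (Q p))) p := by
      apply pdy_congr (a := 0) (b := ζ) (c := 0) (d := m) _ hpm
      intro p hp; show √(bfun γ (Q (p.1, fold m p.2))) = _; rw [fold_of_mem hm hp.2]
    rw [e1, pdy_congr eQ hpm, eQ hpI]
    obtain ⟨a1, a2, a3, a4⟩ := hpos p.1 p.2 hpm.1.1 hpm.1.2.le hpI.2
    have hQy : DifferentiableAt ℝ (fun y => Q (p.1, y)) p.2 := by
      have h0 : DifferentiableAt ℝ (fun y : ℝ => (p.1, y)) p.2 := by fun_prop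
      exact DifferentiableAt.comp (g := Q) p.2 hp h0
    have := ((H (Q p) a3 a4).2.2.1).comp p.2 hQy.hasDerivAt
    exact this.deriv.symm


open Real Set MeasureTheory Filter

/-- `u` solves `u' = -a(u,σ)` on `[-N,N]`. -/
def Sol (a : ℝ × ℝ → ℝ) (N : ℝ) (u : ℝ → ℝ) : Prop :=
  ContinuousOn u (Icc (-N) N) ∧ ∀ t ∈ Ioo (-N) N, HasDerivAt u (-a (u t, t)) t

lemma sol_exists {a : ℝ × ℝ → ℝ} {K : NNReal} (ha : LipschitzWith K a) {A : ℝ}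
    (hA : ∀ p, |a p| ≤ A) {N : ℝ} (σ : ℝ) (hσ : σ ∈ Ioo (-N) N) (x : ℝ) :
    ∃ u, Sol a N u ∧ u σ = x := by
  have hA0 : 0 ≤ A := (abs_nonneg _).trans (hA (0, 0))
  have hN : 0 < N := by linarith [hσ.1, hσ.2]
  have hpl : IsPicardLindelof (fun t x => -a (x, t)) (tmin := -N) (tmax := N)
      ⟨σ, Ioo_subset_Icc_self hσ⟩ x (Real.toNNReal (A * (2 * N))) 0 A.toNNReal K := by
    constructor
    · intro t _
      exact ((lip_slice_x ha t).neg).lipschitzOnWith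
    · intro y _
      exact ((ha.continuous.comp (by fun_prop : Continuous fun t : ℝ => (y, t))).neg).continuousOn
    · intro t _ y _
      rw [norm_neg, Real.coe_toNNReal _ hA0]; exact hA _
    · rw [Real.coe_toNNReal _ hA0, Real.coe_toNNReal _ (by positivity)]
      simp only [NNReal.coe_zero, sub_zero]
      gcongr
      apply max_le <;> linarith [hσ.1, hσ.2]
  obtain ⟨u, hu, hd⟩ := hpl.exists_eq_forall_mem_Icc_hasDerivWithinAt₀
  refine ⟨u, ⟨fun t ht => (hd t ht).continuousWithinAt, fun t ht => ?_⟩, hu⟩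
  exact (hd t (Ioo_subset_Icc_self ht)).hasDerivAt (Icc_mem_nhds ht.1 ht.2)

lemma sol_unique {a : ℝ × ℝ → ℝ} {K : NNReal} (ha : LipschitzWith K a) {N σ : ℝ} (hσ : σ ∈ Ioo (-N) N)
    {u v : ℝ → ℝ} (hu : Sol a N u) (hv : Sol a N v) (h : u σ = v σ) : EqOn u v (Icc (-N) N) :=
  ODE_solution_unique_of_mem_Icc (v := fun t x => -a (x, t)) (s := fun _ => univ) (K := K)
    (fun t _ => ((lip_slice_x ha t).neg).lipschitzOnWith) hσ hu.1 hu.2 (fun _ _ => trivial)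
    hv.1 hv.2 (fun _ _ => trivial) h

lemma sol_mono {a : ℝ × ℝ → ℝ} {K : NNReal} (ha : LipschitzWith K a) {N σ τ : ℝ} (hσ : σ ∈ Ioo (-N) N)
    (hτ : τ ∈ Ioo (-N) N)
    {u v : ℝ → ℝ} (hu : Sol a N u) (hv : Sol a N v) (h : u σ ≤ v σ) : u τ ≤ v τ := by
  by_contra hc
  push Not at hc
  have hsub : uIcc σ τ ⊆ Ioo (-N) N := by
    intro x hx
    rw [mem_uIcc] at hx
    constructor <;> rcases hx with hx | hx <;> linarith [hσ.1, hσ.2, hτ.1, hτ.2, hx.1, hx.2]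
  have hcont : ContinuousOn (fun t => u t - v t) (uIcc σ τ) :=
    (hu.1.mono (hsub.trans Ioo_subset_Icc_self)).sub (hv.1.mono (hsub.trans Ioo_subset_Icc_self))
  have hmem : (0 : ℝ) ∈ uIcc (u σ - v σ) (u τ - v τ) := by
    rw [mem_uIcc]; left; constructor <;> linarith
  obtain ⟨x, hx, hx0⟩ := intermediate_value_uIcc hcont hmem
  simp only at hx0
  have := sol_unique ha (hsub hx) hu hv (by linarith) (Ioo_subset_Icc_self hτ)
  linarith

lemma sol_gronwall {a : ℝ × ℝ → ℝ} {K : NNReal} (ha : LipschitzWith K a) {N σ τ : ℝ} (hσ : σ ∈ Ioo (-N) N)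
    (hτ : τ ∈ Ioo (-N) N) (hστ : σ ≤ τ)
    {u v : ℝ → ℝ} (hu : Sol a N u) (hv : Sol a N v) :
    |u τ - v τ| ≤ |u σ - v σ| * Real.exp (K * (2 * N)) := by
  have hsub : Icc σ τ ⊆ Ioo (-N) N := Icc_subset_Ioo hσ.1 hτ.2
  have := dist_le_of_trajectories_ODE (v := fun t x => -a (x, t)) (K := K) (a := σ) (b := τ) (f := u) (g := v)
    (δ := |u σ - v σ|)
    (fun t => (lip_slice_x ha t).neg) (hu.1.mono (hsub.trans Ioo_subset_Icc_self))
    (fun t ht => (hu.2 t (hsub (Ico_subset_Icc_self ht))).hasDerivWithinAt)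
    (hv.1.mono (hsub.trans Ioo_subset_Icc_self))
    (fun t ht => (hv.2 t (hsub (Ico_subset_Icc_self ht))).hasDerivWithinAt) le_rfl τ ⟨hστ, le_rfl⟩
  refine this.trans ?_
  gcongr
  linarith [hσ.1, hτ.2]

lemma sol_anti {a : ℝ × ℝ → ℝ} (h0 : ∀ p, 0 ≤ a p) {N σ τ : ℝ} (hσ : σ ∈ Ioo (-N) N)
    (hτ : τ ∈ Ioo (-N) N) (hστ : σ ≤ τ) {u : ℝ → ℝ} (hu : Sol a N u) : u τ ≤ u σ := by
  have : AntitoneOn u (Ioo (-N) N) := by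
    apply antitoneOn_of_deriv_nonpos (convex_Ioo _ _) (hu.1.mono Ioo_subset_Icc_self)
    · rw [interior_Ioo]; exact fun x hx => (hu.2 x hx).differentiableAt.differentiableWithinAt
    · rw [interior_Ioo]; intro x hx; rw [(hu.2 x hx).deriv]; linarith [h0 (u x, x)]
  exact this hσ hτ hστ

/-- The label function of the characteristic flow. -/
theorem flow_exists {a : ℝ × ℝ → ℝ} {K : NNReal} (ha : LipschitzWith K a) {A m ζ C1 : ℝ} (hm : 0 < m)
    (hA : ∀ p, |a p| ≤ A) (h0 : ∀ p, 0 ≤ a p) (hneg : ∀ t, a (0, t) = 0)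
    (hlin : ∀ x t, 0 ≤ x → x ≤ ζ → a (x, t) ≤ C1 * x) :
    ∃ T : ℝ × ℝ → ℝ, (∃ L : NNReal, LipschitzOnWith L T (univ ×ˢ Icc (-m) m)) ∧
      (∀ x, T (x, m) = x) ∧
      (∀ x x' t, t ∈ Icc (-m) m → x ≤ x' → T (x, t) ≤ T (x', t)) ∧
      (∀ x t t', -m ≤ t → t ≤ t' → t' ≤ m → T (x, t) ≤ T (x, t')) ∧
      (∀ x t, 0 < x → x ≤ ζ → t ∈ Icc (-m) m → Real.exp (-(2 * m * C1)) * x ≤ T (x, t) ∧ T (x, t) ≤ x) ∧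
      (∀ x, ∃ v ∈ Icc (T (x, -m)) x, ∃ t, x - T (x, -m) = 2 * m * a (v, t)) ∧
      (∀ x t, t ∈ Ioo (-m) m → DifferentiableAt ℝ T (x, t) → pdy T (x, t) = a (x, t) * pdx T (x, t)) := by
  set N := m + 1 with hN
  have hIN : ∀ {t}, t ∈ Icc (-m) m → t ∈ Ioo (-N) N := fun {t} ht =>
    ⟨by linarith [ht.1], by linarith [ht.2]⟩
  have hmN : m ∈ Ioo (-N) N := hIN ⟨by linarith, le_rfl⟩
  have hmN' : -m ∈ Ioo (-N) N := hIN ⟨le_rfl, by linarith⟩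
  have hex : ∀ p : ℝ × ℝ, ∃ u, p.2 ∈ Ioo (-N) N → Sol a N u ∧ u p.2 = p.1 := by
    intro p
    by_cases hp : p.2 ∈ Ioo (-N) N
    · obtain ⟨u, hu⟩ := sol_exists ha hA p.2 hp p.1
      exact ⟨u, fun _ => hu⟩
    · exact ⟨0, fun h => absurd h hp⟩
  choose U hU using hex
  have hU' : ∀ x t, t ∈ Ioo (-N) N → Sol a N (U (x, t)) ∧ U (x, t) t = x := fun x t ht => hU (x, t) ht
  set T : ℝ × ℝ → ℝ := fun p => U p m with hT
  -- transport
  have htr : ∀ u, Sol a N u → ∀ t ∈ Ioo (-N) N, T (u t, t) = u m := by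
    intro u hu t ht
    obtain ⟨h1, h2⟩ := hU' (u t) t ht
    exact sol_unique ha ht h1 hu h2 (Ioo_subset_Icc_self hmN)
  have hmono : ∀ x x' t, t ∈ Icc (-m) m → x ≤ x' → T (x, t) ≤ T (x', t) := by
    intro x x' t ht hxx
    obtain ⟨h1, h2⟩ := hU' x t (hIN ht)
    obtain ⟨h1', h2'⟩ := hU' x' t (hIN ht)
    exact sol_mono ha (hIN ht) hmN h1 h1' (by rw [h2, h2']; exact hxx)
  have hz : Sol a N (fun _ => 0) := by
    refine ⟨continuousOn_const, fun t _ => ?_⟩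
    rw [hneg, neg_zero]; exact hasDerivAt_const t 0
  have hlipx : ∀ x x' t, t ∈ Icc (-m) m → |T (x, t) - T (x', t)| ≤ |x - x'| * Real.exp (K * (2 * N)) := by
    intro x x' t ht
    obtain ⟨h1, h2⟩ := hU' x t (hIN ht)
    obtain ⟨h1', h2'⟩ := hU' x' t (hIN ht)
    have := sol_gronwall ha (hIN ht) hmN ht.2 h1 h1'
    rwa [h2, h2'] at this
  have hA0 : 0 ≤ A := (abs_nonneg _).trans (hA (0, 0))
  have hlipu : ∀ u, Sol a N u → ∀ t ∈ Ioo (-N) N, ∀ t' ∈ Ioo (-N) N, |u t - u t'| ≤ A * |t - t'| := by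
    intro u hu t ht t' ht'
    exact lip_of_deriv_bound (convex_Ioo _ _) hu.2 (fun x _ => by rw [abs_neg]; exact hA _) ht ht'
  have hlipt : ∀ x t t', t ∈ Icc (-m) m → t' ∈ Icc (-m) m →
      |T (x, t) - T (x, t')| ≤ A * |t - t'| * Real.exp (K * (2 * N)) := by
    intro x t t' ht ht'
    obtain ⟨h1, h2⟩ := hU' x t (hIN ht)
    have e1 := htr _ h1 t' (hIN ht')
    have e2 : T (x, t) = T (U (x, t) t', t') := e1.symm
    rw [e2]
    refine (hlipx _ _ _ ht').trans ?_
    gcongr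
    have := hlipu _ h1 t' (hIN ht') t (hIN ht)
    rw [h2] at this
    rwa [abs_sub_comm t]
  refine ⟨T, ⟨Real.toNNReal ((A + 1) * Real.exp (K * (2 * N))), ?_⟩, ?_, hmono, ?_, ?_, ?_, ?_⟩
  · apply LipschitzOnWith.of_dist_le_mul
    rintro ⟨x, t⟩ ⟨-, ht⟩ ⟨x', t'⟩ ⟨-, ht'⟩
    rw [Real.coe_toNNReal _ (by positivity), Real.dist_eq]
    have h1 := hlipx x x' t ht
    have h2 := hlipt x' t t' ht ht'
    have d1 : |x - x'| ≤ dist (x, t) (x', t') := by rw [Prod.dist_eq]; exact le_max_left _ _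
    have d2 : |t - t'| ≤ dist (x, t) (x', t') := by rw [Prod.dist_eq]; exact le_max_right _ _
    have h3 := abs_sub_le (T (x, t)) (T (x', t)) (T (x', t'))
    set D := dist (x, t) (x', t')
    set E := Real.exp (K * (2 * N))
    have hE : 0 < E := Real.exp_pos _
    calc |T (x, t) - T (x', t')| ≤ |x - x'| * E + A * |t - t'| * E := by linarith
      _ ≤ D * E + A * D * E := by gcongr
      _ = _ := by ring
  · intro x; exact (hU' x m hmN).2
  · intro x t t' ht htt ht'
    have htI : t ∈ Icc (-m) m := ⟨ht, htt.trans ht'⟩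
    have htI' : t' ∈ Icc (-m) m := ⟨ht.trans htt, ht'⟩
    obtain ⟨h1, h2⟩ := hU' x t (hIN htI)
    have e1 := htr _ h1 t' (hIN htI')
    have e2 : T (x, t) = T (U (x, t) t', t') := e1.symm
    rw [e2]
    apply hmono _ _ _ htI'
    have := sol_anti h0 (hIN htI) (hIN htI') htt h1
    rwa [h2] at this
  · intro x t hx hxζ ht
    obtain ⟨h1, h2⟩ := hU' x t (hIN ht)
    set u := U (x, t) with hu
    have hTu : T (x, t) = u m := rfl
    have hle : u m ≤ x := by
      have := sol_anti h0 (hIN ht) hmN ht.2 h1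
      rwa [h2] at this
    refine ⟨?_, hle⟩
    have hnn : ∀ τ ∈ Ioo (-N) N, 0 ≤ u τ := fun τ hτ =>
      sol_mono ha (hIN ht) hτ hz h1 (by rw [h2]; exact hx.le)
    have hmon : MonotoneOn (fun τ => u τ * Real.exp (C1 * τ)) (Icc t m) := by
      have hsub : Icc t m ⊆ Ioo (-N) N := Icc_subset_Ioo (hIN ht).1 hmN.2
      have hder : ∀ τ ∈ Icc t m, HasDerivAt (fun τ => u τ * Real.exp (C1 * τ))
          (-a (u τ, τ) * Real.exp (C1 * τ) + u τ * (Real.exp (C1 * τ) * C1)) τ := by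
        intro τ hτ
        have := (((hasDerivAt_id τ).const_mul C1)).exp
        simp only [id, mul_one] at this
        exact (h1.2 τ (hsub hτ)).mul this
      apply monotoneOn_of_deriv_nonneg (convex_Icc _ _)
      · exact fun τ hτ => (hder τ hτ).continuousAt.continuousWithinAt
      · intro τ hτ; exact (hder τ (interior_subset hτ)).differentiableAt.differentiableWithinAt
      · intro τ hτ
        have hτ := interior_subset hτ
        rw [(hder τ hτ).deriv]
        have hux : u τ ≤ ζ := by
          have := sol_anti h0 (hIN ht) (hsub hτ) hτ.1 h1
          rw [h2] at this; linarith
        have := hlin (u τ) τ (hnn τ (hsub hτ)) hux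
        have he := Real.exp_pos (C1 * τ)
        nlinarith
    have h3 := hmon ⟨le_rfl, ht.2⟩ ⟨ht.2, le_rfl⟩ ht.2
    simp only [h2] at h3
    have hC1 : 0 ≤ C1 := by
      have := (h0 (x, t)).trans (hlin x t hx.le hxζ)
      by_contra hc; push Not at hc; nlinarith
    rw [hTu]
    have h4 : x * Real.exp (C1 * (t - m)) ≤ u m := by
      have : Real.exp (C1 * (t - m)) = Real.exp (C1 * t) / Real.exp (C1 * m) := by
        rw [← Real.exp_sub]; ring_nf
      rw [this, ← mul_div_assoc, div_le_iff₀ (Real.exp_pos _)]; exact h3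
    refine le_trans ?_ h4
    rw [mul_comm]
    gcongr
    nlinarith [ht.1]
  · intro x
    obtain ⟨h1, h2⟩ := hU' x (-m) hmN'
    set u := U (x, -m) with hu
    have hsub : Icc (-m) m ⊆ Ioo (-N) N := Icc_subset_Ioo hmN'.1 hmN.2
    obtain ⟨t, ht, he⟩ := exists_hasDerivAt_eq_slope u (fun t => -a (u t, t)) (by linarith : -m < m)
      (h1.1.mono (hsub.trans Ioo_subset_Icc_self)) (fun t ht => h1.2 t (hsub (Ioo_subset_Icc_self ht)))
    have htN := hsub (Ioo_subset_Icc_self ht)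
    refine ⟨u t, ⟨?_, ?_⟩, t, ?_⟩
    · exact sol_anti h0 htN hmN ht.2.le h1
    · have := sol_anti h0 hmN' htN ht.1.le h1
      rwa [h2] at this
    · show x - u m = _
      rw [h2, eq_div_iff (by linarith)] at he
      linarith
  · intro x t ht hd
    have htI := hIN (Ioo_subset_Icc_self ht)
    obtain ⟨h1, h2⟩ := hU' x t htI
    set u := U (x, t) with hu
    have hT' := hd.hasFDerivAt
    set F := fderiv ℝ T (x, t) with hF
    have hc : HasDerivAt (fun τ => (u τ, τ)) (-a (u t, t), 1) t := (h1.2 t htI).prodMk (hasDerivAt_id t)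
    have hcomp : HasDerivAt (fun τ => T (u τ, τ)) (F (-a (u t, t), 1)) t := by
      have hT2 : HasFDerivAt T F (u t, t) := by rw [h2]; exact hT'
      exact HasFDerivAt.comp_hasDerivAt (f := fun τ => (u τ, τ)) t hT2 hc
    have hconst : HasDerivAt (fun τ => T (u τ, τ)) 0 t := by
      apply (hasDerivAt_const t (u m)).congr_of_eventuallyEq
      filter_upwards [Ioo_mem_nhds htI.1 htI.2] with τ hτ using htr u h1 τ hτ
    have e0 := hcomp.unique hconst
    have ex : pdx T (x, t) = F (1, 0) := by
      have hc : HasDerivAt (fun y : ℝ => (y, t)) (1, 0) x := (hasDerivAt_id x).prodMk (hasDerivAt_const x t)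
      exact (hT'.comp_hasDerivAt x hc).deriv
    have ey : pdy T (x, t) = F (0, 1) := by
      have hc : HasDerivAt (fun y : ℝ => (x, y)) (0, 1) t := (hasDerivAt_const t x).prodMk (hasDerivAt_id t)
      exact (hT'.comp_hasDerivAt t hc).deriv
    rw [ex, ey]
    have e1 : ((-a (u t, t), 1) : ℝ × ℝ) = (-a (u t, t)) • ((1, 0) : ℝ × ℝ) + ((0, 1) : ℝ × ℝ) := by
      simp
    rw [e1, map_add, map_smul, h2, smul_eq_mul] at e0
    linarith


open Real Set MeasureTheory Filter Topology

lemma lipOn_of_sep {f : ℝ × ℝ → ℝ} {s t : Set ℝ} {K1 K2 : ℝ} (hK1 : 0 ≤ K1) (hK2 : 0 ≤ K2)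
    (h1 : ∀ x ∈ s, ∀ x' ∈ s, ∀ y ∈ t, |f (x, y) - f (x', y)| ≤ K1 * |x - x'|)
    (h2 : ∀ x ∈ s, ∀ y ∈ t, ∀ y' ∈ t, |f (x, y) - f (x, y')| ≤ K2 * |y - y'|) :
    LipschitzOnWith (Real.toNNReal (K1 + K2)) f (s ×ˢ t) := by
  apply LipschitzOnWith.of_dist_le_mul
  rintro ⟨x, y⟩ ⟨hx, hy⟩ ⟨x', y'⟩ ⟨hx', hy'⟩
  rw [Real.coe_toNNReal _ (by positivity), Real.dist_eq]
  have d1 : |x - x'| ≤ dist (x, y) (x', y') := by rw [Prod.dist_eq]; exact le_max_left _ _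
  have d2 : |y - y'| ≤ dist (x, y) (x', y') := by rw [Prod.dist_eq]; exact le_max_right _ _
  have h3 := abs_sub_le (f (x, y)) (f (x', y)) (f (x', y'))
  have h4 := h1 x hx x' hx' y hy
  have h5 := h2 x' hx' y hy y' hy'
  set D := dist (x, y) (x', y')
  calc |f (x, y) - f (x', y')| ≤ K1 * |x - x'| + K2 * |y - y'| := by linarith
    _ ≤ K1 * D + K2 * D := by gcongr
    _ = _ := by ring

lemma inv_sub_inv_abs {a b c1 X : ℝ} (hc1 : 0 < c1) (hX : 0 < X) (ha : c1 * X⁻¹ ≤ a) (hb : c1 * X⁻¹ ≤ b) :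
    |a⁻¹ - b⁻¹| ≤ |a - b| * (X / c1 * (X / c1)) := by
  have h0 : 0 < c1 * X⁻¹ := by positivity
  have ha0 : 0 < a := by linarith
  have hb0 : 0 < b := by linarith
  have e : a⁻¹ - b⁻¹ = (b - a) * (a⁻¹ * b⁻¹) := by field_simp
  have i1 : a⁻¹ ≤ X / c1 := by
    have := inv_anti₀ h0 ha
    rwa [mul_inv, inv_inv, mul_comm, ← div_eq_mul_inv] at this
  have i2 : b⁻¹ ≤ X / c1 := by
    have := inv_anti₀ h0 hb
    rwa [mul_inv, inv_inv, mul_comm, ← div_eq_mul_inv] at this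
  rw [e, abs_mul, abs_sub_comm, abs_of_pos (by positivity : 0 < a⁻¹ * b⁻¹)]
  gcongr

section CoefLemmas
variable {ζ m κ s c1 c2 C : ℝ} {c : ℝ × ℝ → ℝ}

lemma Coef.pos (H : Coef ζ m κ s c1 c2 C c) (hc1 : 0 < c1) {x : ℝ} (y : ℝ) (hx : 0 < x) (hxζ : x ≤ ζ) : 0 < c (x, y) :=
  lt_of_lt_of_le (by positivity) (H.lo x y hx hxζ)

lemma Coef.inv_le (H : Coef ζ m κ s c1 c2 C c) (hc1 : 0 < c1) {x : ℝ} (y : ℝ) (hx : 0 < x) (hxζ : x ≤ ζ) :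
    (c (x, y))⁻¹ ≤ x ^ κ / c1 := by
  have := inv_anti₀ (by positivity) (H.lo x y hx hxζ)
  rwa [mul_inv, ← Real.rpow_neg hx.le, neg_neg, mul_comm, ← div_eq_mul_inv] at this

lemma Coef.le_inv (H : Coef ζ m κ s c1 c2 C c) (hc1 : 0 < c1) {x : ℝ} (y : ℝ) (hx : 0 < x) (hxζ : x ≤ ζ) :
    x ^ κ / c2 ≤ (c (x, y))⁻¹ := by
  have := inv_anti₀ (H.pos hc1 y hx hxζ) (H.hi x y hx hxζ)
  rwa [mul_inv, ← Real.rpow_neg hx.le, neg_neg, mul_comm, ← div_eq_mul_inv] at this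

/-- `c` is Lipschitz away from `x = 0`. -/
lemma Coef.lip (H : Coef ζ m κ s c1 c2 C c) (hc1 : 0 < c1) (hc2 : 0 < c2) (hC : 0 < C) (hκ : 1 ≤ κ)
    (hζ1 : ζ ≤ 1) {ε : ℝ} (hε : 0 < ε) : ∃ L : NNReal, LipschitzOnWith L c (Icc ε ζ ×ˢ univ) := by
  refine ⟨_, lipOn_of_sep (K1 := (c2 * ε ^ (-κ)) * (c2 * ε ^ (-κ)) * C) (K2 := C * max (ε ^ (s - 1)) 1) (by positivity) (by positivity) ?_ ?_⟩
  · intro x hx x' hx' y _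
    have hx0 : 0 < x := by linarith [hx.1]
    have hx0' : 0 < x' := by linarith [hx'.1]
    have p1 := H.pos hc1 y hx0 hx.2
    have p2 := H.pos hc1 y hx0' hx'.2
    have u1 : ∀ z, ε ≤ z → z ≤ ζ → c (z, y) ≤ c2 * ε ^ (-κ) := by
      intro z hz hzζ
      refine (H.hi z y (by linarith) hzζ).trans ?_
      exact mul_le_mul_of_nonneg_left (Real.rpow_le_rpow_of_nonpos hε hz (by linarith)) hc2.le
    have e : c (x, y) - c (x', y) = c (x, y) * c (x', y) * ((c (x', y))⁻¹ - (c (x, y))⁻¹) := by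
      field_simp
    rw [e, abs_mul, abs_of_pos (by positivity)]
    have l := H.lipa x' x y hx0' hx'.2 hx0 hx.2
    rw [abs_sub_comm x' x] at l
    have v1 := u1 x hx.1 hx.2
    have v2 := u1 x' hx'.1 hx'.2
    calc _ ≤ (c2 * ε ^ (-κ)) * (c2 * ε ^ (-κ)) * (C * |x - x'|) := by gcongr
      _ = _ := by ring
  · intro x hx y _ y' _
    have hx0 : 0 < x := by linarith [hx.1]
    refine (H.lipy x y y' hx0 hx.2).trans ?_
    gcongr
    rcases le_total 0 (s - 1) with h | h
    · exact (Real.rpow_le_one hx0.le (hx.2.trans hζ1) h).trans (le_max_right _ _)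
    · exact (Real.rpow_le_rpow_of_nonpos hε hx.1 h).trans (le_max_left _ _)

/-- the slowness -/
def slow (ζ : ℝ) (c : ℝ × ℝ → ℝ) (p : ℝ × ℝ) : ℝ := if p.1 ≤ 0 then 0 else (c (min p.1 ζ, p.2))⁻¹

lemma slow_eq {x : ℝ} (y : ℝ) (hx : 0 < x) (hxζ : x ≤ ζ) : slow ζ c (x, y) = (c (x, y))⁻¹ := by
  unfold slow; rw [if_neg (by simpa using hx)]; simp [min_eq_left hxζ]

lemma slow_nonneg (H : Coef ζ m κ s c1 c2 C c) (hc1 : 0 < c1) (hζ : 0 < ζ) (p : ℝ × ℝ) : 0 ≤ slow ζ c p := by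
  unfold slow
  split_ifs with h
  · exact le_rfl
  · push Not at h
    exact (inv_pos.2 (H.pos hc1 _ (lt_min h hζ) (min_le_right _ _))).le

lemma slow_le (H : Coef ζ m κ s c1 c2 C c) (hc1 : 0 < c1) (hζ : 0 < ζ) (hζ1 : ζ ≤ 1) (hκ : 1 ≤ κ) {x : ℝ} (y : ℝ)
    (hx : 0 ≤ x) : slow ζ c (x, y) ≤ 1 / c1 * min x ζ := by
  unfold slow
  split_ifs with h
  · have : x = 0 := le_antisymm h hx
    subst this; simp [hζ.le]
  · push Not at h
    simp only at h
    have h0 := lt_min h hζ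
    refine (H.inv_le hc1 _ h0 (min_le_right _ _)).trans ?_
    rw [div_eq_mul_one_div, mul_comm]
    gcongr
    calc (min x ζ) ^ κ ≤ (min x ζ) ^ (1 : ℝ) :=
          Real.rpow_le_rpow_of_exponent_ge h0 ((min_le_right _ _).trans hζ1) hκ
      _ = _ := Real.rpow_one _

lemma slow_lip (H : Coef ζ m κ s c1 c2 C c) (hc1 : 0 < c1) (hC : 0 < C) (hζ : 0 < ζ) (hζ1 : ζ ≤ 1)
    (hκ : 1 ≤ κ) (hs : 0 < s) : ∃ K : NNReal, LipschitzWith K (slow ζ c) := by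
  have hle : ∀ x y, 0 ≤ x → slow ζ c (x, y) ≤ 1 / c1 * x := fun x y hx =>
    (slow_le H hc1 hζ hζ1 hκ y hx).trans (by gcongr; exact min_le_left _ _)
  have := lipOn_of_sep (f := slow ζ c) (s := univ) (t := univ) (K1 := C + 1 / c1) (K2 := C / c1 / c1)
    (by positivity) (by positivity) ?_ ?_
  · rw [univ_prod_univ, lipschitzOnWith_univ] at this; exact ⟨_, this⟩
  · have key : ∀ x x' y, x ≤ x' → |slow ζ c (x, y) - slow ζ c (x', y)| ≤ (C + 1 / c1) * |x - x'| := by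
      intro x x' y hxx
      rcases le_or_gt x 0 with hx | hx
      · have e : slow ζ c (x, y) = 0 := by unfold slow; rw [if_pos hx]
        rw [e, zero_sub, abs_neg, abs_of_nonneg (slow_nonneg H hc1 hζ _)]
        rcases le_or_gt x' 0 with hx' | hx'
        · have e : slow ζ c (x', y) = 0 := by unfold slow; rw [if_pos hx']
          rw [e]; positivity
        · refine (hle x' y hx'.le).trans ?_
          have : 0 < 1 / c1 := by positivity
          rw [abs_sub_comm, abs_of_nonneg (sub_nonneg.2 hxx)]
          nlinarith
      · have hx' : 0 < x' := by linarith
        unfold slow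
        rw [if_neg (by simpa using hx), if_neg (by simpa using hx')]
        refine (H.lipa _ _ y (lt_min hx hζ) (min_le_right _ _) (lt_min hx' hζ) (min_le_right _ _)).trans ?_
        have : |min x ζ - min x' ζ| ≤ |x - x'| := by
          have := abs_min_sub_min_le_max x ζ x' ζ
          simpa using this
        have h1 : 0 < 1 / c1 := by positivity
        calc C * |min x ζ - min x' ζ| ≤ C * |x - x'| := by gcongr
          _ ≤ _ := by gcongr; linarith
    intro x _ x' _ y _
    rcases le_total x x' with h | h
    · exact key x x' y h
    · rw [abs_sub_comm, abs_sub_comm x]; exact key x' x y h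
  · intro x _ y _ y' _
    rcases le_or_gt x 0 with hx | hx
    · have e : ∀ y, slow ζ c (x, y) = 0 := fun y => by unfold slow; rw [if_pos hx]
      rw [e, e, sub_self, abs_zero]; positivity
    · unfold slow
      rw [if_neg (by simpa using hx), if_neg (by simpa using hx)]
      simp only
      set z := min x ζ with hz
      have hz0 : 0 < z := lt_min hx hζ
      have hzζ : z ≤ ζ := min_le_right _ _
      have hX : 0 < z ^ κ := Real.rpow_pos_of_pos hz0 _
      have := inv_sub_inv_abs hc1 hX (a := c (z, y)) (b := c (z, y'))
        (by rw [← Real.rpow_neg hz0.le]; exact H.lo z y hz0 hzζ)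
        (by rw [← Real.rpow_neg hz0.le]; exact H.lo z y' hz0 hzζ)
      refine this.trans ?_
      have l := H.lipy z y y' hz0 hzζ
      have h1 : z ^ (s - 1) * z ^ κ ≤ 1 := by
        rw [← Real.rpow_add hz0]; exact Real.rpow_le_one hz0.le (hzζ.trans hζ1) (by linarith)
      have h2 : z ^ κ ≤ 1 := Real.rpow_le_one hz0.le (hzζ.trans hζ1) (by linarith)
      calc _ ≤ (C * z ^ (s - 1) * |y - y'|) * (z ^ κ / c1 * (z ^ κ / c1)) := by gcongr
        _ = C / c1 / c1 * |y - y'| * ((z ^ (s - 1) * z ^ κ) * z ^ κ) := by field_simp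
        _ ≤ C / c1 / c1 * |y - y'| * (1 * 1) := by gcongr
        _ = _ := by ring

end CoefLemmas

lemma pow_diff_lower {x y l : ℝ} (hy : 0 < y) (hyx : y ≤ x) (hl : 0 < l) :
    y ^ l * (x - y) ≤ x ^ (l + 1) - y ^ (l + 1) := by
  have hx : 0 < x := by linarith
  rw [Real.rpow_add_one hx.ne', Real.rpow_add_one hy.ne']
  have := Real.rpow_le_rpow hy.le hyx hl.le
  nlinarith

lemma pow_diff_upper {x y l : ℝ} (hy : 0 < y) (hyx : y ≤ x) (hl : 0 < l) :
    x ^ (l + 1) - y ^ (l + 1) ≤ (l + 1) * (x ^ l * (x - y)) := by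
  have hx : 0 < x := by linarith
  have h := one_add_mul_self_le_rpow_one_add (s := y / x - 1) (by have : 0 < y / x := by positivity
                                                                  linarith) (p := l + 1) (by linarith)
  have e : 1 + (y / x - 1) = y / x := by ring
  rw [e, Real.div_rpow hy.le hx.le, le_div_iff₀ (by positivity), Real.rpow_add_one hx.ne'] at h
  rw [Real.rpow_add_one hx.ne']
  have e2 : (1 + (l + 1) * (y / x - 1)) * (x ^ l * x) = x ^ l * x - (l + 1) * (x ^ l * (x - y)) := by
    field_simp; ring
  rw [e2] at h; linarith

theorem G_exists {S h : ℝ → ℝ} {ζ κ lam d1 d2 μ3 μ4 : ℝ} (hζ1 : ζ ≤ 1) (hκ : 1 ≤ κ) (hlam : 0 < lam)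
    (hd1 : 0 < d1) (hd2 : 0 < d2) (hμ3 : 0 < μ3) (hμ4 : 0 < μ4)
    (S1 : ∀ t ∈ Ioo 0 ζ, 0 < S t ∧ S t ≤ t) (S2 : ContinuousOn S (Ioo 0 ζ)) (S3 : MonotoneOn S (Ioo 0 ζ))
    (S4 : ∀ t ∈ Ioo 0 ζ, d1 * (S t) ^ κ ≤ t - S t ∧ t - S t ≤ d2 * t ^ κ)
    (h1 : ContinuousOn h (Ioo 0 ζ)) (h2 : MonotoneOn h (Ioo 0 ζ))
    (h3 : ∀ t ∈ Ioo 0 ζ, μ3 * t ^ (lam + κ) ≤ h t ∧ h t ≤ μ4 * t ^ (lam + κ)) :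
    ∃ G : ℝ → ℝ, ContinuousOn G (Ioo 0 ζ) ∧ MonotoneOn G (Ioo 0 ζ) ∧
      (∀ t ∈ Ioo 0 ζ, G t = h t + G (S t)) ∧
      (∀ t ∈ Ioo 0 ζ, μ3 / (d2 * (lam + 1)) * t ^ (lam + 1) ≤ G t ∧ G t ≤ μ4 * (1 + 1 / d1) * t ^ (lam + 1)) := by
  have hit : ∀ k : ℕ, ∀ t ∈ Ioo 0 ζ, S^[k] t ∈ Ioo 0 ζ := by
    intro k
    induction k with
    | zero => intro t ht; exact ht
    | succ k ih =>
      intro t ht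
      rw [Function.iterate_succ_apply']
      have := S1 _ (ih t ht)
      exact ⟨this.1, this.2.trans_lt (ih t ht).2⟩
  have hnn : ∀ t ∈ Ioo 0 ζ, 0 ≤ h t := fun t ht =>
    le_trans (mul_nonneg hμ3.le (Real.rpow_nonneg ht.1.le _)) (h3 t ht).1
  have hup : ∀ t ∈ Ioo 0 ζ, ∀ n : ℕ, ∑ k ∈ Finset.range n, h (S^[k] t) ≤ μ4 * (1 + 1 / d1) * t ^ (lam + 1) := by
    intro t ht n
    have step : ∀ x ∈ Ioo 0 ζ, h (S x) ≤ μ4 / d1 * (x ^ (lam + 1) - (S x) ^ (lam + 1)) := by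
      intro x hx
      obtain ⟨a1, a2⟩ := S1 x hx
      have hSx : S x ∈ Ioo 0 ζ := ⟨a1, a2.trans_lt hx.2⟩
      calc h (S x) ≤ μ4 * (S x) ^ (lam + κ) := (h3 _ hSx).2
        _ = μ4 / d1 * ((S x) ^ lam * (d1 * (S x) ^ κ)) := by
            rw [Real.rpow_add a1]; field_simp
        _ ≤ μ4 / d1 * ((S x) ^ lam * (x - S x)) := by
            gcongr; exact (S4 x hx).1
        _ ≤ _ := by gcongr; exact pow_diff_lower a1 a2 hlam
    have hpart : ∀ n : ℕ, ∑ k ∈ Finset.range n, h (S^[k + 1] t) ≤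
        μ4 / d1 * (t ^ (lam + 1) - (S^[n] t) ^ (lam + 1)) := by
      intro n
      induction n with
      | zero => simp
      | succ n ih =>
        rw [Finset.sum_range_succ]
        have := step _ (hit n t ht)
        rw [← Function.iterate_succ_apply' S n t] at this
        linarith
    have ht1 : h t ≤ μ4 * t ^ (lam + 1) := by
      refine (h3 t ht).2.trans ?_
      exact mul_le_mul_of_nonneg_left
        (Real.rpow_le_rpow_of_exponent_ge ht.1 (ht.2.le.trans hζ1) (by linarith)) hμ4.le
    have h5 := hpart n
    have h6 : 0 ≤ μ4 / d1 * (S^[n] t) ^ (lam + 1) := by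
      have := (hit n t ht).1; positivity
    have h7 : ∑ k ∈ Finset.range n, h (S^[k] t) ≤ ∑ k ∈ Finset.range (n + 1), h (S^[k] t) := by
      rw [Finset.sum_range_succ]; linarith [hnn _ (hit n t ht)]
    rw [Finset.sum_range_succ'] at h7
    have e : μ4 * (1 + 1 / d1) * t ^ (lam + 1) = μ4 * t ^ (lam + 1) + μ4 / d1 * t ^ (lam + 1) := by ring
    rw [e]
    simp only [Function.iterate_zero, id] at h7
    linarith
  have hsum : ∀ t ∈ Ioo 0 ζ, Summable fun k : ℕ => h (S^[k] t) := fun t ht =>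
    summable_of_sum_range_le (fun k => hnn _ (hit k t ht)) (hup t ht)
  have hitm : ∀ k : ℕ, MonotoneOn (S^[k]) (Ioo 0 ζ) := by
    intro k
    induction k with
    | zero => exact monotoneOn_id
    | succ k ih =>
      intro x hx y hy hxy
      rw [Function.iterate_succ_apply', Function.iterate_succ_apply']
      exact S3 (hit k x hx) (hit k y hy) (ih hx hy hxy)
  have hitc : ∀ k : ℕ, ContinuousOn (S^[k]) (Ioo 0 ζ) := by
    intro k
    induction k with
    | zero => exact continuousOn_id
    | succ k ih =>
      rw [Function.iterate_succ']
      exact S2.comp ih (fun x hx => hit k x hx)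
  refine ⟨fun t => ∑' k : ℕ, h (S^[k] t), ?_, ?_, ?_, ?_⟩
  · intro t ht
    set z := (t + ζ) / 2 with hz
    have hzI : z ∈ Ioo 0 ζ := ⟨by linarith [ht.1, ht.2], by linarith [ht.2]⟩
    have hsub : Ioo 0 z ⊆ Ioo 0 ζ := Ioo_subset_Ioo le_rfl hzI.2.le
    have : ContinuousOn (fun t => ∑' k : ℕ, h (S^[k] t)) (Ioo 0 z) := by
      apply continuousOn_tsum (u := fun k => h (S^[k] z))
      · intro k
        exact h1.comp ((hitc k).mono hsub) (fun x hx => hit k x (hsub hx))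
      · exact hsum z hzI
      · intro k x hx
        rw [Real.norm_eq_abs, abs_of_nonneg (hnn _ (hit k x (hsub hx)))]
        exact h2 (hit k x (hsub hx)) (hit k z hzI) (hitm k (hsub hx) hzI hx.2.le)
    exact (this.continuousAt (Ioo_mem_nhds ht.1 (by linarith [ht.2]))).continuousWithinAt
  · intro x hx y hy hxy
    exact (hsum x hx).tsum_le_tsum (fun k => h2 (hit k x hx) (hit k y hy) (hitm k hx hy hxy)) (hsum y hy)
  · intro t ht
    exact (hsum t ht).tsum_eq_zero_add
  · intro t ht
    refine ⟨?_, Real.tsum_le_of_sum_range_le (fun k => hnn _ (hit k t ht)) (hup t ht)⟩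
    have step : ∀ x ∈ Ioo 0 ζ, μ3 / (d2 * (lam + 1)) * (x ^ (lam + 1) - (S x) ^ (lam + 1)) ≤ h x := by
      intro x hx
      obtain ⟨a1, a2⟩ := S1 x hx
      calc μ3 / (d2 * (lam + 1)) * (x ^ (lam + 1) - (S x) ^ (lam + 1))
          ≤ μ3 / (d2 * (lam + 1)) * ((lam + 1) * (x ^ lam * (x - S x))) := by
            gcongr; exact pow_diff_upper a1 a2 hlam
        _ ≤ μ3 / (d2 * (lam + 1)) * ((lam + 1) * (x ^ lam * (d2 * x ^ κ))) := by
            have := hx.1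
            gcongr; exact (S4 x hx).2
        _ = μ3 * x ^ (lam + κ) := by rw [Real.rpow_add hx.1]; field_simp
        _ ≤ _ := (h3 x hx).1
    have hpart : ∀ n : ℕ, μ3 / (d2 * (lam + 1)) * (t ^ (lam + 1) - (S^[n] t) ^ (lam + 1)) ≤
        ∑ k ∈ Finset.range n, h (S^[k] t) := by
      intro n
      induction n with
      | zero => simp
      | succ n ih =>
        rw [Finset.sum_range_succ]
        have := step _ (hit n t ht)
        rw [← Function.iterate_succ_apply' S n t] at this
        linarith
    have hlim0 : Tendsto (fun n : ℕ => (S^[n] t) ^ (lam + 1)) atTop (𝓝 0) := by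
      have l1 := (hsum t ht).tendsto_atTop_zero
      have l2 : Tendsto (fun n : ℕ => (S^[n] t) ^ (lam + κ)) atTop (𝓝 0) := by
        have l3 : Tendsto (fun n : ℕ => μ3⁻¹ * h (S^[n] t)) atTop (𝓝 0) := by
          simpa using l1.const_mul μ3⁻¹
        refine squeeze_zero (fun n => Real.rpow_nonneg (hit n t ht).1.le _) (fun n => ?_) l3
        rw [← div_eq_inv_mul, le_div_iff₀ hμ3, mul_comm]
        exact (h3 _ (hit n t ht)).1
      have l4 := l2.rpow_const (p := (lam + 1) / (lam + κ)) (Or.inr (by positivity))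
      rw [Real.zero_rpow (by positivity)] at l4
      refine l4.congr (fun n => ?_)
      rw [← Real.rpow_mul (hit n t ht).1.le]
      congr 1
      have : lam + κ ≠ 0 := by positivity
      field_simp
    have hlim : Tendsto (fun n : ℕ => μ3 / (d2 * (lam + 1)) * (t ^ (lam + 1) - (S^[n] t) ^ (lam + 1))) atTop
        (𝓝 (μ3 / (d2 * (lam + 1)) * (t ^ (lam + 1) - 0))) :=
      (tendsto_const_nhds.sub hlim0).const_mul _
    rw [sub_zero] at hlim
    exact le_of_tendsto_of_tendsto' hlim (hsum t ht).hasSum.tendsto_sum_nat hpart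


open Real Set MeasureTheory Filter Topology

theorem label_exists {ζ m κ s c1 c2 C lam μ3 μ4 : ℝ} {c : ℝ × ℝ → ℝ} {h : ℝ → ℝ}
    (H : Coef ζ m κ s c1 c2 C c) (hc1 : 0 < c1) (hc2 : 0 < c2) (hC : 0 < C) (hm : 0 < m)
    (hζ : 0 < ζ) (hζ1 : ζ ≤ 1) (hκ : 1 ≤ κ) (hs : 0 < s) (hlam : 0 < lam)
    (hμ3 : 0 < μ3) (hμ4 : 0 < μ4)
    (h1 : ContinuousOn h (Ioo 0 ζ)) (h2 : MonotoneOn h (Ioo 0 ζ))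
    (h3 : ∀ t ∈ Ioo 0 ζ, μ3 * t ^ (lam + κ) ≤ h t ∧ h t ≤ μ4 * t ^ (lam + κ)) :
    ∃ T : ℝ × ℝ → ℝ, ∃ G : ℝ → ℝ,
      (∃ L : NNReal, LipschitzOnWith L T (univ ×ˢ Icc (-m) m)) ∧
      (∀ x t, t ∈ Icc (-m) m → x ∈ Ioo 0 ζ → T (x, t) ∈ Ioo 0 ζ) ∧
      (∀ x t, t ∈ Ioo (-m) m → x ∈ Ioo 0 ζ → DifferentiableAt ℝ T (x, t) →
        pdx T (x, t) = c (x, t) * pdy T (x, t)) ∧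
      ContinuousOn G (Ioo 0 ζ) ∧
      (∀ x t, t ∈ Icc (-m) m → x ∈ Ioo 0 ζ →
        μ3 / (2 * m / c1 * (lam + 1)) * Real.exp (-(2 * m * (1 / c1))) ^ (lam + 1) * x ^ (lam + 1)
          ≤ G (T (x, t)) ∧
        G (T (x, t)) ≤ μ4 * (1 + 1 / (2 * m / c2)) * x ^ (lam + 1)) ∧
      (∀ x t, t ∈ Icc 0 m → x ∈ Ioo 0 ζ → G (T (x, -t)) ≤ G (T (x, t)) ∧
        G (T (x, t)) ≤ G (T (x, -t)) + μ4 * x ^ (lam + κ)) ∧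
      (∀ x ∈ Ioo 0 ζ, G (T (x, m)) - G (T (x, -m)) = h x) := by
  obtain ⟨K, hK⟩ := slow_lip H hc1 hC hζ hζ1 hκ hs
  have hsl : ∀ x y, 0 ≤ x → slow ζ c (x, y) ≤ 1 / c1 * min x ζ := fun x y hx => slow_le H hc1 hζ hζ1 hκ y hx
  have hs0 : ∀ x y, x ≤ 0 → slow ζ c (x, y) = 0 := fun x y hx => by unfold slow; rw [if_pos hx]
  obtain ⟨T, hTL, hTm, hTx, hTt, hTb, hTS, hTd⟩ := flow_exists (ζ := ζ) (C1 := 1 / c1) (A := 1 / c1) hK hm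
    (fun p => by
      rw [abs_of_nonneg (slow_nonneg H hc1 hζ p)]
      obtain ⟨x, y⟩ := p
      rcases le_or_gt x 0 with hx | hx
      · rw [hs0 x y hx]; positivity
      · refine (hsl x y hx.le).trans ?_
        have : min x ζ ≤ 1 := (min_le_right _ _).trans hζ1
        have h5 : 0 < 1 / c1 := by positivity
        nlinarith) (slow_nonneg H hc1 hζ) (fun t => hs0 0 t le_rfl)
    (fun x t hx hxζ => (hsl x t hx).trans (by gcongr; exact min_le_left _ _))
  have hmm : -m ∈ Icc (-m) m := ⟨le_rfl, by linarith⟩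
  have hTI : ∀ x t, t ∈ Icc (-m) m → x ∈ Ioo 0 ζ → T (x, t) ∈ Ioo 0 ζ := by
    intro x t ht hx
    obtain ⟨b1, b2⟩ := hTb x t hx.1 hx.2.le ht
    have : 0 < Real.exp (-(2 * m * (1 / c1))) * x := mul_pos (Real.exp_pos _) hx.1
    exact ⟨by linarith, by linarith [hx.2]⟩
  have hTcont : ContinuousOn (fun x => T (x, -m)) (Ioo 0 ζ) := by
    obtain ⟨L, hL⟩ := hTL
    exact hL.continuousOn.comp (by fun_prop) (fun x _ => ⟨trivial, hmm⟩)
  obtain ⟨G, G1, G2, G3, G4⟩ := G_exists (S := fun x => T (x, -m)) (d1 := 2 * m / c2) (d2 := 2 * m / c1)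
    hζ1 hκ hlam (by positivity) (by positivity) hμ3 hμ4
    (fun t ht => ⟨(hTI t _ hmm ht).1, (hTb t _ ht.1 ht.2.le hmm).2⟩) hTcont
    (fun x _ x' _ hxx => hTx x x' _ hmm hxx)
    (fun x hx => by
      obtain ⟨v, hv, t, e⟩ := hTS x
      have hS := hTI x _ hmm hx
      have hv0 : 0 < v := by linarith [hv.1, hS.1]
      have hvζ : v ≤ ζ := by linarith [hv.2, hx.2]
      rw [slow_eq t hv0 hvζ] at e
      have i1 := H.lo v t hv0 hvζ
      have i2 := H.hi v t hv0 hvζ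
      have pc := H.pos hc1 t hv0 hvζ
      rw [Real.rpow_neg hv0.le] at i1 i2
      have pv : 0 < v ^ κ := Real.rpow_pos_of_pos hv0 _
      have j1 : v ^ κ / c2 ≤ (c (v, t))⁻¹ := by
        rw [div_le_iff₀ hc2, inv_mul_eq_div, le_div_iff₀ pc]
        calc v ^ κ * c (v, t) ≤ v ^ κ * (c2 * (v ^ κ)⁻¹) := by gcongr
          _ = c2 := by field_simp
      have j2 : (c (v, t))⁻¹ ≤ v ^ κ / c1 := by
        rw [le_div_iff₀ hc1, inv_mul_eq_div, div_le_iff₀ pc]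
        calc c1 = v ^ κ * (c1 * (v ^ κ)⁻¹) := by field_simp
          _ ≤ _ := by gcongr
      have k1 : (T (x, -m)) ^ κ ≤ v ^ κ := Real.rpow_le_rpow hS.1.le hv.1 (by linarith)
      have k2 : v ^ κ ≤ x ^ κ := Real.rpow_le_rpow hv0.le hv.2 (by linarith)
      show 2 * m / c2 * (T (x, -m)) ^ κ ≤ x - T (x, -m) ∧ x - T (x, -m) ≤ 2 * m / c1 * x ^ κ
      rw [e]
      constructor
      · calc 2 * m / c2 * (T (x, -m)) ^ κ ≤ 2 * m / c2 * v ^ κ := by gcongr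
          _ = 2 * m * (v ^ κ / c2) := by ring
          _ ≤ _ := by gcongr
      · calc 2 * m * (c (v, t))⁻¹ ≤ 2 * m * (v ^ κ / c1) := by gcongr
          _ = 2 * m / c1 * v ^ κ := by ring
          _ ≤ _ := by gcongr) h1 h2 h3
  refine ⟨T, G, hTL, hTI, ?_, G1, ?_, ?_, ?_⟩
  · intro x t ht hx hd
    rw [hTd x t ht hd, slow_eq t hx.1 hx.2.le, ← mul_assoc, mul_inv_cancel₀ (H.pos hc1 t hx.1 hx.2.le).ne', one_mul]
  · intro x t ht hx
    obtain ⟨b1, b2⟩ := hTb x t hx.1 hx.2.le ht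
    obtain ⟨g1, g2⟩ := G4 _ (hTI x t ht hx)
    have h0 := hx.1
    have h0' := (hTI x t ht hx).1
    constructor
    · refine le_trans ?_ g1
      rw [mul_assoc, ← Real.mul_rpow (Real.exp_pos _).le h0.le]
      have : (rexp (-(2 * m * (1 / c1))) * x) ^ (lam + 1) ≤ T (x, t) ^ (lam + 1) :=
        Real.rpow_le_rpow (by positivity) b1 (by linarith)
      gcongr
    · refine g2.trans ?_
      have : T (x, t) ^ (lam + 1) ≤ x ^ (lam + 1) :=
        Real.rpow_le_rpow h0'.le b2 (by linarith)
      gcongr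
  · intro x t ht hx
    have m1 : -t ∈ Icc (-m) m := ⟨by linarith [ht.2], by linarith [ht.1]⟩
    have m2 : t ∈ Icc (-m) m := ⟨by linarith [ht.1], by linarith [ht.2]⟩
    have i1 := hTI x _ m1 hx
    have i2 := hTI x _ m2 hx
    have b2 := (hTb x t hx.1 hx.2.le m2).2
    refine ⟨G2 i1 i2 (hTt x _ _ m1.1 (by linarith [ht.1]) m2.2), ?_⟩
    rw [G3 _ i2]
    have e1 : T (T (x, t), -m) ≤ T (x, -t) :=
      (hTx _ _ _ hmm b2).trans (hTt x _ _ le_rfl m1.1 m1.2)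
    have e2 := G2 (hTI _ _ hmm i2) i1 e1
    have e3 := (h3 _ i2).2
    have e4 : μ4 * T (x, t) ^ (lam + κ) ≤ μ4 * x ^ (lam + κ) :=
      mul_le_mul_of_nonneg_left (Real.rpow_le_rpow i2.1.le b2 (by linarith)) hμ4.le
    show h (T (x, t)) + G (T (T (x, t), -m)) ≤ _
    linarith
  · intro x hx
    rw [hTm, G3 x hx]; ring


open Real Set MeasureTheory Filter Topology

lemma locLip_mul {f g : ℝ × ℝ → ℝ} (hf : LocallyLipschitz f) (hg : LocallyLipschitz g) :
    LocallyLipschitz (fun p => f p * g p) := by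
  have h : LocallyLipschitz (fun q : ℝ × ℝ => q.1 * q.2) :=
    ContDiff.locallyLipschitz (𝕂 := ℝ) (by fun_prop)
  exact h.comp (hf.prodMk hg)

lemma locLip_rect {f : ℝ × ℝ → ℝ} (hf : LocallyLipschitz f) (a b c d : ℝ) :
    ∃ L, LipschitzOnWith L f (Icc a b ×ˢ Icc c d) :=
  LocallyLipschitzOn.exists_lipschitzOnWith_of_compact (isCompact_Icc.prod isCompact_Icc)
    hf.locallyLipschitzOn

lemma hasDerivAt_pdx {f : ℝ × ℝ → ℝ} {p : ℝ × ℝ} (h : DifferentiableAt ℝ f p) :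
    HasDerivAt (fun x => f (x, p.2)) (pdx f p) p.1 := by
  have h1 : DifferentiableAt ℝ (fun x : ℝ => (x, p.2)) p.1 := by fun_prop
  exact (DifferentiableAt.comp (g := f) (f := fun x : ℝ => (x, p.2)) p.1 h h1).hasDerivAt

lemma hasDerivAt_pdy {f : ℝ × ℝ → ℝ} {p : ℝ × ℝ} (h : DifferentiableAt ℝ f p) :
    HasDerivAt (fun y => f (p.1, y)) (pdy f p) p.2 := by
  have h1 : DifferentiableAt ℝ (fun y : ℝ => (p.1, y)) p.2 := by fun_prop
  exact (DifferentiableAt.comp (g := f) (f := fun y : ℝ => (p.1, y)) p.2 h h1).hasDerivAt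

lemma pdx_eq_fderiv {f : ℝ × ℝ → ℝ} {p : ℝ × ℝ} (h : DifferentiableAt ℝ f p) :
    pdx f p = fderiv ℝ f p (1, 0) := by
  have h1 : HasDerivAt (fun x : ℝ => (x, p.2)) ((1 : ℝ), (0 : ℝ)) p.1 :=
    (hasDerivAt_id p.1).prodMk (hasDerivAt_const _ _)
  have h2 := HasFDerivAt.comp_hasDerivAt (f := fun x : ℝ => (x, p.2)) p.1 (l := f) h.hasFDerivAt h1
  exact h2.deriv

lemma pdy_eq_fderiv {f : ℝ × ℝ → ℝ} {p : ℝ × ℝ} (h : DifferentiableAt ℝ f p) :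
    pdy f p = fderiv ℝ f p (0, 1) := by
  have h1 : HasDerivAt (fun y : ℝ => (p.1, y)) ((0 : ℝ), (1 : ℝ)) p.2 :=
    (hasDerivAt_const _ _).prodMk (hasDerivAt_id p.2)
  have h2 := HasFDerivAt.comp_hasDerivAt (f := fun y : ℝ => (p.1, y)) p.2 (l := f) h.hasFDerivAt h1
  exact h2.deriv

lemma continuous_pdx {ξ : ℝ × ℝ → ℝ} (h : ContDiff ℝ 1 ξ) : Continuous (pdx ξ) := by
  have e : pdx ξ = fun p => fderiv ℝ ξ p (1, 0) :=
    funext fun p => pdx_eq_fderiv (h.differentiable one_ne_zero p)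
  rw [e]
  exact (h.continuous_fderiv one_ne_zero).clm_apply continuous_const

lemma continuous_pdy {ξ : ℝ × ℝ → ℝ} (h : ContDiff ℝ 1 ξ) : Continuous (pdy ξ) := by
  have e : pdy ξ = fun p => fderiv ℝ ξ p (0, 1) :=
    funext fun p => pdy_eq_fderiv (h.differentiable one_ne_zero p)
  rw [e]
  exact (h.continuous_fderiv one_ne_zero).clm_apply continuous_const

lemma cont_bdd_rect {f : ℝ × ℝ → ℝ} (hf : Continuous f) (a b c d : ℝ) :
    ∃ M, 0 ≤ M ∧ ∀ p ∈ Icc a b ×ˢ Icc c d, |f p| ≤ M := by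
  obtain ⟨M, hM⟩ := ((isCompact_Icc (a := a) (b := b)).prod (isCompact_Icc (a := c) (b := d))).exists_bound_of_continuousOn
    hf.continuousOn
  exact ⟨max M 0, le_max_right _ _, fun p hp => (hM p hp).trans (le_max_left _ _)⟩

lemma integrableOn_rect_of_bdd' {f : ℝ × ℝ → ℝ} {a b c d M : ℝ}
    (hf : AEStronglyMeasurable f (volume.restrict (Ioo a b ×ˢ Ioo c d)))
    (hb : ∀ p ∈ Ioo a b ×ˢ Ioo c d, |f p| ≤ M) : IntegrableOn f (Ioo a b ×ˢ Ioo c d) := by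
  refine ⟨hf, ?_⟩
  haveI : IsFiniteMeasure (volume.restrict (Ioo a b ×ˢ Ioo c d)) :=
    ⟨by rw [Measure.restrict_apply_univ]; exact volume_rect_lt_top a b c d⟩
  apply HasFiniteIntegral.of_bounded (C := M)
  exact (ae_restrict_iff' (measurableSet_Ioo.prod measurableSet_Ioo)).2 (Eventually.of_forall hb)

lemma cont_intervalIntegrable {f : ℝ → ℝ} (hf : Continuous f) (a b : ℝ) :
    IntervalIntegrable f volume a b := hf.intervalIntegrable a b

/-- weak transport identity on a rectangle, smooth profile -/
theorem weak_rect_smooth {T c ξ : ℝ × ℝ → ℝ} {f : ℝ → ℝ} {LT Lc : NNReal} {σ a b m : ℝ}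
    (hT : LipschitzWith LT T) (hc : LipschitzWith Lc c) (hξ : ContDiff ℝ 1 ξ) (hf : ContDiff ℝ 1 f)
    (hab : a ≤ b) (hm : 0 ≤ m)
    (hTd : ∀ p ∈ Ioo a b ×ˢ Ioo 0 m, DifferentiableAt ℝ T p → pdx T p = σ * c p * pdy T p) :
    ∫ p in Ioo a b ×ˢ Ioo 0 m, f (T p) * (pdx ξ p - σ * c p * pdy ξ p - σ * pdy c p * ξ p)
      = (∫ y in (0 : ℝ)..m, f (T (b, y)) * ξ (b, y)) - (∫ y in (0 : ℝ)..m, f (T (a, y)) * ξ (a, y))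
        + ((∫ x in a..b, f (T (x, m)) * (-(σ * c (x, m) * ξ (x, m))))
        - (∫ x in a..b, f (T (x, 0)) * (-(σ * c (x, 0) * ξ (x, 0))))) := by
  have lf : LocallyLipschitz (fun p => f (T p)) := hf.locallyLipschitz.comp hT.locallyLipschitz
  have lξ : LocallyLipschitz ξ := hξ.locallyLipschitz
  have lk : LocallyLipschitz (fun p => -(σ * c p * ξ p)) := by
    have := locLip_mul (locLip_mul (LocallyLipschitz.const (-σ)) hc.locallyLipschitz) lξ
    have e : (fun p => -(σ * c p * ξ p)) = fun p => -σ * c p * ξ p := by funext p; ring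
    rw [e]; exact this
  have lP := locLip_mul lf lξ
  have lR := locLip_mul lf lk
  obtain ⟨L1, h1⟩ := locLip_rect lP a b 0 m
  obtain ⟨L2, h2⟩ := locLip_rect lR a b 0 m
  obtain ⟨-, -, h3⟩ := div_rect h1 h2 hab hm
  have cf := hf.continuous
  have cT := hT.continuous
  have cξ := hξ.continuous
  have cc := hc.continuous
  rw [intervalIntegral.integral_sub, intervalIntegral.integral_sub] at h3
  · rw [← h3]
    apply setIntegral_congr_ae (measurableSet_Ioo.prod measurableSet_Ioo)
    filter_upwards [hT.ae_differentiableAt (μ := volume), hc.ae_differentiableAt (μ := volume)] with p d1 d2 hp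
    have e0 := hTd p hp d1
    have d3 : DifferentiableAt ℝ ξ p := hξ.differentiable one_ne_zero p
    have df : HasDerivAt f (deriv f (T p)) (T p) := (hf.differentiable one_ne_zero _).hasDerivAt
    have e1 := ((df.comp p.1 (hasDerivAt_pdx d1)).mul (hasDerivAt_pdx d3)).deriv
    have e2 := ((df.comp p.2 (hasDerivAt_pdy d1)).mul (((hasDerivAt_pdy d2).const_mul σ).mul (hasDerivAt_pdy d3)).neg).deriv
    have e1' : pdx (fun p => f (T p) * ξ p) p = _ := e1
    have e2' : pdy (fun p => f (T p) * -(σ * c p * ξ p)) p = _ := e2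
    rw [e1', e2', e0]
    simp only [Function.comp, Prod.mk.eta, Pi.mul_apply, Pi.neg_apply]
    ring
  all_goals exact Continuous.intervalIntegrable (by fun_prop) _ _

lemma approx_tendsto {X : Type*} [MeasurableSpace X] {ν : Measure X} {τ k : X → ℝ} {G : ℝ → ℝ} {p : ℕ → ℝ → ℝ}
    {α β : ℝ} (hk : Integrable k ν) (hG : ∀ᵐ x ∂ν, τ x ∈ Icc α β)
    (hp : ∀ n : ℕ, ∀ t ∈ Icc α β, |p n t - G t| < 1 / ((n : ℝ) + 1)) 
    (hm : ∀ n, AEStronglyMeasurable (fun x => p n (τ x)) ν) 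
    {M : ℝ} (hM : ∀ t ∈ Icc α β, |G t| ≤ M) :
    Tendsto (fun n => ∫ x, p n (τ x) * k x ∂ν) atTop (𝓝 (∫ x, G (τ x) * k x ∂ν)) := by
  apply tendsto_integral_of_dominated_convergence (fun x => (M + 1) * ‖k x‖)
  · exact fun n => (hm n).mul hk.aestronglyMeasurable
  · exact hk.norm.const_mul _
  · intro n
    filter_upwards [hG] with x hx
    rw [norm_mul]
    gcongr
    have h1 := hp n _ hx
    have h2 := hM _ hx
    have h3 : 1 / ((n : ℝ) + 1) ≤ 1 := by
      rw [div_le_one (by positivity)]; linarith [(Nat.cast_nonneg n : (0 : ℝ) ≤ n)]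
    rw [Real.norm_eq_abs]
    have := abs_add_le (p n (τ x) - G (τ x)) (G (τ x))
    rw [sub_add_cancel] at this
    linarith
  · filter_upwards [hG] with x hx
    apply Tendsto.mul_const
    rw [tendsto_iff_norm_sub_tendsto_zero]
    exact squeeze_zero (fun n => norm_nonneg _) (fun n => (hp n _ hx).le) tendsto_one_div_add_atTop_nhds_zero_nat

theorem weak_rect {T c ξ : ℝ × ℝ → ℝ} {G : ℝ → ℝ} {LT Lc : NNReal} {σ a b m α β : ℝ}
    (hT : LipschitzWith LT T) (hc : LipschitzWith Lc c) (hξ : ContDiff ℝ 1 ξ)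
    (hG : ContinuousOn G (Icc α β)) (hTI : ∀ p ∈ Icc a b ×ˢ Icc 0 m, T p ∈ Icc α β)
    (hab : a ≤ b) (hm : 0 ≤ m)
    (hTd : ∀ p ∈ Ioo a b ×ˢ Ioo 0 m, DifferentiableAt ℝ T p → pdx T p = σ * c p * pdy T p) :
    ∫ p in Ioo a b ×ˢ Ioo 0 m, G (T p) * (pdx ξ p - σ * c p * pdy ξ p - σ * pdy c p * ξ p)
      = (∫ y in (0 : ℝ)..m, G (T (b, y)) * ξ (b, y)) - (∫ y in (0 : ℝ)..m, G (T (a, y)) * ξ (a, y))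
        + ((∫ x in a..b, G (T (x, m)) * (-(σ * c (x, m) * ξ (x, m))))
        - (∫ x in a..b, G (T (x, 0)) * (-(σ * c (x, 0) * ξ (x, 0))))) := by
  have hp : ∀ n : ℕ, ∃ p : Polynomial ℝ, ∀ t ∈ Icc α β, |p.eval t - G t| < 1 / ((n : ℝ) + 1) := fun n =>
    exists_polynomial_near_of_continuousOn α β G hG _ (by positivity)
  choose P hP using hp
  obtain ⟨M, hM⟩ := isCompact_Icc.exists_bound_of_continuousOn hG
  have cξ := hξ.continuous
  have cc := hc.continuous
  have cT := hT.continuous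
  have id := fun n => weak_rect_smooth (f := fun t => (P n).eval t) hT hc hξ (by have := Polynomial.contDiff_aeval (𝕜 := ℝ) (P n) 1; simpa using this) hab hm hTd
  have cP : ∀ n, Continuous fun t => (P n).eval t := fun n => (P n).continuous
  have t0 := approx_tendsto (ν := volume.restrict (Ioo a b ×ˢ Ioo 0 m)) (τ := T) (G := G) (p := fun n t => (P n).eval t)
    (k := fun p => pdx ξ p - σ * c p * pdy ξ p - σ * pdy c p * ξ p) (α := α) (β := β) (M := M) ?_ ?_ hP
    (fun n => ((cP n).comp cT).aestronglyMeasurable) hM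
  have aux : ∀ (k : ℝ → ℝ) (g : ℝ → ℝ × ℝ) (u v : ℝ), u ≤ v → Continuous k → Continuous g →
      (∀ x ∈ Icc u v, g x ∈ Icc a b ×ˢ Icc 0 m) →
      Tendsto (fun n => ∫ x in u..v, (P n).eval (T (g x)) * k x) atTop
        (𝓝 (∫ x in u..v, G (T (g x)) * k x)) := by
    intro k g u v huv hk hg hI
    simp only [intervalIntegral.integral_of_le huv]
    refine approx_tendsto (τ := fun x => T (g x)) (p := fun n t => (P n).eval t)
      (α := α) (β := β) (M := M) (hk.integrableOn_Ioc) ?_ hP (fun n => Continuous.aestronglyMeasurable (by fun_prop)) hM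
    exact (ae_restrict_iff' measurableSet_Ioc).2 (Eventually.of_forall fun x hx => hTI _ (hI x (Ioc_subset_Icc_self hx)))
  · have t1 := aux (fun y => ξ (b, y)) (fun y => (b, y)) 0 m hm (by fun_prop) (by fun_prop)
      (fun y hy => ⟨⟨hab, le_rfl⟩, hy⟩)
    have t2 := aux (fun y => ξ (a, y)) (fun y => (a, y)) 0 m hm (by fun_prop) (by fun_prop)
      (fun y hy => ⟨⟨le_rfl, hab⟩, hy⟩)
    have t3 := aux (fun x => -(σ * c (x, m) * ξ (x, m))) (fun x => (x, m)) a b hab (by fun_prop) (by fun_prop)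
      (fun y hy => ⟨hy, hm, le_rfl⟩)
    have t4 := aux (fun x => -(σ * c (x, 0) * ξ (x, 0))) (fun x => (x, 0)) a b hab (by fun_prop) (by fun_prop)
      (fun y hy => ⟨hy, le_rfl, hm⟩)
    have t5 := (t1.sub t2).add (t3.sub t4)
    refine tendsto_nhds_unique t0 (t5.congr fun n => ?_)
    exact (id n).symm
  · obtain ⟨M1, n1, b1⟩ := cont_bdd_rect (continuous_pdx hξ) a b 0 m
    obtain ⟨M2, n2, b2⟩ := cont_bdd_rect (f := fun p => σ * c p * pdy ξ p) ((continuous_const.mul cc).mul (continuous_pdy hξ)) a b 0 m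
    obtain ⟨M3, n3, b3⟩ := cont_bdd_rect cξ a b 0 m
    refine integrableOn_rect_of_bdd' (M := M1 + M2 + |σ| * Lc * M3) ?_ ?_
    · apply Measurable.aestronglyMeasurable
      exact ((continuous_pdx hξ).measurable.sub ((continuous_const.mul cc).mul (continuous_pdy hξ)).measurable).sub
        ((measurable_const.mul (measurable_pdy cc)).mul cξ.measurable)
    · intro p hp
      have hp' : p ∈ Icc a b ×ˢ Icc 0 m := ⟨Ioo_subset_Icc_self hp.1, Ioo_subset_Icc_self hp.2⟩
      refine (abs_sub _ _).trans (add_le_add ((abs_sub _ _).trans (add_le_add (b1 p hp') (b2 p hp'))) ?_)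
      rw [abs_mul, abs_mul]
      gcongr
      · exact abs_pdy_le hc p
      · exact b3 p hp'
  · exact (ae_restrict_iff' (measurableSet_Ioo.prod measurableSet_Ioo)).2
      (Eventually.of_forall fun p hp => hTI _ ⟨Ioo_subset_Icc_self hp.1, Ioo_subset_Icc_self hp.2⟩)


open Real Set MeasureTheory Filter Topology

section
variable {ζ m κ s c1 c2 C : ℝ} {c : ℝ × ℝ → ℝ}

lemma Coef.continuousOn (H : Coef ζ m κ s c1 c2 C c) (hc1 : 0 < c1) (hC : 0 < C) (hζ : 0 < ζ) (hζ1 : ζ ≤ 1)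
    (hκ : 1 ≤ κ) (hs : 0 < s) : ContinuousOn c (Ioc 0 ζ ×ˢ univ) := by
  obtain ⟨K, hK⟩ := slow_lip H hc1 hC hζ hζ1 hκ hs
  have : ContinuousOn (fun p => (slow ζ c p)⁻¹) (Ioc 0 ζ ×ˢ univ) := by
    refine hK.continuous.continuousOn.inv₀ fun p hp => ?_
    obtain ⟨x, y⟩ := p
    rw [slow_eq y hp.1.1 hp.1.2]
    exact (inv_pos.2 (H.pos hc1 y hp.1.1 hp.1.2)).ne'
  refine this.congr fun p hp => ?_
  obtain ⟨x, y⟩ := p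
  simp only [slow_eq y hp.1.1 hp.1.2, inv_inv]

lemma Coef.pdy_abs_le (H : Coef ζ m κ s c1 c2 C c) (hC : 0 < C) {p : ℝ × ℝ} (hp : 0 < p.1) (hp' : p.1 ≤ ζ) :
    |pdy c p| ≤ C * p.1 ^ (s - 1) := by
  have h0 : 0 ≤ C * p.1 ^ (s - 1) := by positivity
  have : LipschitzWith (Real.toNNReal (C * p.1 ^ (s - 1))) (fun y => c (p.1, y)) := by
    refine LipschitzWith.of_dist_le_mul fun y y' => ?_
    rw [Real.dist_eq, Real.dist_eq, Real.coe_toNNReal _ h0]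
    exact H.lipy p.1 y y' hp hp'
  have h2 := norm_deriv_le_of_lipschitz (x₀ := p.2) this
  rw [Real.coe_toNNReal _ h0] at h2
  exact h2

lemma Coef.pdy_slow (H : Coef ζ m κ s c1 c2 C c) (hc1 : 0 < c1) {p : ℝ × ℝ} (hp : 0 < p.1) (hp' : p.1 ≤ ζ) :
    pdy c p = -pdy (slow ζ c) p / (slow ζ c p) ^ 2 := by
  obtain ⟨x, y⟩ := p
  simp only at hp hp'
  have e : (fun y => slow ζ c (x, y)) = fun y => (c (x, y))⁻¹ := funext fun y => slow_eq y hp hp'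
  have e2 : (fun y => c (x, y)) = fun y => (slow ζ c (x, y))⁻¹ := by funext y; rw [slow_eq y hp hp', inv_inv]
  have h0 : slow ζ c (x, y) ≠ 0 := by
    rw [slow_eq y hp hp']; exact (inv_pos.2 (H.pos hc1 y hp hp')).ne'
  show deriv (fun y => c (x, y)) y = -deriv (fun y => slow ζ c (x, y)) y / (slow ζ c (x, y)) ^ 2
  by_cases hd : DifferentiableAt ℝ (fun y => slow ζ c (x, y)) y
  · rw [e2]
    exact (hd.hasDerivAt.fun_inv h0).deriv
  · have hd2 : ¬ DifferentiableAt ℝ (fun y => c (x, y)) y := by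
      intro h
      apply hd
      rw [e]
      exact h.fun_inv (H.pos hc1 y hp hp').ne'
    rw [deriv_zero_of_not_differentiableAt hd, deriv_zero_of_not_differentiableAt hd2]; simp

lemma Coef.pdy_meas (H : Coef ζ m κ s c1 c2 C c) (hc1 : 0 < c1) (hC : 0 < C) (hζ : 0 < ζ) (hζ1 : ζ ≤ 1)
    (hκ : 1 ≤ κ) (hs : 0 < s) {S : Set (ℝ × ℝ)} (hS : MeasurableSet S) (hSub : S ⊆ Ioc 0 ζ ×ˢ univ) :
    AEStronglyMeasurable (pdy c) (volume.restrict S) := by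
  obtain ⟨K, hK⟩ := slow_lip H hc1 hC hζ hζ1 hκ hs
  have : Measurable (fun p => -pdy (slow ζ c) p / (slow ζ c p) ^ 2) :=
    (measurable_pdy hK.continuous).neg.div (hK.continuous.measurable.pow_const 2)
  refine this.aestronglyMeasurable.congr ?_
  refine (ae_restrict_iff' hS).2 (Eventually.of_forall fun p hp => ?_)
  exact (H.pdy_slow hc1 (hSub hp).1.1 (hSub hp).1.2).symm

end

lemma pdx_eventuallyEq {f g : ℝ × ℝ → ℝ} {p : ℝ × ℝ} (h : f =ᶠ[𝓝 p] g) : pdx f p = pdx g p := by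
  apply Filter.EventuallyEq.deriv_eq
  have : Tendsto (fun x : ℝ => (x, p.2)) (𝓝 p.1) (𝓝 p) := by
    have : Continuous (fun x : ℝ => (x, p.2)) := by fun_prop
    exact this.tendsto p.1
  exact this.eventually h

lemma pdy_eventuallyEq {f g : ℝ × ℝ → ℝ} {p : ℝ × ℝ} (h : f =ᶠ[𝓝 p] g) : pdy f p = pdy g p := by
  apply Filter.EventuallyEq.deriv_eq
  have : Tendsto (fun y : ℝ => (p.1, y)) (𝓝 p.2) (𝓝 p) := by
    have : Continuous (fun y : ℝ => (p.1, y)) := by fun_prop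
    exact this.tendsto p.2
  exact this.eventually h

/-- both signs of the transport identity on a compact rectangle -/
theorem weak_rect_T {ζ m κ s c1 c2 C : ℝ} {c T ξ : ℝ × ℝ → ℝ} {G : ℝ → ℝ}
    (H : Coef ζ m κ s c1 c2 C c) (hc1 : 0 < c1) (hc2 : 0 < c2) (hC : 0 < C) (hm : 0 < m)
    (hζ1 : ζ ≤ 1) (hκ : 1 ≤ κ)
    (hTL : ∃ L : NNReal, LipschitzOnWith L T (univ ×ˢ Icc (-m) m))
    (hTI : ∀ x t, t ∈ Icc (-m) m → x ∈ Ioo 0 ζ → T (x, t) ∈ Ioo 0 ζ)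
    (hTd : ∀ x t, t ∈ Ioo (-m) m → x ∈ Ioo 0 ζ → DifferentiableAt ℝ T (x, t) →
        pdx T (x, t) = c (x, t) * pdy T (x, t))
    (hG : ContinuousOn G (Ioo 0 ζ)) (hξ : ContDiff ℝ 1 ξ) {a b : ℝ} (ha : 0 < a) (hab : a ≤ b) (hb : b < ζ)
    {σ : ℝ} (hσ : σ = 1 ∨ σ = -1) :
    ∫ p in Ioo a b ×ˢ Ioo 0 m, G (T (p.1, σ * p.2)) * (pdx ξ p - σ * c p * pdy ξ p - σ * pdy c p * ξ p)
      = (∫ y in (0 : ℝ)..m, G (T (b, σ * y)) * ξ (b, y)) - (∫ y in (0 : ℝ)..m, G (T (a, σ * y)) * ξ (a, y))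
        + ((∫ x in a..b, G (T (x, σ * m)) * (-(σ * c (x, m) * ξ (x, m))))
        - (∫ x in a..b, G (T (x, σ * 0)) * (-(σ * c (x, 0) * ξ (x, 0))))) := by
  obtain ⟨L, hL⟩ := hTL
  obtain ⟨T', hT', eT⟩ := hL.extend_real
  obtain ⟨Lc, hLc⟩ := H.lip hc1 hc2 hC hκ hζ1 ha
  obtain ⟨c', hc', ec⟩ := hLc.extend_real
  have hσm : ∀ y ∈ Icc 0 m, σ * y ∈ Icc (-m) m := by
    intro y hy
    rcases hσ with h | h <;> subst h <;> constructor <;> linarith [hy.1, hy.2]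
  have hσ2 : σ * σ = 1 := by rcases hσ with h | h <;> subst h <;> norm_num
  have hσ0 : σ ≠ 0 := by rcases hσ with h | h <;> subst h <;> norm_num
  have hσi : ∀ y ∈ Ioo 0 m, σ * y ∈ Ioo (-m) m := by
    intro y hy
    rcases hσ with h | h <;> subst h <;> constructor <;> linarith [hy.1, hy.2]
  have heven : ∀ x y, c (x, σ * y) = c (x, y) := by
    intro x y
    rcases hσ with h | h <;> subst h
    · rw [one_mul]
    · rw [neg_one_mul, H.even]
  set R : ℝ × ℝ → ℝ × ℝ := fun p => (p.1, σ * p.2) with hR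
  have hRd : Differentiable ℝ R := by rw [hR]; fun_prop
  have hRL : LipschitzWith 1 R := by
    refine LipschitzWith.of_dist_le_mul fun p q => ?_
    rw [NNReal.coe_one, one_mul, Prod.dist_eq, Prod.dist_eq]
    have : |σ| = 1 := by rcases hσ with h | h <;> subst h <;> norm_num
    apply max_le_max le_rfl
    simp only [hR]
    rw [Real.dist_eq, Real.dist_eq, ← mul_sub, abs_mul, this, one_mul]
  have hRR : ∀ p, R (R p) = p := by
    intro p; simp only [hR]; rw [← mul_assoc, hσ2, one_mul]
  -- compact range
  have hK : IsCompact (Icc a b ×ˢ Icc (-m) m) := isCompact_Icc.prod isCompact_Icc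
  have hKn : (Icc a b ×ˢ Icc (-m) m).Nonempty := ⟨(a, 0), ⟨le_rfl, hab⟩, by linarith, hm.le⟩
  obtain ⟨p0, hp0, hmin⟩ := hK.exists_isMinOn hKn hT'.continuous.continuousOn
  obtain ⟨p1, hp1, hmax⟩ := hK.exists_isMaxOn hKn hT'.continuous.continuousOn
  have hval : ∀ p ∈ Icc a b ×ˢ Icc (-m) m, T' p ∈ Ioo 0 ζ := by
    intro p hp
    rw [← eT ⟨trivial, hp.2⟩]
    exact hTI p.1 p.2 hp.2 ⟨ha.trans_le hp.1.1, hp.1.2.trans_lt hb⟩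
  have hcomp : LipschitzWith L (fun p => T' (R p)) := by
    have := hT'.comp hRL
    rw [mul_one] at this; exact this
  have key := weak_rect (T := fun p => T' (R p)) (c := c') (ξ := ξ) (G := G) (σ := σ) (a := a) (b := b) (m := m)
    (α := T' p0) (β := T' p1) hcomp hc' hξ
    (hG.mono fun t ht => ⟨(hval _ hp0).1.trans_le ht.1, ht.2.trans_lt (hval _ hp1).2⟩)
    (fun p hp => ⟨hmin ⟨hp.1, hσm _ hp.2⟩, hmax ⟨hp.1, hσm _ hp.2⟩⟩) hab hm.le ?_
  · have ecc : ∀ x ∈ Icc a b, ∀ y, c' (x, y) = c (x, y) := fun x hx y =>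
      (ec ⟨⟨hx.1, hx.2.trans hb.le⟩, trivial⟩).symm
    have eTT : ∀ x, ∀ y ∈ Icc 0 m, T' (R (x, y)) = T (x, σ * y) := fun x y hy =>
      (eT ⟨trivial, hσm y hy⟩).symm
    have m0 : (0 : ℝ) ∈ Icc 0 m := ⟨le_rfl, hm.le⟩
    have mm : m ∈ Icc 0 m := ⟨hm.le, le_rfl⟩
    have i1 : ∀ x, ∫ y in (0 : ℝ)..m, G (T' (R (x, y))) * ξ (x, y) = ∫ y in (0 : ℝ)..m, G (T (x, σ * y)) * ξ (x, y) := by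
      intro x
      apply intervalIntegral.integral_congr
      intro y hy
      rw [uIcc_of_le hm.le] at hy
      simp only [eTT x y hy]
    have i2 : ∀ y ∈ Icc 0 m, ∫ x in a..b, G (T' (R (x, y))) * (-(σ * c' (x, y) * ξ (x, y)))
        = ∫ x in a..b, G (T (x, σ * y)) * (-(σ * c (x, y) * ξ (x, y))) := by
      intro y hy
      apply intervalIntegral.integral_congr
      intro x hx
      rw [uIcc_of_le hab] at hx
      simp only [eTT x y hy, ecc x hx y]
    rw [i1, i1, i2 m mm, i2 0 m0] at key
    rw [← key]
    apply setIntegral_congr_fun (measurableSet_Ioo.prod measurableSet_Ioo)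
    intro p hp
    have e1 : pdy c' p = pdy c p := pdy_congr (a := a) (b := b) (c := 0) (d := m)
      (fun q hq => ecc q.1 hq.1 q.2) hp
    have e2 : c' p = c p := ecc p.1 (Ioo_subset_Icc_self hp.1) p.2
    have e3 : T' (R p) = T (p.1, σ * p.2) := eTT p.1 p.2 (Ioo_subset_Icc_self hp.2)
    simp only [e1, e2, e3]
  · intro p hp hd
    have hq2 : (R p).2 ∈ Ioo (-m) m := hσi p.2 hp.2
    have hq1 : (R p).1 ∈ Ioo 0 ζ := ⟨ha.trans hp.1.1, hp.1.2.trans hb⟩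
    have ev : T' =ᶠ[𝓝 (R p)] T := by
      have : (univ : Set ℝ) ×ˢ Ioo (-m) m ∈ 𝓝 (R p) := (isOpen_univ.prod isOpen_Ioo).mem_nhds ⟨trivial, hq2⟩
      filter_upwards [this] with q hq
      exact (eT ⟨trivial, Ioo_subset_Icc_self hq.2⟩).symm
    have hd' : DifferentiableAt ℝ T' (R p) := by
      have h1 : DifferentiableAt ℝ (fun p => T' (R p)) (R (R p)) := by rw [hRR]; exact hd
      have h2 := DifferentiableAt.comp (R p) h1 (hRd (R p))
      have e : (fun p => T' (R p)) ∘ R = T' := by funext q; simp only [Function.comp, hRR]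
      rwa [e] at h2
    have hdT : DifferentiableAt ℝ T (R p) := ev.differentiableAt_iff.1 hd'
    have e0 := hTd (R p).1 (R p).2 hq2 hq1 hdT
    have ex : pdx (fun p => T' (R p)) p = pdx T' (R p) := rfl
    have ey : pdy (fun p => T' (R p)) p = σ * pdy T' (R p) := by
      have h1 : HasDerivAt (fun y => σ * y) σ p.2 := by simpa using (hasDerivAt_id p.2).const_mul σ
      have h2 := HasDerivAt.comp p.2 (h₂ := fun y => T' (p.1, y)) (hasDerivAt_pdy (p := R p) hd') h1
      have h3 : pdy (fun p => T' (R p)) p = pdy T' (R p) * σ := h2.deriv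
      rw [h3, mul_comm]
    rw [ex, ey, pdx_eventuallyEq ev, pdy_eventuallyEq ev]
    rw [Prod.mk.eta] at e0
    rw [e0]
    have e2 : c' p = c p := (ec ⟨⟨hp.1.1.le, hp.1.2.le.trans hb.le⟩, trivial⟩).symm
    have e3 : c (R p) = c p := heven p.1 p.2
    rw [e2, e3]
    linear_combination (-(c p) * pdy T (R p)) * hσ2


open Real Set MeasureTheory Filter Topology

def an (ζ : ℝ) (n : ℕ) : ℝ := ζ / ((n : ℝ) + 3)

lemma an_pos {ζ : ℝ} (hζ : 0 < ζ) (n : ℕ) : 0 < an ζ n := by unfold an; positivity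

lemma an_anti {ζ : ℝ} (hζ : 0 < ζ) {n k : ℕ} (h : n ≤ k) : an ζ k ≤ an ζ n := by
  unfold an
  have : (n : ℝ) ≤ k := by exact_mod_cast h
  gcongr

lemma an_tendsto (ζ : ℝ) : Tendsto (an ζ) atTop (𝓝 0) := by
  have h := (tendsto_const_div_atTop_nhds_zero_nat ζ).comp (tendsto_add_atTop_nat 3)
  refine h.congr fun n => ?_
  simp [an]

lemma an_lt {ζ : ℝ} (hζ : 0 < ζ) (n : ℕ) : 2 * an ζ n < ζ := by
  unfold an
  have : (0 : ℝ) ≤ n := Nat.cast_nonneg n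
  rw [← mul_div_assoc, div_lt_iff₀ (by positivity)]
  nlinarith

lemma iUnion_an {ζ : ℝ} (hζ : 0 < ζ) : ⋃ n, Ioo (an ζ n) (ζ - an ζ n) = Ioo 0 ζ := by
  ext x
  simp only [mem_iUnion, mem_Ioo]
  constructor
  · rintro ⟨n, h1, h2⟩
    have := an_pos hζ n
    constructor <;> linarith
  · rintro ⟨h1, h2⟩
    have : ∀ᶠ n in atTop, an ζ n < min x (ζ - x) :=
      (an_tendsto ζ).eventually_lt_const (lt_min h1 (by linarith))
    obtain ⟨n, hn⟩ := this.exists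
    exact ⟨n, hn.trans_le (min_le_left _ _), by linarith [hn.trans_le (min_le_right _ _)]⟩

lemma mono_an {ζ : ℝ} (hζ : 0 < ζ) : Monotone fun n => Ioo (an ζ n) (ζ - an ζ n) := by
  intro n k h
  have := an_anti hζ h
  exact Ioo_subset_Ioo this (by linarith)

lemma lim_rect {ζ m : ℝ} (hζ : 0 < ζ) {k : ℝ × ℝ → ℝ} (hk : IntegrableOn k (Ioo 0 ζ ×ˢ Ioo 0 m)) :
    Tendsto (fun n => ∫ p in Ioo (an ζ n) (ζ - an ζ n) ×ˢ Ioo 0 m, k p) atTop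
      (𝓝 (∫ p in Ioo 0 ζ ×ˢ Ioo 0 m, k p)) := by
  have e : ⋃ n, Ioo (an ζ n) (ζ - an ζ n) ×ˢ Ioo 0 m = Ioo 0 ζ ×ˢ Ioo 0 m := by
    rw [← iUnion_prod_const, iUnion_an hζ]
  have := tendsto_setIntegral_of_monotone (μ := volume) (s := fun n => Ioo (an ζ n) (ζ - an ζ n) ×ˢ Ioo 0 m) (f := k)
    (fun n => measurableSet_Ioo.prod measurableSet_Ioo) (fun n k h => prod_mono (mono_an hζ h) subset_rfl)
    (by rw [e]; exact hk)
  rwa [e] at this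

lemma lim_1d {ζ : ℝ} (hζ : 0 < ζ) {k : ℝ → ℝ} (hk : IntegrableOn k (Ioo 0 ζ)) :
    Tendsto (fun n => ∫ x in (an ζ n)..(ζ - an ζ n), k x) atTop (𝓝 (∫ x in Ioo 0 ζ, k x)) := by
  have := tendsto_setIntegral_of_monotone (μ := volume) (s := fun n => Ioo (an ζ n) (ζ - an ζ n)) (f := k)
    (fun n => measurableSet_Ioo) (mono_an hζ) (by rw [iUnion_an hζ]; exact hk)
  rw [iUnion_an hζ] at this
  refine this.congr fun n => ?_
  rw [intervalIntegral.integral_of_le (by linarith [an_lt hζ n]), integral_Ioc_eq_integral_Ioo]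

section
variable {ζ m κ s c1 c2 C lam B : ℝ} {c T : ℝ × ℝ → ℝ} {G h : ℝ → ℝ}

lemma pow_mul_le_one {x u v : ℝ} (hx : 0 < x) (hx1 : x ≤ 1) (h : 0 ≤ u + v) : x ^ u * x ^ v ≤ 1 := by
  rw [← Real.rpow_add hx]; exact Real.rpow_le_one hx.le hx1 h

lemma weak_integrable (H : Coef ζ m κ s c1 c2 C c) (hc1 : 0 < c1) (hc2 : 0 < c2) (hC : 0 < C)
    (hζ : 0 < ζ) (hζ1 : ζ ≤ 1) (hκ : 1 ≤ κ) (hs : 0 < s) (hlam : 0 < lam) (hκl : κ ≤ lam + 1) (hB0 : 0 ≤ B)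
    {u ξ : ℝ × ℝ → ℝ} (hu : ContinuousOn u (Ioo 0 ζ ×ˢ Ioo 0 m))
    (hB : ∀ p ∈ Ioo 0 ζ ×ˢ Ioo 0 m, |u p| ≤ B * p.1 ^ (lam + 1))
    (hξ : ContDiff ℝ 1 ξ) {σ : ℝ} (hσ : |σ| = 1) :
    IntegrableOn (fun p => u p * (pdx ξ p - σ * c p * pdy ξ p - σ * pdy c p * ξ p)) (Ioo 0 ζ ×ˢ Ioo 0 m) := by
  have hms : MeasurableSet (Ioo 0 ζ ×ˢ Ioo 0 m) := measurableSet_Ioo.prod measurableSet_Ioo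
  have hsub : Ioo 0 ζ ×ˢ Ioo 0 m ⊆ Ioc 0 ζ ×ˢ univ := prod_mono Ioo_subset_Ioc_self (subset_univ _)
  obtain ⟨M1, n1, b1⟩ := cont_bdd_rect (continuous_pdx hξ) 0 ζ 0 m
  obtain ⟨M2, n2, b2⟩ := cont_bdd_rect (continuous_pdy hξ) 0 ζ 0 m
  obtain ⟨M3, n3, b3⟩ := cont_bdd_rect hξ.continuous 0 ζ 0 m
  refine integrableOn_rect_of_bdd' (M := B * M1 + B * c2 * M2 + B * C * M3) ?_ ?_
  · have h1 := hu.aestronglyMeasurable (μ := volume) hms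
    have h2 := ((H.continuousOn hc1 hC hζ hζ1 hκ hs).mono hsub).aestronglyMeasurable (μ := volume) hms
    have h3 := H.pdy_meas hc1 hC hζ hζ1 hκ hs hms hsub
    have h4 := (continuous_pdx hξ).aestronglyMeasurable (μ := volume.restrict (Ioo 0 ζ ×ˢ Ioo 0 m))
    have h5 := (continuous_pdy hξ).aestronglyMeasurable (μ := volume.restrict (Ioo 0 ζ ×ˢ Ioo 0 m))
    have h6 := hξ.continuous.aestronglyMeasurable (μ := volume.restrict (Ioo 0 ζ ×ˢ Ioo 0 m))
    exact h1.mul ((h4.sub ((h2.const_mul σ).mul h5)).sub ((h3.const_mul σ).mul h6))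
  · intro p hp
    have hp' : p ∈ Icc 0 ζ ×ˢ Icc 0 m := ⟨Ioo_subset_Icc_self hp.1, Ioo_subset_Icc_self hp.2⟩
    have x0 : 0 < p.1 := hp.1.1
    have x1 : p.1 ≤ 1 := hp.1.2.le.trans hζ1
    have hup := hB p hp
    have q0 : p.1 ^ (lam + 1) ≤ 1 := Real.rpow_le_one x0.le x1 (by linarith)
    have q1 : p.1 ^ (lam + 1) * p.1 ^ (-κ) ≤ 1 := pow_mul_le_one x0 x1 (by linarith)
    have q2 : p.1 ^ (lam + 1) * p.1 ^ (s - 1) ≤ 1 := pow_mul_le_one x0 x1 (by linarith)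
    have r1 : |u p| ≤ B := hup.trans (by nlinarith)
    have cpos : 0 < c p := H.pos hc1 p.2 x0 hp.1.2.le
    have r2 : |u p| * c p ≤ B * c2 := by
      calc |u p| * c p ≤ (B * p.1 ^ (lam + 1)) * (c2 * p.1 ^ (-κ)) := by
            apply mul_le_mul hup (H.hi p.1 p.2 x0 hp.1.2.le) cpos.le (by positivity)
        _ = B * c2 * (p.1 ^ (lam + 1) * p.1 ^ (-κ)) := by ring
        _ ≤ B * c2 * 1 := by gcongr
        _ = _ := mul_one _
    have r3 : |u p| * |pdy c p| ≤ B * C := by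
      calc |u p| * |pdy c p| ≤ (B * p.1 ^ (lam + 1)) * (C * p.1 ^ (s - 1)) := by
            apply mul_le_mul hup (H.pdy_abs_le hC x0 hp.1.2.le) (abs_nonneg _) (by positivity)
        _ = B * C * (p.1 ^ (lam + 1) * p.1 ^ (s - 1)) := by ring
        _ ≤ B * C * 1 := by gcongr
        _ = _ := mul_one _
    have e : u p * (pdx ξ p - σ * c p * pdy ξ p - σ * pdy c p * ξ p)
        = u p * pdx ξ p - σ * (u p * c p) * pdy ξ p - σ * (u p * pdy c p) * ξ p := by ring
    rw [e]
    refine (abs_sub _ _).trans (add_le_add ((abs_sub _ _).trans (add_le_add ?_ ?_)) ?_)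
    · rw [abs_mul]; exact mul_le_mul r1 (b1 p hp') (abs_nonneg _) hB0
    · rw [abs_mul, abs_mul, hσ, one_mul, abs_mul, abs_of_pos cpos]
      exact mul_le_mul r2 (b2 p hp') (abs_nonneg _) (by positivity)
    · rw [abs_mul, abs_mul, hσ, one_mul, abs_mul]
      exact mul_le_mul r3 (b3 p hp') (abs_nonneg _) (by positivity)

/-- Endpoint integrals tend to zero. -/
lemma end_tendsto (hζ : 0 < ζ) (hm : 0 < m) (hlam : 0 < lam) (hB0 : 0 ≤ B) (hζ1 : ζ ≤ 1)
    {u ξ : ℝ × ℝ → ℝ} 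
    (hB : ∀ x ∈ Ioo 0 ζ, ∀ y ∈ Icc 0 m, |u (x, y)| ≤ B * x ^ (lam + 1))
    (hξ : ContDiff ℝ 1 ξ) (h0 : ∀ ψ ∈ Icc (0 : ℝ) m, ξ (ζ, ψ) = 0) :
    Tendsto (fun n => (∫ y in (0 : ℝ)..m, u (ζ - an ζ n, y) * ξ (ζ - an ζ n, y))
      - ∫ y in (0 : ℝ)..m, u (an ζ n, y) * ξ (an ζ n, y)) atTop (𝓝 0) := by
  obtain ⟨M3, n3, b3⟩ := cont_bdd_rect hξ.continuous 0 ζ 0 m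
  obtain ⟨L, hL⟩ := locLip_rect hξ.locallyLipschitz 0 ζ 0 m
  have ha : ∀ n, an ζ n ∈ Ioo 0 ζ := fun n => ⟨an_pos hζ n, by linarith [an_lt hζ n, an_pos hζ n]⟩
  have hb : ∀ n, ζ - an ζ n ∈ Ioo 0 ζ := fun n => ⟨by linarith [an_lt hζ n, an_pos hζ n], by linarith [an_pos hζ n]⟩
  have bd : ∀ x ∈ Ioo 0 ζ, ∀ K, (∀ y ∈ Icc 0 m, |u (x, y) * ξ (x, y)| ≤ K) →
      |∫ y in (0 : ℝ)..m, u (x, y) * ξ (x, y)| ≤ K * m := by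
    intro x hx K hK
    have := intervalIntegral.norm_integral_le_of_norm_le_const (a := 0) (b := m) (C := K)
      (f := fun y => u (x, y) * ξ (x, y)) (fun y hy => by
        rw [uIoc_of_le hm.le] at hy
        exact hK y (Ioc_subset_Icc_self hy))
    rwa [sub_zero, abs_of_pos hm] at this
  have le1 : ∀ x ∈ Ioo 0 ζ, x ^ (lam + 1) ≤ x := by
    intro x hx
    calc x ^ (lam + 1) ≤ x ^ (1 : ℝ) :=
          Real.rpow_le_rpow_of_exponent_ge hx.1 (hx.2.le.trans hζ1) (by linarith)
      _ = x := Real.rpow_one x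
  have t1 : Tendsto (fun n => ∫ y in (0 : ℝ)..m, u (ζ - an ζ n, y) * ξ (ζ - an ζ n, y)) atTop (𝓝 0) := by
    rw [tendsto_zero_iff_norm_tendsto_zero]
    refine squeeze_zero (g := fun n => (B * L * m) * an ζ n) (fun n => norm_nonneg _) (fun n => ?_) ?_
    · refine (bd _ (hb n) (B * (L * an ζ n)) ?_).trans (by apply le_of_eq; ring)
      intro y hy
      rw [abs_mul]
      have q1 : |u (ζ - an ζ n, y)| ≤ B := by
        refine (hB _ (hb n) y hy).trans ?_
        have := le1 _ (hb n)
        have := (hb n).2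
        nlinarith
      have q2 : |ξ (ζ - an ζ n, y)| ≤ L * an ζ n := by
        have := hL.dist_le_mul (ζ - an ζ n, y) ⟨Ioo_subset_Icc_self (hb n), hy⟩ (ζ, y) ⟨⟨hζ.le, le_rfl⟩, hy⟩
        rw [Real.dist_eq, h0 y hy, sub_zero, Prod.dist_eq, dist_self, Real.dist_eq] at this
        simp only [sub_sub_cancel_left, abs_neg, abs_of_pos (an_pos hζ n)] at this
        rwa [max_eq_left (an_pos hζ n).le] at this
      exact mul_le_mul q1 q2 (abs_nonneg _) hB0
    · simpa using (an_tendsto ζ).const_mul (B * L * m)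
  have t2 : Tendsto (fun n => ∫ y in (0 : ℝ)..m, u (an ζ n, y) * ξ (an ζ n, y)) atTop (𝓝 0) := by
    rw [tendsto_zero_iff_norm_tendsto_zero]
    refine squeeze_zero (g := fun n => (B * M3 * m) * an ζ n) (fun n => norm_nonneg _) (fun n => ?_) ?_
    · refine (bd _ (ha n) (B * an ζ n * M3) ?_).trans (by apply le_of_eq; ring)
      intro y hy
      rw [abs_mul]
      have q1 : |u (an ζ n, y)| ≤ B * an ζ n := by
        refine (hB _ (ha n) y hy).trans ?_
        exact mul_le_mul_of_nonneg_left (le1 _ (ha n)) hB0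
      exact mul_le_mul q1 (b3 _ ⟨Ioo_subset_Icc_self (ha n), hy⟩) (abs_nonneg _) (mul_nonneg hB0 (ha n).1.le)
    · simpa using (an_tendsto ζ).const_mul (B * M3 * m)
  simpa using t1.sub t2

theorem weak_exists (H : Coef ζ m κ s c1 c2 C c) (hc1 : 0 < c1) (hc2 : 0 < c2) (hC : 0 < C) (hm : 0 < m)
    (hζ : 0 < ζ) (hζ1 : ζ ≤ 1) (hκ : 1 ≤ κ) (hs : 0 < s) (hlam : 0 < lam) (hκl : κ ≤ lam + 1) (hB0 : 0 ≤ B)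
    (hTL : ∃ L : NNReal, LipschitzOnWith L T (univ ×ˢ Icc (-m) m))
    (hTI : ∀ x t, t ∈ Icc (-m) m → x ∈ Ioo 0 ζ → T (x, t) ∈ Ioo 0 ζ)
    (hTd : ∀ x t, t ∈ Ioo (-m) m → x ∈ Ioo 0 ζ → DifferentiableAt ℝ T (x, t) →
        pdx T (x, t) = c (x, t) * pdy T (x, t))
    (hG : ContinuousOn G (Ioo 0 ζ))
    (hB : ∀ x t, t ∈ Icc (-m) m → x ∈ Ioo 0 ζ → |G (T (x, t))| ≤ B * x ^ (lam + 1))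
    (hh : ∀ x ∈ Ioo 0 ζ, G (T (x, m)) - G (T (x, -m)) = h x)
    {ξ η : ℝ × ℝ → ℝ} (hξ : ContDiff ℝ 1 ξ) (hη : ContDiff ℝ 1 η)
    (h0 : ∀ ψ ∈ Icc (0 : ℝ) m, ξ (ζ, ψ) = 0 ∧ η (ζ, ψ) = 0)
    (hbc : ∀ φ ∈ Icc (0 : ℝ) ζ, ξ (φ, 0) = -η (φ, 0) ∧ ξ (φ, m) = -η (φ, m)) :
    -(∫ p in Ioo 0 ζ ×ˢ Ioo 0 m, G (T (p.1, -1 * p.2)) * (pdx ξ p - (-1) * c p * pdy ξ p - (-1) * pdy c p * ξ p))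
     + (∫ p in Ioo 0 ζ ×ˢ Ioo 0 m, G (T (p.1, 1 * p.2)) * (pdx η p - 1 * c p * pdy η p - 1 * pdy c p * η p))
     - (∫ φ in Ioo 0 ζ, c (φ, m) * h φ * ξ (φ, m)) = 0 := by
  have hσm : ∀ σ : ℝ, (σ = 1 ∨ σ = -1) → ∀ y ∈ Icc 0 m, σ * y ∈ Icc (-m) m := by
    intro σ hσ y hy
    rcases hσ with h | h <;> subst h <;> constructor <;> linarith [hy.1, hy.2]
  have hcont : ∀ σ : ℝ, (σ = 1 ∨ σ = -1) → ContinuousOn (fun p : ℝ × ℝ => G (T (p.1, σ * p.2))) (Ioo 0 ζ ×ˢ Icc 0 m) := by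
    intro σ hσ
    obtain ⟨L, hL⟩ := hTL
    refine hG.comp (hL.continuousOn.comp (f := fun p : ℝ × ℝ => (p.1, σ * p.2)) (by fun_prop) ?_) ?_
    · intro p hp; exact ⟨trivial, hσm σ hσ _ hp.2⟩
    · intro p hp; exact hTI _ _ (hσm σ hσ _ hp.2) hp.1
  have key : ∀ σ : ℝ, (σ = 1 ∨ σ = -1) → ∀ ξ : ℝ × ℝ → ℝ, ContDiff ℝ 1 ξ → (∀ ψ ∈ Icc (0 : ℝ) m, ξ (ζ, ψ) = 0) →
      Tendsto (fun n => ((∫ x in (an ζ n)..(ζ - an ζ n), G (T (x, σ * m)) * (-(σ * c (x, m) * ξ (x, m))))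
        - (∫ x in (an ζ n)..(ζ - an ζ n), G (T (x, σ * 0)) * (-(σ * c (x, 0) * ξ (x, 0)))))) atTop
        (𝓝 (∫ p in Ioo 0 ζ ×ˢ Ioo 0 m, G (T (p.1, σ * p.2)) * (pdx ξ p - σ * c p * pdy ξ p - σ * pdy c p * ξ p))) := by
    intro σ hσ ξ hξ h0
    have i := weak_integrable (m := m) (B := B) (u := fun p => G (T (p.1, σ * p.2))) H hc1 hc2 hC hζ hζ1 hκ hs hlam hκl hB0
      ((hcont σ hσ).mono (prod_mono subset_rfl Ioo_subset_Icc_self))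
      (fun p hp => hB _ _ (hσm σ hσ _ (Ioo_subset_Icc_self hp.2)) hp.1) hξ (σ := σ)
      (by rcases hσ with h | h <;> subst h <;> norm_num)
    have t1 := lim_rect hζ i
    have t2 := end_tendsto (u := fun p => G (T (p.1, σ * p.2))) hζ hm hlam hB0 hζ1
      (fun x hx y hy => hB _ _ (hσm σ hσ _ hy) hx) hξ h0
    have t3 := t1.sub t2
    rw [sub_zero] at t3
    refine t3.congr fun n => ?_
    rw [weak_rect_T H hc1 hc2 hC hm hζ1 hκ hTL hTI hTd hG hξ (an_pos hζ n) (by linarith [an_lt hζ n])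
      (by linarith [an_pos hζ n]) hσ]
    simp only
    ring
  have k1 := key (-1) (Or.inr rfl) ξ hξ (fun ψ hψ => (h0 ψ hψ).1)
  have k2 := key 1 (Or.inl rfl) η hη (fun ψ hψ => (h0 ψ hψ).2)
  -- continuity in x of boundary data
  have cc := H.continuousOn hc1 hC hζ hζ1 hκ hs
  have bcont : ∀ σ : ℝ, (σ = 1 ∨ σ = -1) → ∀ ξ : ℝ × ℝ → ℝ, Continuous ξ → ∀ y ∈ Icc 0 m,
      ContinuousOn (fun x => G (T (x, σ * y)) * (-(σ * c (x, y) * ξ (x, y)))) (Ioo 0 ζ) := by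
    intro σ hσ ξ hξ y hy
    have q1 : ContinuousOn (fun x => G (T (x, σ * y))) (Ioo 0 ζ) :=
      (hcont σ hσ).comp (f := fun x => (x, y)) (by fun_prop) (fun x hx => ⟨hx, hy⟩)
    have q2 : ContinuousOn (fun x => c (x, y)) (Ioo 0 ζ) :=
      cc.comp (f := fun x => (x, y)) (by fun_prop) (fun x hx => ⟨Ioo_subset_Ioc_self hx, trivial⟩)
    have q3 : Continuous (fun x => ξ (x, y)) := by fun_prop
    exact q1.mul ((continuousOn_const.mul q2).mul q3.continuousOn).neg
  have bint : ∀ σ : ℝ, (σ = 1 ∨ σ = -1) → ∀ ξ : ℝ × ℝ → ℝ, Continuous ξ → ∀ y ∈ Icc 0 m,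
      IntegrableOn (fun x => G (T (x, σ * y)) * (-(σ * c (x, y) * ξ (x, y)))) (Ioo 0 ζ) := by
    intro σ hσ ξ hξ y hy
    obtain ⟨M3, n3, b3⟩ := cont_bdd_rect hξ 0 ζ 0 m
    refine ⟨(bcont σ hσ ξ hξ y hy).aestronglyMeasurable measurableSet_Ioo, ?_⟩
    apply HasFiniteIntegral.of_bounded (C := B * c2 * M3)
    refine (ae_restrict_iff' measurableSet_Ioo).2 (Eventually.of_forall fun x hx => ?_)
    have hup := hB x _ (hσm σ hσ y hy) hx
    have cpos : 0 < c (x, y) := H.pos hc1 y hx.1 hx.2.le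
    have q1 : x ^ (lam + 1) * x ^ (-κ) ≤ 1 := pow_mul_le_one hx.1 (hx.2.le.trans hζ1) (by linarith)
    have x0 := hx.1
    have r2 : |G (T (x, σ * y))| * c (x, y) ≤ B * c2 := by
      calc |G (T (x, σ * y))| * c (x, y) ≤ (B * x ^ (lam + 1)) * (c2 * x ^ (-κ)) := by
            apply mul_le_mul hup (H.hi x y hx.1 hx.2.le) cpos.le (by positivity)
        _ = B * c2 * (x ^ (lam + 1) * x ^ (-κ)) := by ring
        _ ≤ B * c2 * 1 := by gcongr
        _ = _ := mul_one _
    have hσ1 : |σ| = 1 := by rcases hσ with h | h <;> subst h <;> norm_num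
    rw [Real.norm_eq_abs, abs_mul, abs_neg, abs_mul, abs_mul, hσ1, one_mul, abs_of_pos cpos, ← mul_assoc]
    exact mul_le_mul r2 (b3 _ ⟨Ioo_subset_Icc_self hx, hy⟩) (abs_nonneg _) (by positivity)
  have mm : m ∈ Icc 0 m := ⟨hm.le, le_rfl⟩
  have m0 : (0 : ℝ) ∈ Icc 0 m := ⟨le_rfl, hm.le⟩
  have full : ∀ σ : ℝ, (σ = 1 ∨ σ = -1) → ∀ ξ : ℝ × ℝ → ℝ, ContDiff ℝ 1 ξ → (∀ ψ ∈ Icc (0 : ℝ) m, ξ (ζ, ψ) = 0) →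
      ∫ p in Ioo 0 ζ ×ˢ Ioo 0 m, G (T (p.1, σ * p.2)) * (pdx ξ p - σ * c p * pdy ξ p - σ * pdy c p * ξ p)
      = (∫ x in Ioo 0 ζ, G (T (x, σ * m)) * (-(σ * c (x, m) * ξ (x, m))))
        - (∫ x in Ioo 0 ζ, G (T (x, σ * 0)) * (-(σ * c (x, 0) * ξ (x, 0)))) := by
    intro σ hσ ξ hξ h0
    exact tendsto_nhds_unique (key σ hσ ξ hξ h0)
      ((lim_1d hζ (bint σ hσ ξ hξ.continuous m mm)).sub (lim_1d hζ (bint σ hσ ξ hξ.continuous 0 m0)))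
  rw [full (-1) (Or.inr rfl) ξ hξ (fun ψ hψ => (h0 ψ hψ).1), full 1 (Or.inl rfl) η hη (fun ψ hψ => (h0 ψ hψ).2)]
  have j0 : (∫ x in Ioo 0 ζ, G (T (x, -1 * 0)) * (-(-1 * c (x, 0) * ξ (x, 0))))
      = ∫ x in Ioo 0 ζ, G (T (x, 1 * 0)) * (-(1 * c (x, 0) * η (x, 0))) := by
    apply setIntegral_congr_fun measurableSet_Ioo
    intro x hx
    simp only [mul_zero, (hbc x (Ioo_subset_Icc_self hx)).1]
    ring
  have j1 : (∫ φ in Ioo 0 ζ, c (φ, m) * h φ * ξ (φ, m)) =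
      (∫ x in Ioo 0 ζ, G (T (x, 1 * m)) * (-(1 * c (x, m) * η (x, m))))
       - ∫ x in Ioo 0 ζ, G (T (x, -1 * m)) * (-(-1 * c (x, m) * ξ (x, m))) := by
    rw [← integral_sub (bint 1 (Or.inl rfl) η hη.continuous m mm) (bint (-1) (Or.inr rfl) ξ hξ.continuous m mm)]
    apply setIntegral_congr_fun measurableSet_Ioo
    intro x hx
    simp only [one_mul, neg_one_mul, ← hh x hx, (hbc x (Ioo_subset_Icc_self hx)).2]
    ring
  rw [j0, j1]; ring
end


open Real Set MeasureTheory Filter Topology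

lemma kernel_exists : ∃ A : ℝ, 0 < A ∧ ∀ δ : ℝ, 0 < δ → ∃ ρ : ℝ × ℝ → ℝ, ContDiff ℝ 1 ρ ∧
    (∀ q, δ < ‖q‖ → ρ q = 0) ∧ (∫ q, ρ q = 1) ∧ (∀ q, |ρ q| ≤ A / δ ^ 2) ∧
    (∀ q, ‖fderiv ℝ ρ q‖ ≤ A / δ ^ 3) := by
  let f : ContDiffBump (0 : ℝ × ℝ) := ⟨1 / 2, 1, by norm_num, by norm_num⟩
  set g : ℝ × ℝ → ℝ := f.normed volume with hg
  have g1 : ContDiff ℝ 1 g := by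
    have := f.contDiff_normed (μ := (volume : Measure (ℝ × ℝ))) (n := 1)
    exact_mod_cast this
  have gs : HasCompactSupport g := f.hasCompactSupport_normed
  have gi : ∫ q, g q = 1 := f.integral_normed
  have g0 : ∀ q, 1 < ‖q‖ → g q = 0 := by
    intro q hq
    have : q ∉ Function.support g := by
      rw [hg, f.support_normed_eq]
      simp only [Metric.mem_ball, dist_zero_right, not_lt]
      exact hq.le
    simpa using this
  obtain ⟨A1, hA1⟩ := gs.exists_bound_of_continuous g1.continuous
  obtain ⟨A2, hA2⟩ := (gs.fderiv (𝕜 := ℝ)).exists_bound_of_continuous (g1.continuous_fderiv one_ne_zero)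
  have h1 : 0 ≤ A1 := (norm_nonneg _).trans (hA1 0)
  have h2 : 0 ≤ A2 := (norm_nonneg _).trans (hA2 0)
  refine ⟨A1 + A2 + 1, by positivity, fun δ hδ => ⟨fun q => (δ ^ 2)⁻¹ * g (δ⁻¹ • q), ?_, ?_, ?_, ?_, ?_⟩⟩
  · exact contDiff_const.mul (g1.comp (contDiff_const_smul _))
  · intro q hq
    show (δ ^ 2)⁻¹ * g (δ⁻¹ • q) = 0
    rw [g0, mul_zero]
    rw [norm_smul, norm_inv, Real.norm_of_nonneg hδ.le, ← div_eq_inv_mul, lt_div_iff₀ hδ, one_mul]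
    exact hq
  · rw [integral_const_mul, Measure.integral_comp_inv_smul_of_nonneg volume g hδ.le, gi]
    simp
    field_simp
  · intro q
    rw [abs_mul, abs_of_nonneg (by positivity), div_eq_inv_mul]
    apply mul_le_mul_of_nonneg_left _ (by positivity)
    exact (hA1 _).trans (by linarith)
  · intro q
    have hd : HasFDerivAt (fun q => (δ ^ 2)⁻¹ * g (δ⁻¹ • q))
        ((δ ^ 2)⁻¹ • ((fderiv ℝ g (δ⁻¹ • q)).comp (δ⁻¹ • ContinuousLinearMap.id ℝ (ℝ × ℝ)))) q := by
      apply HasFDerivAt.const_mul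
      exact ((g1.differentiable one_ne_zero _).hasFDerivAt).comp q ((hasFDerivAt_id q).const_smul δ⁻¹)
    rw [hd.fderiv, ContinuousLinearMap.comp_smul, ContinuousLinearMap.comp_id, norm_smul, norm_smul, norm_inv,
      norm_inv, norm_pow, Real.norm_of_nonneg hδ.le]
    have : (A1 + A2 + 1) / δ ^ 3 = (δ ^ 2)⁻¹ * (δ⁻¹ * (A1 + A2 + 1)) := by field_simp
    rw [this]
    apply mul_le_mul_of_nonneg_left _ (by positivity)
    apply mul_le_mul_of_nonneg_left _ (by positivity)
    exact (hA2 _).trans (by linarith)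

def osc (v : ℝ × ℝ → ℝ) (δ : ℝ) (p : ℝ × ℝ) : ℝ :=
  ∫ q in Metric.closedBall p δ, |v q - v p|

lemma vol_ball (p : ℝ × ℝ) {δ : ℝ} (hδ : 0 < δ) :
    volume.real (Metric.closedBall p δ) = 4 * δ ^ 2 := by
  rw [← closedBall_prod_same]
  rw [measureReal_def, Measure.volume_eq_prod, Measure.prod_prod, ENNReal.toReal_mul]
  simp [Real.volume_closedBall, hδ.le]
  ring

lemma bdd_locInt {v : ℝ × ℝ → ℝ} {M : ℝ} (hv : Measurable v) (hM : ∀ p, |v p| ≤ M) :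
    LocallyIntegrable v volume := by
  intro p
  refine ⟨Metric.closedBall p 1, Metric.closedBall_mem_nhds _ one_pos, hv.aestronglyMeasurable, ?_⟩
  haveI : IsFiniteMeasure (volume.restrict (Metric.closedBall p 1)) :=
    ⟨by rw [Measure.restrict_apply_univ]; exact measure_closedBall_lt_top⟩
  exact HasFiniteIntegral.of_bounded (C := M) (Eventually.of_forall hM)

lemma osc_int {v : ℝ × ℝ → ℝ} {M : ℝ} (hv : Measurable v) (hM : ∀ p, |v p| ≤ M) (δ : ℝ) (p : ℝ × ℝ) :
    IntegrableOn (fun q => |v q - v p|) (Metric.closedBall p δ) := by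
  haveI : IsFiniteMeasure (volume.restrict (Metric.closedBall p δ)) :=
    ⟨by rw [Measure.restrict_apply_univ]; exact measure_closedBall_lt_top⟩
  refine ⟨by fun_prop, HasFiniteIntegral.of_bounded (C := 2 * M) (Eventually.of_forall fun q => ?_)⟩
  rw [norm_eq_abs, abs_abs]
  exact (abs_sub _ _).trans (by linarith [hM q, hM p])

lemma osc_nonneg (v : ℝ × ℝ → ℝ) (δ : ℝ) (p : ℝ × ℝ) : 0 ≤ osc v δ p :=
  integral_nonneg fun _ => abs_nonneg _

lemma osc_le {v : ℝ × ℝ → ℝ} {M : ℝ} (hv : Measurable v) (hM : ∀ p, |v p| ≤ M) {δ : ℝ} (hδ : 0 < δ) (p : ℝ × ℝ) :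
    osc v δ p / δ ^ 2 ≤ 8 * M := by
  rw [div_le_iff₀ (by positivity)]
  have : osc v δ p ≤ ∫ q in Metric.closedBall p δ, 2 * M := by
    apply setIntegral_mono_on (osc_int hv hM δ p)
    · exact integrableOn_const measure_closedBall_lt_top.ne
    · exact measurableSet_closedBall
    · intro q _
      exact (abs_sub _ _).trans (by linarith [hM q, hM p])
  rw [setIntegral_const, vol_ball p hδ, smul_eq_mul] at this
  linarith

lemma osc_tendsto {v : ℝ × ℝ → ℝ} {M : ℝ} (hv : Measurable v) (hM : ∀ p, |v p| ≤ M)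
    {d : ℕ → ℝ} (hd : ∀ n, 0 < d n) (hd0 : Tendsto d atTop (𝓝 0)) :
    ∀ᵐ p, Tendsto (fun n => osc v (d n) p / d n ^ 2) atTop (𝓝 0) := by
  filter_upwards [IsUnifLocDoublingMeasure.ae_tendsto_average_norm_sub volume (bdd_locInt hv hM) 1] with p hp
  have h := hp (fun _ : ℕ => p) d (tendsto_nhdsWithin_iff.2 ⟨hd0, Eventually.of_forall hd⟩)
    (Eventually.of_forall fun n => Metric.mem_closedBall_self (by rw [one_mul]; exact (hd n).le))
  have h' := h.const_mul 4
  rw [mul_zero] at h'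
  refine h'.congr fun n => ?_
  rw [setAverage_eq, vol_ball p (hd n), smul_eq_mul]
  simp only [osc, norm_eq_abs]
  have := hd n
  field_simp


open Real Set MeasureTheory Filter Topology

def mol (v ρ : ℝ × ℝ → ℝ) (p : ℝ × ℝ) : ℝ := ∫ q, v q * ρ (p - q)

section
variable {v ρ : ℝ × ℝ → ℝ} {M A δ : ℝ}

lemma ker_compact (hs : ∀ q, δ < ‖q‖ → ρ q = 0) : HasCompactSupport ρ := by
  apply HasCompactSupport.intro (isCompact_closedBall (0 : ℝ × ℝ) δ)
  intro q hq
  exact hs q (by simpa using hq)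

lemma ker_fderiv_zero (hs : ∀ q, δ < ‖q‖ → ρ q = 0) {q : ℝ × ℝ} (hq : δ < ‖q‖) : fderiv ℝ ρ q = 0 := by
  have : ρ =ᶠ[𝓝 q] fun _ => 0 := by
    filter_upwards [(isOpen_lt continuous_const continuous_norm).mem_nhds hq] with z hz using hs z hz
  rw [this.fderiv_eq]
  simp

lemma mol_props (hv : Measurable v) (hM : ∀ p, |v p| ≤ M) (hρ : ContDiff ℝ 1 ρ) (hs : ∀ q, δ < ‖q‖ → ρ q = 0) : ContDiff ℝ 1 (mol v ρ) ∧
    (∀ p, pdx (mol v ρ) p = ∫ q, v q * pdx ρ (p - q)) ∧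
    (∀ p, pdy (mol v ρ) p = ∫ q, v q * pdy ρ (p - q)) := by
  have hc := ker_compact hs
  have hl := bdd_locInt hv hM
  have e : mol v ρ = convolution v ρ (ContinuousLinearMap.mul ℝ ℝ) volume := by
    ext p; simp [mol, convolution_def]
  have h1 : ContDiff ℝ 1 (mol v ρ) := by
    rw [e]
    have := hc.contDiff_convolution_right (n := 1) (ContinuousLinearMap.mul ℝ ℝ) hl (by exact_mod_cast hρ)
    exact_mod_cast this
  have hd : ∀ p w, fderiv ℝ (mol v ρ) p w = ∫ q, v q * fderiv ℝ ρ (p - q) w := by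
    intro p w
    have := hc.hasFDerivAt_convolution_right (ContinuousLinearMap.mul ℝ ℝ) hl hρ p
    rw [e, this.fderiv, convolution_precompR_apply _ hl (hc.fderiv (𝕜 := ℝ)) (hρ.continuous_fderiv one_ne_zero)]
    simp [convolution_def]
  refine ⟨h1, fun p => ?_, fun p => ?_⟩
  · rw [pdx_eq_fderiv (h1.differentiable one_ne_zero p), hd]
    congr 1; ext q
    rw [pdx_eq_fderiv (hρ.differentiable one_ne_zero _)]
  · rw [pdy_eq_fderiv (h1.differentiable one_ne_zero p), hd]
    congr 1; ext q
    rw [pdy_eq_fderiv (hρ.differentiable one_ne_zero _)]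

/-- A bounded kernel supported in a ball is integrable against bounded functions. -/
lemma ker_integrable {k : ℝ × ℝ → ℝ} {B : ℝ} {p : ℝ × ℝ} (hk : AEStronglyMeasurable k volume)
    (hb : ∀ q, |k q| ≤ B) (h0 : ∀ q, δ < ‖p - q‖ → k q = 0) : Integrable k := by
  have : IntegrableOn k (Metric.closedBall p δ) := by
    haveI : IsFiniteMeasure (volume.restrict (Metric.closedBall p δ)) :=
      ⟨by rw [Measure.restrict_apply_univ]; exact measure_closedBall_lt_top⟩
    exact ⟨hk.restrict, HasFiniteIntegral.of_bounded (C := B) (Eventually.of_forall hb)⟩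
  refine (integrableOn_iff_integrable_of_support_subset ?_).1 this
  intro q hq
  by_contra h
  apply hq
  apply h0
  rw [Metric.mem_closedBall, dist_comm, dist_eq_norm] at h
  exact not_le.1 h

/-- Zero-mean kernels see only the oscillation. -/
lemma ker_osc (hv : Measurable v) (hM : ∀ p, |v p| ≤ M) (hδ : 0 < δ) {k : ℝ × ℝ → ℝ} {B s : ℝ} {p : ℝ × ℝ} (hk : AEStronglyMeasurable k volume)
    (hb : ∀ q, |k q| ≤ B) (h0 : ∀ q, δ < ‖p - q‖ → k q = 0) (hi : ∫ q, k q = s) :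
    |(∫ q, v q * k q) - s * v p| ≤ B * osc v δ p := by
  have hB : 0 ≤ B := (abs_nonneg _).trans (hb 0)
  have hM0 : 0 ≤ M := (abs_nonneg _).trans (hM 0)
  have i1 : Integrable k := ker_integrable hk hb h0
  have i2 : Integrable fun q => v q * k q := by
    apply ker_integrable (B := M * B) (δ := δ) (p := p) (hv.aestronglyMeasurable.mul hk)
    · intro q; rw [Pi.mul_apply, abs_mul]; exact mul_le_mul (hM q) (hb q) (abs_nonneg _) hM0
    · intro q hq; rw [Pi.mul_apply, h0 q hq, mul_zero]
  have e : (∫ q, v q * k q) - s * v p = ∫ q, (v q - v p) * k q := by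
    rw [← hi, mul_comm, ← integral_const_mul, ← integral_sub i2 (i1.const_mul _)]
    congr 1; ext q; ring
  have e2 : ∫ q, (v q - v p) * k q = ∫ q in Metric.closedBall p δ, (v q - v p) * k q := by
    symm
    apply setIntegral_eq_integral_of_forall_compl_eq_zero
    intro q hq
    rw [h0, mul_zero]
    rw [Metric.mem_closedBall, dist_comm, dist_eq_norm] at hq
    exact not_le.1 hq
  rw [e, e2, osc, ← integral_const_mul]
  rw [← norm_eq_abs]
  refine norm_integral_le_of_norm_le ((osc_int hv hM δ p).const_mul B) (Eventually.of_forall fun q => ?_)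
  rw [norm_eq_abs, abs_mul, mul_comm]
  exact mul_le_mul_of_nonneg_right (hb q) (abs_nonneg _)

lemma mol_sub_le (hv : Measurable v) (hM : ∀ p, |v p| ≤ M) (hρ : ContDiff ℝ 1 ρ) (hδ : 0 < δ) (hs : ∀ q, δ < ‖q‖ → ρ q = 0) (h1 : ∫ q, ρ q = 1) (hA : ∀ q, |ρ q| ≤ A / δ ^ 2) (p : ℝ × ℝ) :
    |mol v ρ p - v p| ≤ A * (osc v δ p / δ ^ 2) := by
  have h := ker_osc (v := v) (k := fun q => ρ (p - q)) (p := p) (s := 1) hv hM hδ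
    (by have := hρ.continuous; exact (by fun_prop : Continuous fun q => ρ (p - q)).aestronglyMeasurable) (fun q => hA _)
    (fun q hq => hs _ hq) (by rw [integral_sub_left_eq_self ρ volume p, h1])
  rw [one_mul] at h
  refine h.trans (le_of_eq ?_)
  ring

lemma commut_kernel (hρ : ContDiff ℝ 1 ρ) (hδ : 0 < δ) (hs : ∀ q, δ < ‖q‖ → ρ q = 0) {c : ℝ × ℝ → ℝ} {L : NNReal} (hc : LipschitzWith L c) 
    (hA : ∀ q, |ρ q| ≤ A / δ ^ 2) (hA' : ∀ q, ‖fderiv ℝ ρ q‖ ≤ A / δ ^ 3) (p : ℝ × ℝ) :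
    AEStronglyMeasurable (fun q => (c p - c q) * pdy ρ (p - q) + pdy c q * ρ (p - q)) volume ∧
    (∀ q, |(c p - c q) * pdy ρ (p - q) + pdy c q * ρ (p - q)| ≤ 2 * L * A / δ ^ 2) ∧
    (∀ q, δ < ‖p - q‖ → (c p - c q) * pdy ρ (p - q) + pdy c q * ρ (p - q) = 0) ∧
    ∫ q, ((c p - c q) * pdy ρ (p - q) + pdy c q * ρ (p - q)) = 0 := by
  have cρ := hρ.continuous
  have cy := continuous_pdy hρ
  have cc := hc.continuous
  have hD : ∀ q, |pdy ρ q| ≤ A / δ ^ 3 := by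
    intro q
    rw [pdy_eq_fderiv (hρ.differentiable one_ne_zero _), ← norm_eq_abs]
    refine ((fderiv ℝ ρ q).le_opNorm _).trans ?_
    have : ‖((0 : ℝ), (1 : ℝ))‖ = 1 := by simp [Prod.norm_def]
    rw [this, mul_one]
    exact hA' q
  have hA0 : 0 ≤ A := by
    have := (abs_nonneg _).trans (hA 0)
    rw [le_div_iff₀ (by positivity), zero_mul] at this
    exact this
  have z : ∀ q, δ < ‖p - q‖ → (c p - c q) * pdy ρ (p - q) + pdy c q * ρ (p - q) = 0 := by
    intro q hq
    rw [pdy_eq_fderiv (hρ.differentiable one_ne_zero _), ker_fderiv_zero hs hq, hs _ hq]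
    simp
  refine ⟨?_, ?_, z, ?_⟩
  · have := measurable_pdy hc.continuous
    exact ((by fun_prop : Continuous fun q => (c p - c q) * pdy ρ (p - q)).aestronglyMeasurable).add
      (this.aestronglyMeasurable.mul (by fun_prop : Continuous fun q => ρ (p - q)).aestronglyMeasurable)
  · intro q
    by_cases hq : δ < ‖p - q‖
    · rw [z q hq, abs_zero]; positivity
    · push Not at hq
      have h1 : |c p - c q| ≤ L * δ := by
        have := hc.dist_le_mul p q
        rw [Real.dist_eq, dist_eq_norm] at this
        exact this.trans (mul_le_mul_of_nonneg_left hq L.2)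
      have h2 : |pdy c q| ≤ L := abs_pdy_le hc q
      refine (abs_add_le _ _).trans ?_
      rw [abs_mul, abs_mul]
      have e1 : |c p - c q| * |pdy ρ (p - q)| ≤ (L * δ) * (A / δ ^ 3) :=
        mul_le_mul h1 (hD _) (abs_nonneg _) (by positivity)
      have e2 : |pdy c q| * |ρ (p - q)| ≤ L * (A / δ ^ 2) :=
        mul_le_mul h2 (hA _) (abs_nonneg _) L.2
      have e3 : (L * δ) * (A / δ ^ 3) + L * (A / δ ^ 2) = 2 * L * A / δ ^ 2 := by
        field_simp; ring
      linarith
  · set g : ℝ × ℝ → ℝ := fun q => (c q - c p) * ρ (p - q) with hg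
    have hgl : LocallyLipschitz g := by
      apply locLip_mul
      · exact (hc.sub (LipschitzWith.const (c p))).locallyLipschitz
      · exact (hρ.comp (contDiff_const.sub contDiff_id)).locallyLipschitz
    obtain ⟨Lg, hLg⟩ := locLip_rect hgl (p.1 - 2 * δ) (p.1 + 2 * δ) (p.2 - 2 * δ) (p.2 + 2 * δ)
    have hdiv := (div_rect (P := fun _ => 0) (LipschitzWith.const (0:ℝ)).lipschitzOnWith hLg (by linarith) (by linarith)).2.2
    have g0 : ∀ x y, 2 * δ ≤ |p.2 - y| → g (x, y) = 0 := by
      intro x y h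
      have : ρ (p - (x, y)) = 0 := by
        apply hs
        have h2 := norm_snd_le (p - (x, y))
        simp only [Prod.snd_sub, norm_eq_abs] at h2
        linarith
      simp [hg, this]
    have e1 : ∀ x, g (x, p.2 + 2 * δ) = 0 := fun x => g0 _ _ (by
      rw [show p.2 - (p.2 + 2 * δ) = -(2 * δ) by ring, abs_neg]; exact le_abs_self _)
    have e2 : ∀ x, g (x, p.2 - 2 * δ) = 0 := fun x => g0 _ _ (by
      rw [show p.2 - (p.2 - 2 * δ) = (2 * δ) by ring]; exact le_abs_self _)
    simp only [e1, e2, sub_zero, intervalIntegral.integral_zero, add_zero] at hdiv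
    have p0 : ∀ q, pdx (fun _ : ℝ × ℝ => (0:ℝ)) q = 0 := fun q => by simp [pdx]
    simp only [p0, zero_add] at hdiv
    rw [← setIntegral_eq_integral_of_forall_compl_eq_zero
      (s := Ioo (p.1 - 2 * δ) (p.1 + 2 * δ) ×ˢ Ioo (p.2 - 2 * δ) (p.2 + 2 * δ)), ← hdiv]
    · apply integral_congr_ae
      filter_upwards [ae_restrict_of_ae hc.ae_differentiableAt] with q hq
      have d1 := hasDerivAt_pdy hq
      have d2 : HasDerivAt (fun y => ρ (p - (q.1, y))) (-pdy ρ (p - q)) q.2 := by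
        have := hasDerivAt_pdy (hρ.differentiable one_ne_zero (p - q))
        have h3 := HasDerivAt.comp_const_sub (f := fun y => ρ ((p - q).1, y)) p.2 q.2 this
        exact h3
      have d3 : HasDerivAt (fun y => g (q.1, y)) _ q.2 := (d1.sub_const (c p)).mul d2
      show _ = deriv (fun y => g (q.1, y)) q.2
      rw [d3.deriv]
      simp only [Prod.mk.eta]
      ring
    · intro q hq
      apply z
      by_contra h
      push Not at h
      apply hq
      have h1 := (norm_fst_le (p - q)).trans h
      have h2 := (norm_snd_le (p - q)).trans h
      simp only [Prod.fst_sub, Prod.snd_sub, norm_eq_abs, abs_le] at h1 h2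
      exact ⟨⟨by linarith, by linarith⟩, ⟨by linarith, by linarith⟩⟩

lemma mol_eqn (hv : Measurable v) (hM : ∀ p, |v p| ≤ M) (hρ : ContDiff ℝ 1 ρ) (hδ : 0 < δ) (hs : ∀ q, δ < ‖q‖ → ρ q = 0) {c : ℝ × ℝ → ℝ} {L : NNReal} (hc : LipschitzWith L c) 
    (hA : ∀ q, |ρ q| ≤ A / δ ^ 2) (hA' : ∀ q, ‖fderiv ℝ ρ q‖ ≤ A / δ ^ 3) (p : ℝ × ℝ)
    (hw : ∫ q, v q * (pdx (fun q => ρ (p - q)) q + c q * pdy (fun q => ρ (p - q)) q + pdy c q * ρ (p - q)) = 0) :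
    |pdx (mol v ρ) p + c p * pdy (mol v ρ) p| ≤ 2 * L * A * (osc v δ p / δ ^ 2) := by
  obtain ⟨k1, k2, k3, k4⟩ := commut_kernel hρ hδ hs hc hA hA' p
  have h := ker_osc hv hM hδ k1 k2 k3 k4
  rw [zero_mul, sub_zero] at h
  obtain ⟨-, m1, m2⟩ := mol_props hv hM hρ hs
  have ex : ∀ q, pdx (fun q => ρ (p - q)) q = - pdx ρ (p - q) := by
    intro q
    exact (HasDerivAt.comp_const_sub (f := fun y => ρ (y, (p - q).2)) p.1 q.1
      (hasDerivAt_pdx (hρ.differentiable one_ne_zero (p - q)))).deriv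
  have ey : ∀ q, pdy (fun q => ρ (p - q)) q = - pdy ρ (p - q) := by
    intro q
    exact (HasDerivAt.comp_const_sub (f := fun y => ρ ((p - q).1, y)) p.2 q.2
      (hasDerivAt_pdy (hρ.differentiable one_ne_zero (p - q)))).deriv
  simp only [ex, ey] at hw
  have cx := continuous_pdx hρ
  have cy := continuous_pdy hρ
  have hco : HasCompactSupport (fderiv ℝ ρ) := (ker_compact hs).fderiv (𝕜 := ℝ)
  have bx : ∀ w : ℝ × ℝ, ∃ B, ∀ q, |fderiv ℝ ρ q w| ≤ B := fun w =>
    ⟨A / δ ^ 3 * ‖w‖, fun q => ((fderiv ℝ ρ q).le_opNorm w).trans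
      (mul_le_mul_of_nonneg_right (hA' q) (norm_nonneg _))⟩
  have hM0 : 0 ≤ M := (abs_nonneg _).trans (hM 0)
  have ix : Integrable fun q => v q * pdx ρ (p - q) := by
    obtain ⟨B, hB⟩ := bx (1, 0)
    apply ker_integrable (B := M * B) (δ := δ) (p := p)
      (hv.aestronglyMeasurable.mul (by fun_prop : Continuous fun q => pdx ρ (p - q)).aestronglyMeasurable)
    · intro q; rw [Pi.mul_apply, abs_mul, pdx_eq_fderiv (hρ.differentiable one_ne_zero _)]
      exact mul_le_mul (hM q) (hB _) (abs_nonneg _) hM0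
    · intro q hq
      rw [Pi.mul_apply, pdx_eq_fderiv (hρ.differentiable one_ne_zero _), ker_fderiv_zero hs hq]; simp
  have iy : Integrable fun q => v q * pdy ρ (p - q) := by
    obtain ⟨B, hB⟩ := bx (0, 1)
    apply ker_integrable (B := M * B) (δ := δ) (p := p)
      (hv.aestronglyMeasurable.mul (by fun_prop : Continuous fun q => pdy ρ (p - q)).aestronglyMeasurable)
    · intro q; rw [Pi.mul_apply, abs_mul, pdy_eq_fderiv (hρ.differentiable one_ne_zero _)]
      exact mul_le_mul (hM q) (hB _) (abs_nonneg _) hM0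
    · intro q hq
      rw [Pi.mul_apply, pdy_eq_fderiv (hρ.differentiable one_ne_zero _), ker_fderiv_zero hs hq]; simp
  have ik : Integrable fun q => v q * ((c p - c q) * pdy ρ (p - q) + pdy c q * ρ (p - q)) := by
    apply ker_integrable (B := M * (2 * L * A / δ ^ 2)) (δ := δ) (p := p) (hv.aestronglyMeasurable.mul k1)
    · intro q; rw [Pi.mul_apply, abs_mul]; exact mul_le_mul (hM q) (k2 _) (abs_nonneg _) hM0
    · intro q hq; rw [Pi.mul_apply, k3 q hq, mul_zero]
  have e : pdx (mol v ρ) p + c p * pdy (mol v ρ) p =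
      ∫ q, v q * ((c p - c q) * pdy ρ (p - q) + pdy c q * ρ (p - q)) := by
    have isum : Integrable fun a => v a * pdx ρ (p - a) + c p * (v a * pdy ρ (p - a)) :=
      ix.add (iy.const_mul _)
    rw [m1, m2, ← integral_const_mul, ← integral_add ix (iy.const_mul _), eq_comm, ← sub_eq_zero,
      ← integral_sub ik isum, ← hw]
    congr 1; ext q
    ring
  rw [e]
  exact h.trans (le_of_eq (by ring))
end


open Real Set MeasureTheory Filter Topology

lemma energy_smooth {u c : ℝ × ℝ → ℝ} {θ K : ℝ → ℝ} {L : NNReal} {a b m : ℝ} (hm : 0 < m) (hab : a ≤ b)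
    (hu : ContDiff ℝ 1 u) (hc : LipschitzWith L c) (hθ : ContDiff ℝ 1 θ) (hθ0 : ∀ x, 0 ≤ θ x)
    (hθK : ∀ x ∈ Ioo a b, deriv θ x = -K x * θ x)
    (hcK : ∀ p ∈ Ioo a b ×ˢ Ioo (-m) m, pdy c p ≤ K p.1)
    (hup : ∀ x, u (x, m) = u (x, -m)) (hcp : ∀ x ∈ Icc a b, c (x, m) = c (x, -m)) :
    (∫ y in (-m)..m, (θ b * u (b, y) ^ 2 - θ a * u (a, y) ^ 2)) ≤
      ∫ p in Ioo a b ×ˢ Ioo (-m) m, 2 * θ p.1 * (|u p| * |pdx u p + c p * pdy u p|) := by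
  have cu := hu.continuous
  have cc := hc.continuous
  have cθ := hθ.continuous
  have cx := continuous_pdx hu
  have cy := continuous_pdy hu
  have hθ2 : ContDiff ℝ 1 (fun p : ℝ × ℝ => θ p.1) := hθ.comp contDiff_fst
  have hP1 : ContDiff ℝ 1 (fun p : ℝ × ℝ => θ p.1 * u p ^ 2) := hθ2.mul (hu.pow 2)
  have lP : LocallyLipschitz (fun p : ℝ × ℝ => θ p.1 * u p ^ 2) := hP1.locallyLipschitz
  have lR : LocallyLipschitz (fun p : ℝ × ℝ => (θ p.1 * u p ^ 2) * c p) := locLip_mul lP hc.locallyLipschitz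
  obtain ⟨L1, hL1⟩ := locLip_rect lP a b (-m) m
  obtain ⟨L2, hL2⟩ := locLip_rect lR a b (-m) m
  obtain ⟨i1, i2, e⟩ := div_rect hL1 hL2 hab (by linarith)
  have e0 : ∫ x in a..b, (θ x * u (x, m) ^ 2 * c (x, m) - θ x * u (x, -m) ^ 2 * c (x, -m)) = 0 := by
    rw [intervalIntegral.integral_congr (g := fun _ => 0)]
    · simp
    · intro x hx
      rw [uIcc_of_le hab] at hx
      simp only [hup x, hcp x hx, sub_self]
  simp only at e
  rw [e0, add_zero] at e
  rw [← e]
  apply integral_mono_ae (i1.add i2)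
  · obtain ⟨M, -, hM⟩ := cont_bdd_rect (f := fun p : ℝ × ℝ => 2 * θ p.1 * (|u p| * |pdx u p + c p * pdy u p|))
      (by fun_prop) a b (-m) m
    apply integrableOn_rect_of_bdd' (M := M) (by fun_prop)
    exact fun p hp => hM p ⟨Ioo_subset_Icc_self hp.1, Ioo_subset_Icc_self hp.2⟩
  · filter_upwards [ae_restrict_of_ae hc.ae_differentiableAt,
      ae_restrict_mem (measurableSet_Ioo.prod measurableSet_Ioo)] with p hd hp
    have dux := hasDerivAt_pdx (hu.differentiable one_ne_zero p)
    have duy := hasDerivAt_pdy (hu.differentiable one_ne_zero p)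
    have dcy := hasDerivAt_pdy hd
    have dθ := (hθ.differentiable one_ne_zero p.1).hasDerivAt
    have eP : pdx (fun p : ℝ × ℝ => θ p.1 * u p ^ 2) p = _ := (dθ.mul (dux.pow 2)).deriv
    have eR : pdy (fun p : ℝ × ℝ => (θ p.1 * u p ^ 2) * c p) p = _ :=
      (((duy.pow 2).const_mul (θ p.1)).mul dcy).deriv
    show pdx (fun p : ℝ × ℝ => θ p.1 * u p ^ 2) p + pdy (fun p : ℝ × ℝ => (θ p.1 * u p ^ 2) * c p) p ≤ _
    rw [eP, eR, hθK p.1 hp.1]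
    simp only [Pi.pow_apply, Prod.mk.eta, Nat.cast_ofNat]
    have h1 := hcK p hp
    have h2 : u p * (pdx u p + c p * pdy u p) ≤ |u p| * |pdx u p + c p * pdy u p| := by
      rw [← abs_mul]; exact le_abs_self _
    have h3 := mul_le_mul_of_nonneg_left h2 (hθ0 p.1)
    have h4 : 0 ≤ (K p.1 - pdy c p) * (θ p.1 * u p ^ 2) :=
      mul_nonneg (by linarith) (mul_nonneg (hθ0 _) (sq_nonneg _))
    simp only [Nat.add_one_sub_one, pow_one, Nat.reduceSub]
    nlinarith [h3, h4]

lemma theta_exists {a b C s : ℝ} (ha : 0 < a) (hab : a ≤ b) (hb : b ≤ 1) (hC : 0 < C) (hs : 0 < s) :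
    ∃ θ : ℝ → ℝ, ContDiff ℝ 1 θ ∧ (∀ x, 0 ≤ θ x) ∧ (∀ x ∈ Ioo a b, deriv θ x = -(C * x ^ (s - 1)) * θ x) ∧
      θ a = 1 ∧ Real.exp (-(C / s)) ≤ θ b ∧ (∀ x ∈ Ioo a b, θ x ≤ 1) := by
  set k : ℝ → ℝ := fun t => C * (max t a) ^ (s - 1) with hk
  have kc : Continuous k := by
    apply Continuous.mul continuous_const
    apply Continuous.rpow_const (by fun_prop)
    intro x; left; exact (lt_of_lt_of_le ha (le_max_right _ _)).ne'
  have kp : ∀ x, 0 ≤ k x := fun x => by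
    have : 0 < max x a := lt_of_lt_of_le ha (le_max_right _ _)
    positivity
  have hd : ∀ x, HasDerivAt (fun x => Real.exp (-(∫ t in a..x, k t)))
      (Real.exp (-(∫ t in a..x, k t)) * (-k x)) x := fun x =>
    (kc.integral_hasStrictDerivAt a x).hasDerivAt.neg.exp
  have dc : Differentiable ℝ (fun x => Real.exp (-(∫ t in a..x, k t))) := fun x => (hd x).differentiableAt
  refine ⟨fun x => Real.exp (-(∫ t in a..x, k t)), ?_, fun x => (Real.exp_pos _).le, ?_, by simp, ?_, ?_⟩
  · rw [contDiff_one_iff_deriv]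
    refine ⟨dc, ?_⟩
    have : deriv (fun x => Real.exp (-(∫ t in a..x, k t))) = fun x => Real.exp (-(∫ t in a..x, k t)) * (-k x) :=
      funext fun x => (hd x).deriv
    rw [this]
    exact dc.continuous.mul kc.neg
  · intro x hx
    rw [(hd x).deriv]
    have : k x = C * x ^ (s - 1) := by simp only [hk]; rw [max_eq_left hx.1.le]
    rw [this]; ring
  · apply Real.exp_le_exp.2
    have : ∫ t in a..b, k t = ∫ t in a..b, C * t ^ (s - 1) := by
      apply intervalIntegral.integral_congr
      intro t ht
      rw [uIcc_of_le hab] at ht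
      simp only [hk]; rw [max_eq_left ht.1]
    rw [this, intervalIntegral.integral_const_mul, integral_rpow (Or.inl (by linarith))]
    rw [show s - 1 + 1 = s by ring]
    have h1 : b ^ s ≤ 1 := Real.rpow_le_one (ha.le.trans hab) hb hs.le
    have h2 : 0 ≤ a ^ s := Real.rpow_nonneg ha.le _
    have : C * ((b ^ s - a ^ s) / s) ≤ C / s := by
      rw [mul_div_assoc']
      apply div_le_div_of_nonneg_right _ hs.le
      nlinarith
    linarith
  · intro x hx
    apply Real.exp_le_one_iff.2
    have : 0 ≤ ∫ t in a..x, k t := intervalIntegral.integral_nonneg hx.1.le fun t _ => kp t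
    linarith

lemma mol_periodic {v ρ : ℝ × ℝ → ℝ} {m : ℝ} (hp : ∀ x y, v (x, y + 2 * m) = v (x, y)) (x y : ℝ) :
    mol v ρ (x, y + 2 * m) = mol v ρ (x, y) := by
  unfold mol
  rw [← integral_add_right_eq_self (fun q => v q * ρ ((x, y + 2 * m) - q)) ((0 : ℝ), 2 * m)]
  congr 1; ext q
  have e1 : v (q + (0, 2 * m)) = v q := by
    have := hp q.1 q.2
    rw [show q + (0, 2 * m) = (q.1, q.2 + 2 * m) by ext <;> simp]
    exact this
  rw [e1]
  congr 2
  ext <;> simp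

/-- the weak transport equation on the doubled strip -/
def WeakV (ζ m : ℝ) (c v : ℝ × ℝ → ℝ) : Prop :=
  ∀ ω : ℝ × ℝ → ℝ, ContDiff ℝ 1 ω → ∀ a b : ℝ, 0 < a → b < ζ → (∀ q : ℝ × ℝ, q.1 ∉ Icc a b → ω q = 0) →
    (∀ q : ℝ × ℝ, q.2 ∉ Icc (-(2 * m)) (2 * m) → ω q = 0) →
    ∫ q, v q * (pdx ω q + c q * pdy ω q + pdy c q * ω q) = 0

section
variable {ζ m κ s c1 c2 C : ℝ} {c : ℝ × ℝ → ℝ}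

lemma energy_ineq (H : Coef ζ m κ s c1 c2 C c) (hc1 : 0 < c1) (hc2 : 0 < c2) (hC : 0 < C) (hm : 0 < m)
    (hζ1 : ζ ≤ 1) (hκ : 1 ≤ κ) (hs : 0 < s) {v : ℝ × ℝ → ℝ} {M : ℝ}
    (hv : Measurable v) (hM : ∀ p, |v p| ≤ M) (hp : ∀ x y, v (x, y + 2 * m) = v (x, y))
    (hw : WeakV ζ m c v) :
    ∃ good : ℝ → Prop, (∀ᵐ x, good x) ∧ ∀ a b, good a → good b → 0 < a → a < b → b < ζ →
      Real.exp (-(C / s)) * (∫ y in (-m)..m, v (b, y) ^ 2) ≤ ∫ y in (-m)..m, v (a, y) ^ 2 := by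
  obtain ⟨A, hA, hker⟩ := kernel_exists
  set d : ℕ → ℝ := fun n => 1 / ((n : ℝ) + 1) with hd
  have d0 : ∀ n, 0 < d n := fun n => by simp only [hd]; positivity
  have dlim : Tendsto d atTop (𝓝 0) := tendsto_one_div_add_atTop_nhds_zero_nat
  choose ρ r1 r2 r3 r4 r5 using fun n => hker (d n) (d0 n)
  have hosc := osc_tendsto hv hM d0 dlim
  refine ⟨fun x => ∀ᵐ y, Tendsto (fun n => osc v (d n) (x, y) / d n ^ 2) atTop (𝓝 0), ?_, ?_⟩
  · rw [Measure.volume_eq_prod] at hosc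
    exact Measure.ae_ae_of_ae_prod hosc
  intro a b ga gb ha hab hb
  obtain ⟨L, hL⟩ := H.lip hc1 hc2 hC hκ hζ1 (half_pos ha)
  obtain ⟨c', hc', ec⟩ := hL.extend_real
  obtain ⟨θ, t1, t2, t3, t4, t5, t6⟩ := theta_exists ha hab.le (by linarith) hC hs
  have hM0 : 0 ≤ M := (abs_nonneg _).trans (hM 0)
  set u : ℕ → ℝ × ℝ → ℝ := fun n => mol v (ρ n) with hu
  have u1 : ∀ n, ContDiff ℝ 1 (u n) := fun n => (mol_props hv hM (r1 n) (r2 n)).1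
  have uv : ∀ n p, |u n p - v p| ≤ A * (osc v (d n) p / d n ^ 2) := fun n p =>
    mol_sub_le hv hM (r1 n) (d0 n) (r2 n) (r3 n) (r4 n) p
  have ub : ∀ n p, |u n p| ≤ M + A * (8 * M) := by
    intro n p
    have h1 := uv n p
    have h2 := mul_le_mul_of_nonneg_left (osc_le hv hM (d0 n) p) hA.le
    have h3 := abs_add_le (u n p - v p) (v p)
    rw [sub_add_cancel] at h3
    linarith [hM p]
  have ulim : ∀ p, Tendsto (fun n => osc v (d n) p / d n ^ 2) atTop (𝓝 0) →
      Tendsto (fun n => u n p) atTop (𝓝 (v p)) := by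
    intro p h
    rw [tendsto_iff_dist_tendsto_zero]
    have h2 := h.const_mul A
    rw [mul_zero] at h2
    exact squeeze_zero (fun _ => dist_nonneg) (fun n => uv n p) h2
  have eN : ∀ᶠ n in atTop, d n < min (a / 2) (min ((ζ - b) / 2) m) :=
    dlim.eventually_lt_const (lt_min (half_pos ha) (lt_min (by linarith) hm))
  -- the mollified equation
  have hr : ∀ᶠ n in atTop, ∀ p ∈ Icc a b ×ˢ Icc (-m) m,
      |pdx (u n) p + c' p * pdy (u n) p| ≤ 2 * L * A * (osc v (d n) p / d n ^ 2) := by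
    filter_upwards [eN] with n hn p hpm
    have n1 : d n < a / 2 := hn.trans_le (min_le_left _ _)
    have n2 : d n < (ζ - b) / 2 := hn.trans_le ((min_le_right _ _).trans (min_le_left _ _))
    have n3 : d n < m := hn.trans_le ((min_le_right _ _).trans (min_le_right _ _))
    apply mol_eqn hv hM (r1 n) (d0 n) (r2 n) hc' (r4 n) (r5 n)
    have hω : ContDiff ℝ 1 (fun q => ρ n (p - q)) := (r1 n).comp (contDiff_const.sub contDiff_id)
    have z1 : ∀ q : ℝ × ℝ, q.1 ∉ Icc (a - d n) (b + d n) → ρ n (p - q) = 0 := by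
      intro q hq
      apply r2
      by_contra h
      push Not at h
      have h1 := (norm_fst_le (p - q)).trans h
      rw [norm_eq_abs, abs_le, Prod.fst_sub] at h1
      exact hq ⟨by linarith [hpm.1.1], by linarith [hpm.1.2]⟩
    have z2 : ∀ q : ℝ × ℝ, q.2 ∉ Icc (-(2 * m)) (2 * m) → ρ n (p - q) = 0 := by
      intro q hq
      apply r2
      by_contra h
      push Not at h
      have h1 := (norm_snd_le (p - q)).trans h
      rw [norm_eq_abs, abs_le, Prod.snd_sub] at h1
      exact hq ⟨by linarith [hpm.2.1], by linarith [hpm.2.2]⟩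
    have := hw _ hω (a - d n) (b + d n) (by linarith) (by linarith) z1 z2
    rw [← this]
    congr 1; ext q
    by_cases hq : q.1 ∈ Icc (a - d n) (b + d n)
    · have q1 : a / 2 < q.1 := by linarith [hq.1]
      have q2 : q.1 < ζ := by linarith [hq.2]
      have e1 : c' q = c q := (ec ⟨⟨q1.le, q2.le⟩, mem_univ _⟩).symm
      have e2 : pdy c' q = pdy c q := by
        apply pdy_congr (a := a / 2) (b := ζ) (c := q.2 - 1) (d := q.2 + 1)
        · intro z hz; exact (ec ⟨hz.1, mem_univ _⟩).symm
        · exact ⟨⟨q1, q2⟩, ⟨by linarith, by linarith⟩⟩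
      rw [e1, e2]
    · have ez : (fun q => ρ n (p - q)) =ᶠ[𝓝 q] fun _ => 0 := by
        have : IsOpen {q : ℝ × ℝ | q.1 ∉ Icc (a - d n) (b + d n)} :=
          (isClosed_Icc.preimage continuous_fst).isOpen_compl
        filter_upwards [this.mem_nhds hq] with z hz using z1 z hz
      rw [pdx_eventuallyEq ez, pdy_eventuallyEq ez, z1 q hq]
      simp [pdx, pdy]
  have hen : ∀ n, (∫ y in (-m)..m, (θ b * u n (b, y) ^ 2 - θ a * u n (a, y) ^ 2)) ≤
      ∫ p in Ioo a b ×ˢ Ioo (-m) m, 2 * θ p.1 * (|u n p| * |pdx (u n) p + c' p * pdy (u n) p|) := by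
    intro n
    apply energy_smooth (K := fun x => C * x ^ (s - 1)) hm hab.le (u1 n) hc' t1 t2 t3
    · intro p hpp
      have e2 : pdy c' p = pdy c p := by
        apply pdy_congr (a := a / 2) (b := ζ) (c := p.2 - 1) (d := p.2 + 1)
        · intro z hz; exact (ec ⟨hz.1, mem_univ _⟩).symm
        · exact ⟨⟨by linarith [hpp.1.1], by linarith [hpp.1.2]⟩, ⟨by linarith, by linarith⟩⟩
      rw [e2]
      exact (le_abs_self _).trans (H.pdy_abs_le hC (by linarith [hpp.1.1]) (by linarith [hpp.1.2]))
    · intro x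
      have := mol_periodic (ρ := ρ n) hp x (-m)
      rw [show -m + 2 * m = m by ring] at this
      exact this
    · intro x hx
      have hx' : x ∈ Icc (a / 2) ζ := ⟨by linarith [hx.1], by linarith [hx.2]⟩
      rw [← ec ⟨hx', mem_univ _⟩, ← ec ⟨hx', mem_univ _⟩, H.even]
  -- limits
  have lslice : ∀ x, (∀ᵐ y, Tendsto (fun n => osc v (d n) (x, y) / d n ^ 2) atTop (𝓝 0)) →
      Tendsto (fun n => ∫ y in (-m)..m, u n (x, y) ^ 2) atTop (𝓝 (∫ y in (-m)..m, v (x, y) ^ 2)) := by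
    intro x hx
    apply intervalIntegral.tendsto_integral_filter_of_dominated_convergence (fun _ => (M + A * (8 * M)) ^ 2)
    · refine Eventually.of_forall fun n => ?_
      have := (u1 n).continuous
      exact (by fun_prop : Continuous fun y => u n (x, y) ^ 2).aestronglyMeasurable
    · refine Eventually.of_forall fun n => Eventually.of_forall fun y _ => ?_
      rw [norm_eq_abs, abs_pow]
      exact pow_le_pow_left₀ (abs_nonneg _) (ub n _) 2
    · exact intervalIntegrable_const
    · filter_upwards [hx] with y hy _
      exact (ulim _ hy).pow 2
  have lrect : Tendsto (fun n => ∫ p in Ioo a b ×ˢ Ioo (-m) m,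
      2 * θ p.1 * (|u n p| * |pdx (u n) p + c' p * pdy (u n) p|)) atTop (𝓝 0) := by
    have : Tendsto (fun n => ∫ p in Ioo a b ×ˢ Ioo (-m) m,
      2 * θ p.1 * (|u n p| * |pdx (u n) p + c' p * pdy (u n) p|)) atTop
      (𝓝 (∫ p in Ioo a b ×ˢ Ioo (-m) m, (0 : ℝ))) := by
      have key : ∀ n, ∀ p ∈ Ioo a b ×ˢ Ioo (-m) m,
          |pdx (u n) p + c' p * pdy (u n) p| ≤ 2 * L * A * (osc v (d n) p / d n ^ 2) →
          |2 * θ p.1 * (|u n p| * |pdx (u n) p + c' p * pdy (u n) p|)| ≤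
            2 * ((M + A * (8 * M)) * (2 * L * A)) * (osc v (d n) p / d n ^ 2) := by
        intro n p hp h
        have o0 := osc_nonneg v (d n) p
        have h0 := t2 p.1
        rw [abs_of_nonneg (by positivity)]
        have h1 : |u n p| * |pdx (u n) p + c' p * pdy (u n) p| ≤
          (M + A * (8 * M)) * (2 * L * A * (osc v (d n) p / d n ^ 2)) :=
          mul_le_mul (ub n p) h (abs_nonneg _) (by positivity)
        have h2 : 2 * θ p.1 * (|u n p| * |pdx (u n) p + c' p * pdy (u n) p|) ≤
            2 * (|u n p| * |pdx (u n) p + c' p * pdy (u n) p|) :=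
          mul_le_mul_of_nonneg_right (by linarith [t6 p.1 hp.1]) (by positivity)
        linarith
      apply tendsto_integral_filter_of_dominated_convergence
        (fun _ => 2 * ((M + A * (8 * M)) * (2 * L * A)) * (8 * M))
      · refine Eventually.of_forall fun n => ?_
        have g1 := (u1 n).continuous
        have g2 := continuous_pdx (u1 n)
        have g3 := continuous_pdy (u1 n)
        have g4 := hc'.continuous
        have g5 := t1.continuous
        exact (by fun_prop : Continuous fun p : ℝ × ℝ =>
          2 * θ p.1 * (|u n p| * |pdx (u n) p + c' p * pdy (u n) p|)).aestronglyMeasurable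
      · filter_upwards [hr] with n hn
        filter_upwards [ae_restrict_mem (measurableSet_Ioo.prod measurableSet_Ioo)] with p hp
        refine (key n p hp (hn p ⟨Ioo_subset_Icc_self hp.1, Ioo_subset_Icc_self hp.2⟩)).trans ?_
        exact mul_le_mul_of_nonneg_left (osc_le hv hM (d0 n) p) (by positivity)
      · exact integrableOn_const (volume_rect_lt_top a b (-m) m).ne
      · filter_upwards [ae_restrict_of_ae hosc, ae_restrict_mem (measurableSet_Ioo.prod measurableSet_Ioo)] with p ho hp
        have h2 := ho.const_mul (2 * ((M + A * (8 * M)) * (2 * L * A)))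
        rw [mul_zero] at h2
        apply squeeze_zero_norm' _ h2
        filter_upwards [hr] with n hn
        exact key n p hp (hn p ⟨Ioo_subset_Icc_self hp.1, Ioo_subset_Icc_self hp.2⟩)
    rw [integral_zero] at this
    exact this
  have hfin : ∀ n, θ b * (∫ y in (-m)..m, u n (b, y) ^ 2) - θ a * (∫ y in (-m)..m, u n (a, y) ^ 2) ≤
      ∫ p in Ioo a b ×ˢ Ioo (-m) m, 2 * θ p.1 * (|u n p| * |pdx (u n) p + c' p * pdy (u n) p|) := by
    intro n
    have g1 := (u1 n).continuous
    rw [← intervalIntegral.integral_const_mul, ← intervalIntegral.integral_const_mul, ← intervalIntegral.integral_sub]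
    · exact hen n
    · exact (by fun_prop : Continuous fun y => θ b * u n (b, y) ^ 2).intervalIntegrable _ _
    · exact (by fun_prop : Continuous fun y => θ a * u n (a, y) ^ 2).intervalIntegrable _ _
  have := le_of_tendsto_of_tendsto' (((lslice b gb).const_mul (θ b)).sub ((lslice a ga).const_mul (θ a))) lrect hfin
  rw [t4, one_mul] at this
  have e0 : 0 ≤ ∫ y in (-m)..m, v (b, y) ^ 2 :=
    intervalIntegral.integral_nonneg (by linarith) fun y _ => sq_nonneg _
  have := mul_le_mul_of_nonneg_right t5 e0
  linarith
end


open Real Set MeasureTheory Filter Topology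

lemma strip_map (e : ℝ ≃ᵐ ℝ) (he : MeasurePreserving e volume volume) (S T T' : Set ℝ) (hT : e ⁻¹' T = T')
    (I : ℝ × ℝ → ℝ) : ∫ p in S ×ˢ T, I p = ∫ p in S ×ˢ T', I (p.1, e p.2) := by
  have h := (MeasurePreserving.id (volume : Measure ℝ)).prod he
  have := h.setIntegral_preimage_emb
    ((MeasurableEquiv.refl ℝ).prodCongr e).measurableEmbedding I (S ×ˢ T)
  rw [Measure.volume_eq_prod, ← this]
  have e1 : Prod.map id e ⁻¹' (S ×ˢ T) = S ×ˢ T' := by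
    rw [← hT]; rfl
  rw [e1]
  rfl

lemma strip_split {I : ℝ × ℝ → ℝ} {S : Set ℝ} (hS : MeasurableSet S) {y0 y1 y2 : ℝ} (h1 : y0 < y1) (h2 : y1 < y2)
    (hI : IntegrableOn I (S ×ˢ Ioo y0 y2)) :
    ∫ p in S ×ˢ Ioo y0 y2, I p = (∫ p in S ×ˢ Ioo y0 y1, I p) + ∫ p in S ×ˢ Ioo y1 y2, I p := by
  have e : (S ×ˢ Ioo y0 y2 : Set (ℝ × ℝ)) =ᵐ[volume] (S ×ˢ (Ioo y0 y1 ∪ Ioo y1 y2) : Set (ℝ × ℝ)) := by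
    rw [Measure.volume_eq_prod]
    apply Measure.set_prod_ae_eq (ae_eq_refl _)
    rw [← Ioo_union_Ico_eq_Ioo h1 h2.le]
    exact (ae_eq_refl _).union Ioo_ae_eq_Ico.symm
  rw [setIntegral_congr_set e, prod_union, setIntegral_union]
  · rw [disjoint_left]
    rintro p hp hq
    exact absurd hp.2.2 (not_lt.2 hq.2.1.le)
  · exact hS.prod measurableSet_Ioo
  · exact hI.mono_set (prod_mono subset_rfl (Ioo_subset_Ioo le_rfl h2.le))
  · exact hI.mono_set (prod_mono subset_rfl (Ioo_subset_Ioo h1.le le_rfl))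

section
variable {ζ m κ s c1 c2 C : ℝ} {c : ℝ × ℝ → ℝ}

lemma supp_eventually {ω : ℝ × ℝ → ℝ} {a b : ℝ} (h : ∀ q : ℝ × ℝ, q.1 ∉ Icc a b → ω q = 0) {q : ℝ × ℝ}
    (hq : q.1 ∉ Icc a b) : ω =ᶠ[𝓝 q] fun _ => 0 := by
  have : IsOpen {q : ℝ × ℝ | q.1 ∉ Icc a b} := (isClosed_Icc.preimage continuous_fst).isOpen_compl
  filter_upwards [this.mem_nhds hq] with z hz using h z hz

lemma supp_eventually' {ω : ℝ × ℝ → ℝ} {a b : ℝ} (h : ∀ q : ℝ × ℝ, q.2 ∉ Icc a b → ω q = 0) {q : ℝ × ℝ}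
    (hq : q.2 ∉ Icc a b) : ω =ᶠ[𝓝 q] fun _ => 0 := by
  have : IsOpen {q : ℝ × ℝ | q.2 ∉ Icc a b} := (isClosed_Icc.preimage continuous_snd).isOpen_compl
  filter_upwards [this.mem_nhds hq] with z hz using h z hz

lemma pd_zero {ω : ℝ × ℝ → ℝ} {q : ℝ × ℝ} (h : ω =ᶠ[𝓝 q] fun _ => 0) : pdx ω q = 0 ∧ pdy ω q = 0 ∧ ω q = 0 := by
  rw [pdx_eventuallyEq h, pdy_eventuallyEq h]
  exact ⟨by simp [pdx], by simp [pdy], h.self_of_nhds⟩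

lemma test_integrable (H : Coef ζ m κ s c1 c2 C c) (hc1 : 0 < c1) (hc2 : 0 < c2) (hC : 0 < C)
    (hζ : 0 < ζ) (hζ1 : ζ ≤ 1) (hκ : 1 ≤ κ) (hs : 0 < s) (σ y0 y1 : ℝ) {f ω : ℝ × ℝ → ℝ} {M : ℝ}
    (hf : Measurable f) (hM : ∀ p ∈ Ioo 0 ζ ×ˢ Ioo y0 y1, |f p| ≤ M) (hω : ContDiff ℝ 1 ω) {a b : ℝ} (ha : 0 < a) (hb : b < ζ)
    (h0 : ∀ q : ℝ × ℝ, q.1 ∉ Icc a b → ω q = 0) :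
    IntegrableOn (fun q => f q * (pdx ω q + σ * (c q * pdy ω q) + σ * (pdy c q * ω q))) (Ioo 0 ζ ×ˢ Ioo y0 y1) := by
  have cω := hω.continuous
  have cx := continuous_pdx hω
  have cy := continuous_pdy hω
  have sub : Ioo (0 : ℝ) ζ ×ˢ Ioo y0 y1 ⊆ Ioc 0 ζ ×ˢ univ := prod_mono Ioo_subset_Ioc_self (subset_univ _)
  have ms : MeasurableSet (Ioo (0 : ℝ) ζ ×ˢ Ioo y0 y1) := measurableSet_Ioo.prod measurableSet_Ioo
  have m1 := H.pdy_meas hc1 hC hζ hζ1 hκ hs ms sub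
  have m2 : AEStronglyMeasurable c (volume.restrict (Ioo 0 ζ ×ˢ Ioo y0 y1)) :=
    ((H.continuousOn hc1 hC hζ hζ1 hκ hs).mono sub).aestronglyMeasurable ms
  obtain ⟨B0, b0, hB0⟩ := cont_bdd_rect cω 0 ζ y0 y1
  obtain ⟨B1, b1, hB1⟩ := cont_bdd_rect cx 0 ζ y0 y1
  obtain ⟨B2, b2, hB2⟩ := cont_bdd_rect cy 0 ζ y0 y1
  obtain ⟨D, hD⟩ := (isCompact_Icc (a := a) (b := b)).exists_bound_of_continuousOn
    (f := fun x : ℝ => x ^ (s - 1)) (fun x hx => (Real.continuousAt_rpow_const _ _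
      (Or.inl (lt_of_lt_of_le ha hx.1).ne')).continuousWithinAt)
  obtain ⟨E, hE⟩ := (isCompact_Icc (a := a) (b := b)).exists_bound_of_continuousOn
    (f := fun x : ℝ => x ^ (-κ)) (fun x hx => (Real.continuousAt_rpow_const _ _
      (Or.inl (lt_of_lt_of_le ha hx.1).ne')).continuousWithinAt)
  apply integrableOn_rect_of_bdd' (M := |M| * (B1 + |σ| * (|c2 * E| * B2) + |σ| * (|C * D| * B0)))
  · exact hf.aestronglyMeasurable.mul ((cx.aestronglyMeasurable.add
      ((m2.mul cy.aestronglyMeasurable).const_mul σ)).add ((m1.mul cω.aestronglyMeasurable).const_mul σ))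
  · intro p hp
    by_cases hq : p.1 ∈ Icc a b
    · have hp' : p ∈ Icc 0 ζ ×ˢ Icc y0 y1 := ⟨Ioo_subset_Icc_self hp.1, Ioo_subset_Icc_self hp.2⟩
      have k1 : |c p| ≤ |c2 * E| := by
        have h1 := H.hi p.1 p.2 hp.1.1 hp.1.2.le
        have h2 := H.pos hc1 p.2 hp.1.1 hp.1.2.le
        rw [Prod.mk.eta] at h1 h2
        rw [abs_of_pos h2]
        have h3 := (le_abs_self _).trans (hE p.1 hq)
        exact (h1.trans (mul_le_mul_of_nonneg_left h3 hc2.le)).trans (le_abs_self _)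
      have k2 : |pdy c p| ≤ |C * D| := by
        have h3 := (le_abs_self _).trans (hD p.1 hq)
        exact ((H.pdy_abs_le hC hp.1.1 hp.1.2.le).trans (mul_le_mul_of_nonneg_left h3 hC.le)).trans (le_abs_self _)
      rw [abs_mul]
      apply mul_le_mul ((hM p hp).trans (le_abs_self _)) _ (abs_nonneg _) (abs_nonneg _)
      refine (abs_add_le _ _).trans (add_le_add ((abs_add_le _ _).trans (add_le_add (hB1 p hp') ?_)) ?_)
      · rw [abs_mul, abs_mul]
        exact mul_le_mul_of_nonneg_left (mul_le_mul k1 (hB2 p hp') (abs_nonneg _) (abs_nonneg _)) (abs_nonneg _)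
      · rw [abs_mul, abs_mul]
        exact mul_le_mul_of_nonneg_left (mul_le_mul k2 (hB0 p hp') (abs_nonneg _) (abs_nonneg _)) (abs_nonneg _)
    · obtain ⟨z1, z2, z3⟩ := pd_zero (supp_eventually h0 hq)
      rw [z1, z2, z3]
      simp only [mul_zero, add_zero, abs_zero]
      positivity
end

/-- weak form for the pair, with test functions compactly supported in the first variable -/
def WeakWZ (ζ m : ℝ) (c w z : ℝ × ℝ → ℝ) : Prop :=
  ∀ ξ η : ℝ × ℝ → ℝ, ContDiff ℝ 1 ξ → ContDiff ℝ 1 η → ∀ a b : ℝ, 0 < a → b < ζ →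
    (∀ q : ℝ × ℝ, q.1 ∉ Icc a b → ξ q = 0) → (∀ q : ℝ × ℝ, q.1 ∉ Icc a b → η q = 0) →
    (∀ φ, ξ (φ, 0) = -η (φ, 0) ∧ ξ (φ, m) = -η (φ, m)) →
    (∫ p in Ioo 0 ζ ×ˢ Ioo 0 m, w p * (pdx ξ p + 1 * (c p * pdy ξ p) + 1 * (pdy c p * ξ p)))
    + (∫ p in Ioo 0 ζ ×ˢ Ioo 0 m, z p * (pdx η p + (-1) * (c p * pdy η p) + (-1) * (pdy c p * η p))) = 0

def vext (m : ℝ) (w z : ℝ × ℝ → ℝ) (p : ℝ × ℝ) : ℝ :=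
  if 0 < Real.sin (π * p.2 / m) then w (p.1, fold m p.2) else -z (p.1, fold m p.2)

lemma continuous_fold (m : ℝ) : Continuous (fold m) :=
  (LipschitzWith.of_dist_le_mul (K := 1) fun x y => by
    rw [Real.dist_eq, Real.dist_eq]; simpa using fold_lip m x y).continuous

section
variable {ζ m κ s c1 c2 C : ℝ} {c w z : ℝ × ℝ → ℝ}

lemma vext_meas (m : ℝ) (hw : Measurable w) (hz : Measurable z) : Measurable (vext m w z) := by
  have := continuous_fold m
  unfold vext
  apply Measurable.ite
  · exact measurableSet_lt measurable_const (by fun_prop)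
  · exact hw.comp (by fun_prop)
  · exact (hz.comp (by fun_prop)).neg

lemma vext_bdd {M : ℝ} (hw : ∀ p, |w p| ≤ M) (hz : ∀ p, |z p| ≤ M) (p : ℝ × ℝ) : |vext m w z p| ≤ M := by
  unfold vext
  split_ifs
  · exact hw _
  · rw [abs_neg]; exact hz _

lemma vext_per (hm : 0 < m) (x y : ℝ) : vext m w z (x, y + 2 * m) = vext m w z (x, y) := by
  unfold vext
  have : π * (y + 2 * m) / m = π * y / m + 2 * π := by field_simp
  simp only [this, Real.sin_add_two_pi, fold_add]

lemma vext_pos (hm : 0 < m) {x y : ℝ} (hy : y ∈ Ioo 0 m) : vext m w z (x, y) = w (x, y) := by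
  unfold vext
  have : 0 < Real.sin (π * y / m) := by
    apply Real.sin_pos_of_pos_of_lt_pi
    · have := hy.1; positivity
    · rw [div_lt_iff₀ hm]; exact mul_lt_mul_of_pos_left hy.2 Real.pi_pos
  simp only [this, if_true]
  rw [fold_of_mem hm (Ioo_subset_Icc_self hy)]

lemma vext_neg (hm : 0 < m) {x y : ℝ} (hy : y ∈ Ioo 0 m) : vext m w z (x, -y) = -z (x, y) := by
  unfold vext
  have : 0 < Real.sin (π * y / m) := by
    apply Real.sin_pos_of_pos_of_lt_pi
    · have := hy.1; positivity
    · rw [div_lt_iff₀ hm]; exact mul_lt_mul_of_pos_left hy.2 Real.pi_pos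
  have h2 : ¬ 0 < Real.sin (π * -y / m) := by
    rw [show π * -y / m = -(π * y / m) by ring, Real.sin_neg]; linarith
  simp only [h2, if_false]
  rw [fold_neg, fold_of_mem hm (Ioo_subset_Icc_self hy)]
end


open Real Set MeasureTheory Filter Topology
section
variable {ζ m κ s c1 c2 C : ℝ} {c w z : ℝ × ℝ → ℝ}

lemma Coef.pdy_per (H : Coef ζ m κ s c1 c2 C c) (x y : ℝ) : pdy c (x, y - 2 * m) = pdy c (x, y) := by
  have e : (fun t => c (x, t)) = fun t => c (x, t - 2 * m) := by
    ext t
    have := H.per x (t - 2 * m)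
    rw [sub_add_cancel] at this
    exact this
  show deriv (fun t => c (x, t)) (y - 2 * m) = deriv (fun t => c (x, t)) y
  conv_rhs => rw [e]
  rw [deriv_comp_sub_const (f := fun t => c (x, t))]

lemma Coef.pdy_odd (H : Coef ζ m κ s c1 c2 C c) (x y : ℝ) : pdy c (x, -y) = -pdy c (x, y) := by
  have e : (fun t => c (x, t)) = fun t => c (x, -t) := by
    ext t; rw [H.even]
  show deriv (fun t => c (x, t)) (-y) = -deriv (fun t => c (x, t)) y
  conv_rhs => rw [e]
  rw [deriv_comp_neg (f := fun t => c (x, t))]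
  simp

/-- the transport integrand -/
def tr (c v ω : ℝ × ℝ → ℝ) (q : ℝ × ℝ) : ℝ := v q * (pdx ω q + c q * pdy ω q + pdy c q * ω q)

lemma weakV_of_WZ (H : Coef ζ m κ s c1 c2 C c) (hc1 : 0 < c1) (hc2 : 0 < c2) (hC : 0 < C) (hm : 0 < m)
    (hζ : 0 < ζ) (hζ1 : ζ ≤ 1) (hκ : 1 ≤ κ) (hs : 0 < s) {M : ℝ} (hw : Measurable w) (hz : Measurable z)
    (hwM : ∀ p, |w p| ≤ M) (hzM : ∀ p, |z p| ≤ M) (h : WeakWZ ζ m c w z) : WeakV ζ m c (vext m w z) := by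
  intro ω hω a b ha hb h1 h2
  set v := vext m w z with hv
  have mv : Measurable v := vext_meas m hw hz
  have bv : ∀ p, |v p| ≤ M := vext_bdd hwM hzM
  have dω := hω.differentiable one_ne_zero
  set I := tr c v ω with hI
  show ∫ q, I q = 0
  -- boundary values of ω
  have hcl : ∀ x, ω (x, 2 * m) = 0 ∧ ω (x, -(2 * m)) = 0 := by
    intro x
    have cω : Continuous fun y => ω (x, y) := by have := hω.continuous; fun_prop
    constructor
    · have t : Tendsto (fun y => ω (x, y)) (𝓝[>] (2 * m)) (𝓝 (ω (x, 2 * m))) := (cω.tendsto _).mono_left nhdsWithin_le_nhds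
      refine tendsto_nhds_unique t (tendsto_const_nhds.congr' ?_)
      filter_upwards [self_mem_nhdsWithin] with y hy
      exact (h2 (x, y) (fun hh => absurd hh.2 (not_le.2 hy))).symm
    · have t : Tendsto (fun y => ω (x, y)) (𝓝[<] (-(2 * m))) (𝓝 (ω (x, -(2 * m)))) := (cω.tendsto _).mono_left nhdsWithin_le_nhds
      refine tendsto_nhds_unique t (tendsto_const_nhds.congr' ?_)
      filter_upwards [self_mem_nhdsWithin] with y hy
      exact (h2 (x, y) (fun hh => absurd hh.1 (not_le.2 hy))).symm
  have int : ∀ y0 y1, IntegrableOn I (Ioo 0 ζ ×ˢ Ioo y0 y1) := by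
    intro y0 y1
    have := test_integrable H hc1 hc2 hC hζ hζ1 hκ hs 1 y0 y1 mv (fun p _ => bv p) hω ha hb h1
    simp only [one_mul] at this
    exact this
  have e0 : ∫ q, I q = ∫ q in Ioo 0 ζ ×ˢ Ioo (-(3 * m)) (3 * m), I q := by
    symm
    apply setIntegral_eq_integral_of_forall_compl_eq_zero
    intro q hq
    have : ω =ᶠ[𝓝 q] fun _ => 0 := by
      by_cases hq1 : q.1 ∈ Icc a b
      · apply supp_eventually' h2
        intro hh
        exact hq ⟨⟨by linarith [hq1.1], by linarith [hq1.2]⟩, ⟨by linarith [hh.1], by linarith [hh.2]⟩⟩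
      · exact supp_eventually h1 hq1
    obtain ⟨z1, z2, z3⟩ := pd_zero this
    simp only [hI, tr, z1, z2, z3]; ring
  have zz : ∀ T : Set ℝ, MeasurableSet T → (∀ y ∈ T, y ∉ Icc (-(2 * m)) (2 * m)) → ∫ q in Ioo 0 ζ ×ˢ T, I q = 0 := by
    intro T hT hT2
    apply setIntegral_eq_zero_of_forall_eq_zero
    intro q hq
    obtain ⟨z1, z2, z3⟩ := pd_zero (supp_eventually' h2 (hT2 q.2 hq.2))
    simp only [hI, tr, z1, z2, z3]; ring
  have e1 : ∫ q, I q = (∫ q in Ioo 0 ζ ×ˢ Ioo (-(2 * m)) (-m), I q) + (∫ q in Ioo 0 ζ ×ˢ Ioo (-m) 0, I q)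
      + (∫ q in Ioo 0 ζ ×ˢ Ioo 0 m, I q) + ∫ q in Ioo 0 ζ ×ˢ Ioo m (2 * m), I q := by
    rw [e0, strip_split measurableSet_Ioo (y1 := -(2 * m)) (by linarith) (by linarith) (int _ _),
      zz _ measurableSet_Ioo (fun y hy hh => by linarith [hy.2, hh.1]), zero_add,
      strip_split measurableSet_Ioo (y1 := -m) (by linarith) (by linarith) (int _ _),
      strip_split measurableSet_Ioo (y0 := -m) (y1 := 0) (by linarith) (by linarith) (int _ _),
      strip_split measurableSet_Ioo (y0 := 0) (y1 := m) (by linarith) (by linarith) (int _ _),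
      strip_split measurableSet_Ioo (y0 := m) (y1 := 2 * m) (by linarith) (by linarith) (int _ _),
      zz (Ioo (2 * m) (3 * m)) measurableSet_Ioo (fun y hy hh => by linarith [hy.1, hh.2])]
    ring
  have s1 := strip_map (MeasurableEquiv.subRight (2 * m)) (measurePreserving_sub_right volume (2 * m)) (Ioo 0 ζ)
    (Ioo (-(2 * m)) (-m)) (Ioo 0 m) (by
      ext y; simp only [MeasurableEquiv.subRight, mem_preimage, mem_Ioo]
      show (-(2 * m) < y - 2 * m ∧ y - 2 * m < -m) ↔ _
      constructor <;> rintro ⟨h1, h2⟩ <;> constructor <;> linarith) I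
  have s2 := strip_map (MeasurableEquiv.neg ℝ) (Measure.measurePreserving_neg volume) (Ioo 0 ζ)
    (Ioo (-m) 0) (Ioo 0 m) (by
      ext y
      show (-m < -y ∧ -y < 0) ↔ (0 < y ∧ y < m)
      constructor <;> rintro ⟨h1, h2⟩ <;> constructor <;> linarith) I
  have s3 := strip_map (MeasurableEquiv.subLeft (2 * m)) (Measure.measurePreserving_sub_left volume (2 * m)) (Ioo 0 ζ)
    (Ioo m (2 * m)) (Ioo 0 m) (by
      ext y
      show (m < 2 * m - y ∧ 2 * m - y < 2 * m) ↔ (0 < y ∧ y < m)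
      constructor <;> rintro ⟨h1, h2⟩ <;> constructor <;> linarith) I
  replace s1 : _ = ∫ p in Ioo 0 ζ ×ˢ Ioo 0 m, I (p.1, p.2 - 2 * m) := s1
  replace s2 : _ = ∫ p in Ioo 0 ζ ×ˢ Ioo 0 m, I (p.1, -p.2) := s2
  replace s3 : _ = ∫ p in Ioo 0 ζ ×ˢ Ioo 0 m, I (p.1, 2 * m - p.2) := s3
  -- test functions
  set ω1 : ℝ × ℝ → ℝ := fun q => ω (q.1, q.2 - 2 * m) with hω1
  set ω2 : ℝ × ℝ → ℝ := fun q => -ω (q.1, -q.2) with hω2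
  set ω3 : ℝ × ℝ → ℝ := fun q => -ω (q.1, 2 * m - q.2) with hω3
  have k1 : ContDiff ℝ 1 ω1 := hω.comp (by fun_prop : ContDiff ℝ 1 fun q : ℝ × ℝ => (q.1, q.2 - 2 * m))
  have k2 : ContDiff ℝ 1 ω2 := (hω.comp (by fun_prop : ContDiff ℝ 1 fun q : ℝ × ℝ => (q.1, -q.2))).neg
  have k3 : ContDiff ℝ 1 ω3 := (hω.comp (by fun_prop : ContDiff ℝ 1 fun q : ℝ × ℝ => (q.1, 2 * m - q.2))).neg
  have n1 : ∀ q : ℝ × ℝ, q.1 ∉ Icc a b → ω1 q = 0 := fun q hq => h1 _ hq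
  have n2 : ∀ q : ℝ × ℝ, q.1 ∉ Icc a b → ω2 q = 0 := fun q hq => by simp only [hω2]; rw [h1 (q.1, -q.2) hq, neg_zero]
  have n3 : ∀ q : ℝ × ℝ, q.1 ∉ Icc a b → ω3 q = 0 := fun q hq => by simp only [hω3]; rw [h1 (q.1, 2 * m - q.2) hq, neg_zero]
  have key := h (fun q => ω q + ω1 q) (fun q => ω2 q + ω3 q) (hω.add k1) (k2.add k3) a b ha hb
    (fun q hq => by rw [h1 q hq, n1 q hq, add_zero]) (fun q hq => by rw [n2 q hq, n3 q hq, add_zero]) (by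
      intro x
      have := hcl x
      constructor
      · simp only [hω1, hω2, hω3]
        simp [this.1, this.2]
      · simp only [hω1, hω2, hω3, show m - 2 * m = -m by ring, show 2 * m - m = m by ring]
        ring)
  have xadd : ∀ f g : ℝ × ℝ → ℝ, ContDiff ℝ 1 f → ContDiff ℝ 1 g → ∀ p, pdx (fun q => f q + g q) p = pdx f p + pdx g p :=
    fun f g hf hg p => ((hasDerivAt_pdx (hf.differentiable one_ne_zero p)).add (hasDerivAt_pdx (hg.differentiable one_ne_zero p))).deriv
  have yadd : ∀ f g : ℝ × ℝ → ℝ, ContDiff ℝ 1 f → ContDiff ℝ 1 g → ∀ p, pdy (fun q => f q + g q) p = pdy f p + pdy g p :=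
    fun f g hf hg p => ((hasDerivAt_pdy (hf.differentiable one_ne_zero p)).add (hasDerivAt_pdy (hg.differentiable one_ne_zero p))).deriv
  have TI := fun (f g : ℝ × ℝ → ℝ) (σ : ℝ) (hf : Measurable f) (hfM : ∀ p, |f p| ≤ M) (hg : ContDiff ℝ 1 g)
      (hg0 : ∀ q : ℝ × ℝ, q.1 ∉ Icc a b → g q = 0) =>
    test_integrable H hc1 hc2 hC hζ hζ1 hκ hs σ 0 m hf (fun p _ => hfM p) hg ha hb hg0
  have a1 : (∫ p in Ioo 0 ζ ×ˢ Ioo 0 m, w p * (pdx (fun q => ω q + ω1 q) p + 1 * (c p * pdy (fun q => ω q + ω1 q) p) + 1 * (pdy c p * (ω p + ω1 p))))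
      = (∫ p in Ioo 0 ζ ×ˢ Ioo 0 m, I p) + ∫ p in Ioo 0 ζ ×ˢ Ioo 0 m, I (p.1, p.2 - 2 * m) := by
    have q1 : ∫ p in Ioo 0 ζ ×ˢ Ioo 0 m, I p = ∫ p in Ioo 0 ζ ×ˢ Ioo 0 m, w p * (pdx ω p + 1 * (c p * pdy ω p) + 1 * (pdy c p * ω p)) := by
      apply setIntegral_congr_fun (measurableSet_Ioo.prod measurableSet_Ioo)
      rintro ⟨x, y⟩ hp
      simp only [hI, tr, hv, vext_pos hm hp.2, one_mul]
    have q2 : ∫ p in Ioo 0 ζ ×ˢ Ioo 0 m, I (p.1, p.2 - 2 * m) = ∫ p in Ioo 0 ζ ×ˢ Ioo 0 m, w p * (pdx ω1 p + 1 * (c p * pdy ω1 p) + 1 * (pdy c p * ω1 p)) := by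
      apply setIntegral_congr_fun (measurableSet_Ioo.prod measurableSet_Ioo)
      rintro ⟨x, y⟩ hp
      have f1 : v (x, y - 2 * m) = w (x, y) := by
        rw [hv, ← vext_per hm, sub_add_cancel, vext_pos hm hp.2]
      have f2 : c (x, y - 2 * m) = c (x, y) := by rw [← H.per, sub_add_cancel]
      have f3 : pdx ω1 (x, y) = pdx ω (x, y - 2 * m) := rfl
      have f4 : pdy ω1 (x, y) = pdy ω (x, y - 2 * m) := by
        show deriv (fun t => ω (x, t - 2 * m)) y = deriv (fun t => ω (x, t)) (y - 2 * m)
        rw [deriv_comp_sub_const (f := fun t => ω (x, t))]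
      have f6 : ω1 (x, y) = ω (x, y - 2 * m) := rfl
      simp only [hI, tr, one_mul, f1, f2, f3, f4, H.pdy_per, f6]
    rw [q1, q2, ← integral_add (TI w ω 1 hw hwM hω h1) (TI w ω1 1 hw hwM k1 n1)]
    congr 1; ext p
    rw [xadd _ _ hω k1, yadd _ _ hω k1]
    ring
  have a2 : (∫ p in Ioo 0 ζ ×ˢ Ioo 0 m, z p * (pdx (fun q => ω2 q + ω3 q) p + (-1) * (c p * pdy (fun q => ω2 q + ω3 q) p) + (-1) * (pdy c p * (ω2 p + ω3 p))))
      = (∫ p in Ioo 0 ζ ×ˢ Ioo 0 m, I (p.1, -p.2)) + ∫ p in Ioo 0 ζ ×ˢ Ioo 0 m, I (p.1, 2 * m - p.2) := by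
    have gx : ∀ x y, pdx (fun q => -ω (q.1, q.2)) (x, y) = -pdx ω (x, y) := fun x y =>
      (hasDerivAt_pdx (dω (x, y))).neg.deriv
    have q1 : ∫ p in Ioo 0 ζ ×ˢ Ioo 0 m, I (p.1, -p.2) = ∫ p in Ioo 0 ζ ×ˢ Ioo 0 m, z p * (pdx ω2 p + (-1) * (c p * pdy ω2 p) + (-1) * (pdy c p * ω2 p)) := by
      apply setIntegral_congr_fun (measurableSet_Ioo.prod measurableSet_Ioo)
      rintro ⟨x, y⟩ hp
      have f1 : v (x, -y) = -z (x, y) := vext_neg hm hp.2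
      have f3 : pdx ω2 (x, y) = -pdx ω (x, -y) := (hasDerivAt_pdx (dω (x, -y))).neg.deriv
      have f4 : pdy ω2 (x, y) = pdy ω (x, -y) := by
        have := (HasDerivAt.comp_const_sub (f := fun t => ω (x, t)) 0 y (f' := pdy ω (x, -y))
          (by rw [zero_sub]; exact hasDerivAt_pdy (dω (x, -y)))).neg
        rw [neg_neg] at this
        have e := this.deriv
        simp only [zero_sub] at e
        exact e
      have f6 : ω2 (x, y) = -ω (x, -y) := rfl
      simp only [hI, tr, f1, f3, f4, H.pdy_odd, H.even, f6]
      ring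
    have q2 : ∫ p in Ioo 0 ζ ×ˢ Ioo 0 m, I (p.1, 2 * m - p.2) = ∫ p in Ioo 0 ζ ×ˢ Ioo 0 m, z p * (pdx ω3 p + (-1) * (c p * pdy ω3 p) + (-1) * (pdy c p * ω3 p)) := by
      apply setIntegral_congr_fun (measurableSet_Ioo.prod measurableSet_Ioo)
      rintro ⟨x, y⟩ hp
      have e2 : 2 * m - y = -y + 2 * m := by ring
      have f1 : v (x, 2 * m - y) = -z (x, y) := by rw [e2, hv, vext_per hm, vext_neg hm hp.2]
      have f2 : c (x, 2 * m - y) = c (x, y) := by rw [e2, H.per, H.even]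
      have f5 : pdy c (x, 2 * m - y) = -pdy c (x, y) := by
        have := H.pdy_per x (2 * m - y)
        rw [← this, show 2 * m - y - 2 * m = -y by ring, H.pdy_odd]
      have f3 : pdx ω3 (x, y) = -pdx ω (x, 2 * m - y) := (hasDerivAt_pdx (dω (x, 2 * m - y))).neg.deriv
      have f4 : pdy ω3 (x, y) = pdy ω (x, 2 * m - y) := by
        have := (HasDerivAt.comp_const_sub (f := fun t => ω (x, t)) (2 * m) y (f' := pdy ω (x, 2 * m - y))
          (hasDerivAt_pdy (dω (x, 2 * m - y)))).neg
        rw [neg_neg] at this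
        exact this.deriv
      have f6 : ω3 (x, y) = -ω (x, 2 * m - y) := rfl
      simp only [hI, tr, f1, f2, f3, f4, f5, f6]
      ring
    rw [q1, q2, ← integral_add (TI z ω2 (-1) hz hzM k2 n2) (TI z ω3 (-1) hz hzM k3 n3)]
    congr 1; ext p
    rw [xadd _ _ k2 k3, yadd _ _ k2 k3]
    ring
  rw [a1, a2] at key
  rw [e1, s1, s2, s3]
  linarith
end


open Real Set MeasureTheory Filter Topology
section
variable {ζ m κ s c1 c2 C : ℝ} {c w z : ℝ × ℝ → ℝ}

lemma energy_eq (hm : 0 < m) {M : ℝ} (hw : Measurable w) (hz : Measurable z)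
    (hwM : ∀ p, |w p| ≤ M) (hzM : ∀ p, |z p| ≤ M) (x : ℝ) :
    ∫ y in (-m)..m, vext m w z (x, y) ^ 2 = ∫ y in Ioo 0 m, (w (x, y) ^ 2 + z (x, y) ^ 2) := by
  have mv := vext_meas m hw hz
  have bv : ∀ p, |vext m w z p| ≤ M := vext_bdd hwM hzM
  have sq_bd : ∀ f : ℝ × ℝ → ℝ, (∀ p, |f p| ≤ M) → ∀ p, ‖f p ^ 2‖ ≤ M ^ 2 := by
    intro f hf p
    rw [Real.norm_eq_abs, abs_pow]
    exact pow_le_pow_left₀ (abs_nonneg _) (hf p) 2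
  have ii : ∀ f : ℝ × ℝ → ℝ, Measurable f → (∀ p, |f p| ≤ M) → ∀ a b : ℝ,
      IntegrableOn (fun y => f (x, y) ^ 2) (Ioo a b) := by
    intro f hf hfM a b
    refine ⟨?_, HasFiniteIntegral.of_bounded (C := M ^ 2) (Eventually.of_forall fun y => sq_bd f hfM _)⟩
    exact (by fun_prop : Measurable fun y => f (x, y) ^ 2).aestronglyMeasurable
  have iv : ∀ a b : ℝ, a ≤ b → IntervalIntegrable (fun y => vext m w z (x, y) ^ 2) volume a b := by
    intro a b hab
    rw [intervalIntegrable_iff_integrableOn_Ioo_of_le hab]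
    exact ii _ mv bv a b
  rw [← intervalIntegral.integral_add_adjacent_intervals (iv (-m) 0 (by linarith)) (iv 0 m hm.le)]
  have e1 : ∫ y in (-m)..0, vext m w z (x, y) ^ 2 = ∫ y in Ioo 0 m, z (x, y) ^ 2 := by
    have := intervalIntegral.integral_comp_neg (a := 0) (b := m) (fun y => vext m w z (x, y) ^ 2)
    rw [neg_zero] at this
    rw [← this, intervalIntegral.integral_of_le hm.le, integral_Ioc_eq_integral_Ioo]
    apply setIntegral_congr_fun measurableSet_Ioo
    intro y hy
    simp only [vext_neg hm hy, neg_sq]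
  have e2 : ∫ y in 0..m, vext m w z (x, y) ^ 2 = ∫ y in Ioo 0 m, w (x, y) ^ 2 := by
    rw [intervalIntegral.integral_of_le hm.le, integral_Ioc_eq_integral_Ioo]
    apply setIntegral_congr_fun measurableSet_Ioo
    intro y hy
    simp only [vext_pos hm hy]
  rw [e1, e2, integral_add (ii w hw hwM 0 m) (ii z hz hzM 0 m), add_comm]

lemma sonic_unique_zero (H : Coef ζ m κ s c1 c2 C c) (hc1 : 0 < c1) (hc2 : 0 < c2) (hC : 0 < C) (hm : 0 < m)
    (hζ : 0 < ζ) (hζ1 : ζ ≤ 1) (hκ : 1 ≤ κ) (hs : 0 < s) {M : ℝ} (hw : Measurable w) (hz : Measurable z)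
    (hwM : ∀ p, |w p| ≤ M) (hzM : ∀ p, |z p| ≤ M) (h : WeakWZ ζ m c w z) (hV : VanishAtSonic ζ m w z) :
    ∀ᵐ p ∂(volume.restrict (Ioo (0 : ℝ) ζ ×ˢ Ioo (0 : ℝ) m)), w p = 0 ∧ z p = 0 := by
  have hWV := weakV_of_WZ H hc1 hc2 hC hm hζ hζ1 hκ hs hw hz hwM hzM h
  obtain ⟨good, hgood, hen⟩ := energy_ineq H hc1 hc2 hC hm hζ1 hκ hs (vext_meas m hw hz)
    (vext_bdd hwM hzM) (vext_per hm) hWV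
  simp only [energy_eq hm hw hz hwM hzM] at hen
  set e : ℝ → ℝ := fun x => ∫ y in Ioo 0 m, (w (x, y) ^ 2 + z (x, y) ^ 2) with he
  have e_nonneg : ∀ x, 0 ≤ e x := fun x => integral_nonneg fun y => by positivity
  -- smallness near the sonic line
  have small : ∀ η > 0, ∃ φ1, 0 < φ1 ∧ φ1 ≤ ζ ∧ ∀ᵐ x ∂(volume.restrict (Ioo 0 φ1)), e x ≤ 2 * η ^ 2 * m := by
    intro η hη
    obtain ⟨φ0, hφ0, hae⟩ := hV η hη
    refine ⟨min φ0 ζ, lt_min hφ0 hζ, min_le_right _ _, ?_⟩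
    rw [Measure.volume_eq_prod, ← Measure.prod_restrict] at hae
    filter_upwards [Measure.ae_ae_of_ae_prod hae] with x hx
    have hb := norm_setIntegral_le_of_norm_le_const_ae (μ := volume) (s := Ioo 0 m) (C := 2 * η ^ 2)
      (f := fun y => w (x, y) ^ 2 + z (x, y) ^ 2) (by simp) (by
        filter_upwards [hx] with y hy
        rw [Real.norm_eq_abs, abs_of_nonneg (by positivity), ← sq_abs (w (x, y)), ← sq_abs (z (x, y))]
        have h1 := pow_le_pow_left₀ (abs_nonneg _) hy.1 2
        have h2 := pow_le_pow_left₀ (abs_nonneg _) hy.2 2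
        linarith)
    have : volume.real (Ioo 0 m) = m := by simp [Measure.real, hm.le]
    rw [this] at hb
    exact (le_abs_self _).trans hb
  have ezero : ∀ᵐ b ∂(volume.restrict (Ioo 0 ζ)), e b = 0 := by
    filter_upwards [ae_restrict_of_ae hgood, ae_restrict_mem measurableSet_Ioo] with b hb hbI
    have key : ∀ η > 0, Real.exp (-(C / s)) * e b ≤ 2 * η ^ 2 * m := by
      intro η hη
      obtain ⟨φ1, hφ1, hφζ, hae⟩ := small η hη
      have hmin : 0 < min φ1 b := lt_min hφ1 hbI.1
      have hne : (volume.restrict (Ioo 0 (min φ1 b))) ≠ 0 := by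
        rw [Ne, Measure.restrict_eq_zero]
        simp [hmin]
        exact ⟨hφ1, hbI.1⟩
      have hne' : (ae (volume.restrict (Ioo 0 (min φ1 b)))).NeBot := ae_neBot.2 hne
      have hsub : Ioo 0 (min φ1 b) ⊆ Ioo 0 φ1 := Ioo_subset_Ioo_right (min_le_left _ _)
      obtain ⟨a, ha1, ha2, ha3⟩ := ((ae_restrict_of_ae_restrict_of_subset hsub hae).and
        ((ae_restrict_of_ae hgood).and (ae_restrict_mem measurableSet_Ioo))).exists
      exact (hen a b ha2 hb ha3.1 (ha3.2.trans_le (min_le_right _ _)) hbI.2).trans ha1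
    have hle : Real.exp (-(C / s)) * e b ≤ 0 := by
      have t : Tendsto (fun η : ℝ => 2 * η ^ 2 * m) (𝓝[>] 0) (𝓝 0) := by
        have : Tendsto (fun η : ℝ => 2 * η ^ 2 * m) (𝓝 0) (𝓝 (2 * 0 ^ 2 * m)) :=
          (by fun_prop : Continuous fun η : ℝ => 2 * η ^ 2 * m).tendsto 0
        simp only [ne_eq, OfNat.ofNat_ne_zero, not_false_eq_true, zero_pow, mul_zero, zero_mul] at this
        exact this.mono_left nhdsWithin_le_nhds
      refine ge_of_tendsto t ?_
      filter_upwards [self_mem_nhdsWithin] with η hη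
      exact key η hη
    have := e_nonneg b
    have hp := Real.exp_pos (-(C / s))
    nlinarith
  have hintg : IntegrableOn (fun p => w p ^ 2 + z p ^ 2) (Ioo 0 ζ ×ˢ Ioo 0 m) := by
    have hfin : IsFiniteMeasure (volume.restrict (Ioo 0 ζ ×ˢ Ioo 0 m)) :=
      isFiniteMeasure_restrict.2 (volume_rect_lt_top _ _ _ _).ne
    refine ⟨(by fun_prop : Measurable fun p => w p ^ 2 + z p ^ 2).aestronglyMeasurable,
      HasFiniteIntegral.of_bounded (C := 2 * M ^ 2) (Eventually.of_forall fun p => ?_)⟩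
    rw [Real.norm_eq_abs, abs_of_nonneg (by positivity), ← sq_abs (w p), ← sq_abs (z p)]
    have h1 := pow_le_pow_left₀ (abs_nonneg _) (hwM p) 2
    have h2 := pow_le_pow_left₀ (abs_nonneg _) (hzM p) 2
    linarith
  have hz0 : ∫ p in Ioo 0 ζ ×ˢ Ioo 0 m, (w p ^ 2 + z p ^ 2) = 0 := by
    rw [setIntegral_rect hintg]
    exact integral_eq_zero_of_ae ezero
  have := (integral_eq_zero_iff_of_nonneg (fun p => by positivity) hintg).1 hz0
  filter_upwards [this] with p hp
  have hp' : w p ^ 2 + z p ^ 2 = 0 := hp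
  constructor <;> nlinarith [sq_nonneg (w p), sq_nonneg (z p)]
end


open Real Set MeasureTheory Filter Topology

lemma hyp_convert {γ ζ m : ℝ} {Qt c : ℝ × ℝ → ℝ} {hb : ℝ → ℝ} (hm : 0 < m)
    (hc : ∀ p ∈ Icc 0 ζ ×ˢ Icc 0 m, √(bfun γ (Qt p)) = c p)
    (hpc : ∀ᵐ p ∂(volume.restrict (Ioo (0 : ℝ) ζ ×ˢ Ioo (0 : ℝ) m)),
        1 / 2 * (√(bfun γ (Qt p)))⁻¹ * pfun γ (Qt p) * pdy Qt p = pdy c p) (W Z ξ η : ℝ × ℝ → ℝ) :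
    (∫ p in Ioo (0 : ℝ) ζ ×ˢ Ioo (0 : ℝ) m,
        (W p * pdx ξ p + Real.sqrt (bfun γ (Qt p)) * W p * pdy ξ p
          + 1 / 2 * (Real.sqrt (bfun γ (Qt p)))⁻¹ * pfun γ (Qt p) * pdy Qt p * W p * ξ p
          + (fun _ => 0) p * ξ p))
    + (∫ p in Ioo (0 : ℝ) ζ ×ˢ Ioo (0 : ℝ) m,
        (Z p * pdx η p - Real.sqrt (bfun γ (Qt p)) * Z p * pdy η p
          - 1 / 2 * (Real.sqrt (bfun γ (Qt p)))⁻¹ * pfun γ (Qt p) * pdy Qt p * Z p * η p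
          + (fun _ => 0) p * η p))
    - (∫ φ in Ioo (0 : ℝ) ζ, Real.sqrt (bfun γ (Qt (φ, m))) * hb φ * ξ (φ, m))
    = (∫ p in Ioo 0 ζ ×ˢ Ioo 0 m, W p * (pdx ξ p + 1 * (c p * pdy ξ p) + 1 * (pdy c p * ξ p)))
    + (∫ p in Ioo 0 ζ ×ˢ Ioo 0 m, Z p * (pdx η p + (-1) * (c p * pdy η p) + (-1) * (pdy c p * η p)))
    - (∫ φ in Ioo 0 ζ, c (φ, m) * hb φ * ξ (φ, m)) := by
  have hmem := ae_restrict_mem (μ := (volume : Measure (ℝ × ℝ)))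
    ((measurableSet_Ioo (a := (0 : ℝ)) (b := ζ)).prod (measurableSet_Ioo (a := (0 : ℝ)) (b := m)))
  congr 1
  · congr 1
    · apply integral_congr_ae
      filter_upwards [hpc, hmem] with p hp hpm
      rw [hp, hc p ⟨Ioo_subset_Icc_self hpm.1, Ioo_subset_Icc_self hpm.2⟩]
      ring
    · apply integral_congr_ae
      filter_upwards [hpc, hmem] with p hp hpm
      rw [hp, hc p ⟨Ioo_subset_Icc_self hpm.1, Ioo_subset_Icc_self hpm.2⟩]
      ring
  · apply setIntegral_congr_fun measurableSet_Ioo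
    intro φ hφ
    simp only [hc (φ, m) ⟨Ioo_subset_Icc_self hφ, ⟨hm.le, le_refl m⟩⟩]

/-- well-posedness of the homogeneous singular characteristic
system with boundary datum `h̃` (Lemma `lemma-0`). -/
theorem stmt_18 (γ : ℝ) (hγ : 1 < γ) (lam m μ1 μ2 μ3 μ4 : ℝ)
    (hlam : 2 < lam) (hm : 0 < m)
    (hμ1 : 0 < μ1) (hμ12 : μ1 ≤ μ2) (hμ3 : 0 < μ3) (hμ34 : μ3 ≤ μ4) :
    ∃ μ6 μ7 : ℝ, 0 < μ6 ∧ μ6 ≤ μ7 ∧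
    ∀ ζ β1 β2 β3 : ℝ, 0 < ζ → ζ ≤ 1 → 0 < β1 → β1 ≤ β2 → 0 < β3 →
    ∀ Qt : ℝ × ℝ → ℝ, QtOK γ lam ζ m μ1 μ2 β1 β2 β3 Qt →
    ∀ hb : ℝ → ℝ, ContinuousOn hb (Icc 0 ζ) → ContDiffOn ℝ 1 hb (Ioo 0 ζ) →
      (∀ φ ∈ Ioo (0 : ℝ) ζ,
        μ3 * φ ^ (5 * lam / 4 + 1 / 2) ≤ hb φ ∧
        hb φ ≤ μ4 * φ ^ (5 * lam / 4 + 1 / 2) ∧ 0 ≤ deriv hb φ) →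
    ∃ W Z : ℝ × ℝ → ℝ,
      (Measurable W ∧ Measurable Z ∧
        ∃ M : ℝ, ∀ p ∈ Ioo (0 : ℝ) ζ ×ˢ Ioo (0 : ℝ) m, |W p| ≤ M ∧ |Z p| ≤ M) ∧
      HypWeakSol γ ζ m Qt (fun _ => 0) (fun _ => 0) hb W Z ∧
      VanishAtSonic ζ m W Z ∧
      (∀ᵐ p ∂(volume.restrict (Ioo (0 : ℝ) ζ ×ˢ Ioo (0 : ℝ) m)),
        (-μ7 * p.1 ^ (lam + 1) ≤ W p ∧ W p ≤ -μ6 * p.1 ^ (lam + 1)) ∧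
        (μ6 * p.1 ^ (lam + 1) ≤ Z p ∧ Z p ≤ μ7 * p.1 ^ (lam + 1)) ∧
        (0 ≤ W p + Z p ∧ W p + Z p ≤ μ4 * p.1 ^ (5 * lam / 4 + 1 / 2))) ∧
      (∀ W' Z' : ℝ × ℝ → ℝ,
        (Measurable W' ∧ Measurable Z' ∧
          ∃ M : ℝ, ∀ p ∈ Ioo (0 : ℝ) ζ ×ˢ Ioo (0 : ℝ) m, |W' p| ≤ M ∧ |Z' p| ≤ M) →
        HypWeakSol γ ζ m Qt (fun _ => 0) (fun _ => 0) hb W' Z' →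
        VanishAtSonic ζ m W' Z' →
        ∀ᵐ p ∂(volume.restrict (Ioo (0 : ℝ) ζ ×ˢ Ioo (0 : ℝ) m)),
          W' p = W p ∧ Z' p = Z p) := by
  obtain ⟨c1, c2, hc1, hc2, hcoef⟩ := coef_exists hγ hlam hm hμ1 hμ12
  have hμ4 : 0 < μ4 := lt_of_lt_of_le hμ3 hμ34
  have hlam0 : 0 < lam := by linarith
  set κ := (lam + 2) / 4 with hκdef
  set s := lam / 4 - 1 / 2 with hsdef
  have hκ : 1 ≤ κ := by rw [hκdef]; linarith
  have hs : 0 < s := by rw [hsdef]; linarith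
  have hκl : κ ≤ lam + 1 := by rw [hκdef]; linarith
  have hexp : 5 * lam / 4 + 1 / 2 = lam + κ := by rw [hκdef]; ring
  set μ6 := μ3 / (2 * m / c1 * (lam + 1)) * Real.exp (-(2 * m * (1 / c1))) ^ (lam + 1) with hdefμ6
  set μu := μ4 * (1 + 1 / (2 * m / c2)) with hdefμu
  have hμ6 : 0 < μ6 := by rw [hdefμ6]; positivity
  refine ⟨μ6, max μu μ6, hμ6, le_max_right _ _, ?_⟩
  set μ7 := max μu μ6 with hdefμ7
  have hμ7 : 0 < μ7 := hμ6.trans_le (le_max_right _ _)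
  intro ζ β1 β2 β3 hζ hζ1 hβ1 hβ12 hβ3 Qt hQt hb hbc hbd hbb
  obtain ⟨C, hC, c, H, hcQ, hcp⟩ := hcoef ζ β1 β2 β3 hζ hζ1 hβ1 hβ12 hβ3 Qt hQt
  have hmono : MonotoneOn hb (Ioo 0 ζ) := by
    apply monotoneOn_of_deriv_nonneg (convex_Ioo 0 ζ) (hbc.mono Ioo_subset_Icc_self)
    · rw [interior_Ioo]; exact hbd.differentiableOn one_ne_zero
    · rw [interior_Ioo]; exact fun x hx => (hbb x hx).2.2
  simp only [hexp] at hbb ⊢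
  obtain ⟨T, G, hTL, hTI, hTd, hG, hGb, hGs, hGh⟩ := label_exists H hc1 hc2 hC hm hζ hζ1 hκ hs hlam0 hμ3 hμ4
    (hbc.mono Ioo_subset_Icc_self) hmono (fun t ht => ⟨(hbb t ht).1, (hbb t ht).2.1⟩)
  set S : Set (ℝ × ℝ) := Ioo (0 : ℝ) ζ ×ˢ Ioo (0 : ℝ) m with hS
  have mS : MeasurableSet S := measurableSet_Ioo.prod measurableSet_Ioo
  have hlow : ∀ x t, t ∈ Icc (-m) m → x ∈ Ioo 0 ζ → μ6 * x ^ (lam + 1) ≤ G (T (x, t)) :=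
    fun x t ht hx => (hGb x t ht hx).1
  have hupp : ∀ x t, t ∈ Icc (-m) m → x ∈ Ioo 0 ζ → G (T (x, t)) ≤ μ7 * x ^ (lam + 1) :=
    fun x t ht hx => (hGb x t ht hx).2.trans
      (mul_le_mul_of_nonneg_right (le_max_left _ _) (Real.rpow_nonneg hx.1.le _))
  have habs : ∀ x t, t ∈ Icc (-m) m → x ∈ Ioo 0 ζ → |G (T (x, t))| ≤ μ7 * x ^ (lam + 1) := by
    intro x t ht hx
    have h1 := hlow x t ht hx
    have h2 : 0 ≤ μ6 * x ^ (lam + 1) := mul_nonneg hμ6.le (Real.rpow_nonneg hx.1.le _)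
    rw [abs_of_nonneg (h2.trans h1)]
    exact hupp x t ht hx
  have memn : ∀ y ∈ Ioo 0 m, -y ∈ Icc (-m) m := fun y hy => ⟨by linarith [hy.2], by linarith [hy.1]⟩
  have memp : ∀ y ∈ Ioo 0 m, y ∈ Icc (-m) m := fun y hy => ⟨by linarith [hy.1], by linarith [hy.2]⟩
  have hpow : ∀ x ∈ Ioo 0 ζ, x ^ (lam + 1) ≤ x := by
    intro x hx
    have := Real.rpow_le_rpow_of_exponent_ge hx.1 (hx.2.le.trans hζ1) (by linarith : (1 : ℝ) ≤ lam + 1)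
    rwa [Real.rpow_one] at this
  set W : ℝ × ℝ → ℝ := S.indicator fun p => -G (T (p.1, -p.2)) with hW
  set Z : ℝ × ℝ → ℝ := S.indicator fun p => G (T (p.1, p.2)) with hZ
  have Wv : ∀ p ∈ S, W p = -G (T (p.1, -p.2)) := fun p hp => indicator_of_mem hp _
  have Zv : ∀ p ∈ S, Z p = G (T (p.1, p.2)) := fun p hp => indicator_of_mem hp _
  have mind : ∀ f : ℝ × ℝ → ℝ, ContinuousOn f S → Measurable (S.indicator f) := by
    intro f hf
    classical
    rw [← Set.piecewise_eq_indicator]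
    exact hf.measurable_piecewise continuousOn_const mS
  have mW : Measurable W := by
    apply mind
    obtain ⟨L, hL⟩ := hTL
    refine (hG.comp (hL.continuousOn.comp (f := fun p : ℝ × ℝ => (p.1, -p.2)) (by fun_prop) ?_) ?_).neg
    · intro p hp; exact ⟨trivial, memn _ hp.2⟩
    · intro p hp; exact hTI _ _ (memn _ hp.2) hp.1
  have mZ : Measurable Z := by
    apply mind
    obtain ⟨L, hL⟩ := hTL
    refine hG.comp (hL.continuousOn.comp (f := fun p : ℝ × ℝ => (p.1, p.2)) (by fun_prop) ?_) ?_
    · intro p hp; exact ⟨trivial, memp _ hp.2⟩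
    · intro p hp; exact hTI _ _ (memp _ hp.2) hp.1
  have bW : ∀ p ∈ S, |W p| ≤ μ7 * p.1 := by
    intro p hp
    rw [Wv p hp, abs_neg]
    exact (habs _ _ (memn _ hp.2) hp.1).trans (mul_le_mul_of_nonneg_left (hpow _ hp.1) hμ7.le)
  have bZ : ∀ p ∈ S, |Z p| ≤ μ7 * p.1 := by
    intro p hp
    rw [Zv p hp]
    exact (habs _ _ (memp _ hp.2) hp.1).trans (mul_le_mul_of_nonneg_left (hpow _ hp.1) hμ7.le)
  have bM : ∀ p ∈ S, |W p| ≤ μ7 ∧ |Z p| ≤ μ7 := by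
    intro p hp
    have : μ7 * p.1 ≤ μ7 := mul_le_of_le_one_right hμ7.le (hp.1.2.le.trans hζ1)
    exact ⟨(bW p hp).trans this, (bZ p hp).trans this⟩
  have hsol : HypWeakSol γ ζ m Qt (fun _ => 0) (fun _ => 0) hb W Z := by
    intro ξ η hξ hη h0 hbd'
    rw [hyp_convert hm hcQ hcp]
    have key := weak_exists H hc1 hc2 hC hm hζ hζ1 hκ hs hlam0 hκl hμ7.le hTL hTI hTd hG habs hGh hξ hη h0 hbd'
    rw [← integral_neg] at key
    refine Eq.trans ?_ key
    congr 2
    · apply setIntegral_congr_fun mS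
      intro p hp
      simp only [Wv p hp, neg_one_mul]
      ring
    · apply setIntegral_congr_fun mS
      intro p hp
      simp only [Zv p hp, one_mul]
      ring
  have hvan : VanishAtSonic ζ m W Z := by
    intro η hη
    refine ⟨η / μ7, by positivity, ?_⟩
    refine (ae_restrict_mem (measurableSet_Ioo.prod measurableSet_Ioo)).mono ?_
    intro p hp
    have hpS : p ∈ S := ⟨⟨hp.1.1, hp.1.2.trans_le (min_le_right _ _)⟩, hp.2⟩
    have h1 : p.1 ≤ η / μ7 := hp.1.2.le.trans (min_le_left _ _)
    have h2 : μ7 * p.1 ≤ η := by rwa [le_div_iff₀ hμ7, mul_comm] at h1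
    exact ⟨(bW p hpS).trans h2, (bZ p hpS).trans h2⟩
  refine ⟨W, Z, ⟨mW, mZ, μ7, bM⟩, hsol, hvan, ?_, ?_⟩
  · refine (ae_restrict_mem mS).mono ?_
    intro p hp
    rw [Wv p hp, Zv p hp]
    have a1 := hlow _ _ (memn _ hp.2) hp.1
    have a2 := hupp _ _ (memn _ hp.2) hp.1
    have a3 := hlow _ _ (memp _ hp.2) hp.1
    have a4 := hupp _ _ (memp _ hp.2) hp.1
    have a5 := hGs p.1 p.2 (Ioo_subset_Icc_self hp.2) hp.1
    exact ⟨⟨by linarith, by linarith⟩, ⟨a3, a4⟩, by linarith [a5.1], by linarith [a5.2]⟩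
  · rintro W' Z' ⟨mW', mZ', M, hM⟩ hsol' hvan'
    set w : ℝ × ℝ → ℝ := S.indicator fun p => W' p - W p with hw
    set z : ℝ × ℝ → ℝ := S.indicator fun p => Z' p - Z p with hz
    have wv : ∀ p ∈ S, w p = W' p - W p := fun p hp => indicator_of_mem hp _
    have zv : ∀ p ∈ S, z p = Z' p - Z p := fun p hp => indicator_of_mem hp _
    have mw : Measurable w := (mW'.sub mW).indicator mS
    have mz : Measurable z := (mZ'.sub mZ).indicator mS
    have hp0 : ((ζ / 2, m / 2) : ℝ × ℝ) ∈ S := ⟨⟨by positivity, by simp only; linarith⟩, ⟨by positivity, by simp only; linarith⟩⟩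
    have hM0 : 0 ≤ M := (abs_nonneg _).trans (hM _ hp0).1
    have bw : ∀ p, |w p| ≤ M + μ7 := by
      intro p
      by_cases hp : p ∈ S
      · rw [wv p hp]
        exact (abs_sub _ _).trans (add_le_add (hM p hp).1 (bM p hp).1)
      · rw [hw, indicator_of_notMem hp, abs_zero]; positivity
    have bz : ∀ p, |z p| ≤ M + μ7 := by
      intro p
      by_cases hp : p ∈ S
      · rw [zv p hp]
        exact (abs_sub _ _).trans (add_le_add (hM p hp).2 (bM p hp).2)
      · rw [hz, indicator_of_notMem hp, abs_zero]; positivity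
    have hWZ : WeakWZ ζ m c w z := by
      intro ξ η hξ hη a b ha hb' h1 h2 hbd'
      have hζn : ∀ ψ : ℝ, ((ζ, ψ) : ℝ × ℝ).1 ∉ Icc a b := fun ψ hh => absurd hh.2 (not_le.2 hb')
      have k1 := hsol' ξ η hξ hη (fun ψ _ => ⟨h1 _ (hζn ψ), h2 _ (hζn ψ)⟩) (fun φ _ => hbd' φ)
      have k2 := hsol ξ η hξ hη (fun ψ _ => ⟨h1 _ (hζn ψ), h2 _ (hζn ψ)⟩) (fun φ _ => hbd' φ)
      rw [hyp_convert hm hcQ hcp] at k1 k2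
      have i1 := test_integrable H hc1 hc2 hC hζ hζ1 hκ hs 1 0 m mW' (fun p hp => (hM p hp).1) hξ ha hb' h1
      have i2 := test_integrable H hc1 hc2 hC hζ hζ1 hκ hs 1 0 m mW (fun p hp => (bM p hp).1) hξ ha hb' h1
      have i3 := test_integrable H hc1 hc2 hC hζ hζ1 hκ hs (-1) 0 m mZ' (fun p hp => (hM p hp).2) hη ha hb' h2
      have i4 := test_integrable H hc1 hc2 hC hζ hζ1 hκ hs (-1) 0 m mZ (fun p hp => (bM p hp).2) hη ha hb' h2
      have j1 := integral_sub i1 i2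
      have j2 := integral_sub i3 i4
      have l1 : (∫ p in S, w p * (pdx ξ p + 1 * (c p * pdy ξ p) + 1 * (pdy c p * ξ p)))
          = ∫ p in S, (W' p * (pdx ξ p + 1 * (c p * pdy ξ p) + 1 * (pdy c p * ξ p))
            - W p * (pdx ξ p + 1 * (c p * pdy ξ p) + 1 * (pdy c p * ξ p))) := by
        apply setIntegral_congr_fun mS
        intro p hp
        simp only [wv p hp]
        ring
      have l2 : (∫ p in S, z p * (pdx η p + (-1) * (c p * pdy η p) + (-1) * (pdy c p * η p)))
          = ∫ p in S, (Z' p * (pdx η p + (-1) * (c p * pdy η p) + (-1) * (pdy c p * η p))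
            - Z p * (pdx η p + (-1) * (c p * pdy η p) + (-1) * (pdy c p * η p))) := by
        apply setIntegral_congr_fun mS
        intro p hp
        simp only [zv p hp]
        ring
      rw [l1, l2, j1, j2]
      linarith
    have hV : VanishAtSonic ζ m w z := by
      intro η hη
      obtain ⟨f1, hf1, g1⟩ := hvan' (η / 2) (by positivity)
      obtain ⟨f2, hf2, g2⟩ := hvan (η / 2) (by positivity)
      refine ⟨min f1 f2, lt_min hf1 hf2, ?_⟩
      have s1 : Ioo (0 : ℝ) (min (min f1 f2) ζ) ×ˢ Ioo (0 : ℝ) m ⊆ Ioo (0 : ℝ) (min f1 ζ) ×ˢ Ioo (0 : ℝ) m :=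
        prod_mono (Ioo_subset_Ioo_right (min_le_min_right _ (min_le_left _ _))) subset_rfl
      have s2 : Ioo (0 : ℝ) (min (min f1 f2) ζ) ×ˢ Ioo (0 : ℝ) m ⊆ Ioo (0 : ℝ) (min f2 ζ) ×ˢ Ioo (0 : ℝ) m :=
        prod_mono (Ioo_subset_Ioo_right (min_le_min_right _ (min_le_right _ _))) subset_rfl
      filter_upwards [ae_restrict_of_ae_restrict_of_subset s1 g1, ae_restrict_of_ae_restrict_of_subset s2 g2,
        ae_restrict_mem (measurableSet_Ioo.prod measurableSet_Ioo)] with p q1 q2 hp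
      have hpS : p ∈ S := ⟨⟨hp.1.1, hp.1.2.trans_le (min_le_right _ _)⟩, hp.2⟩
      rw [wv p hpS, zv p hpS]
      exact ⟨(abs_sub _ _).trans (by linarith [q1.1, q2.1]), (abs_sub _ _).trans (by linarith [q1.2, q2.2])⟩
    have hfin := sonic_unique_zero H hc1 hc2 hC hm hζ hζ1 hκ hs mw mz bw bz hWZ hV
    filter_upwards [hfin, ae_restrict_mem mS] with p hp hpS
    rw [wv p hpS, zv p hpS] at hp
    exact ⟨by linarith [hp.1], by linarith [hp.2]⟩
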